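/- There exists a constant c > 0 such that for every integer d ≥ 2 and every convex body K ⊆ ℝ^d of unit volume, the limit inferior of n^{-d} · EH^K_{d,d+1}(n) as n → ∞ is at least (2 / ((d+2)(d−1)!)) · (d^{1/4} / (c · log d))^d. -/

import Mathlib

open MeasureTheory Filter

noncomputable section

abbrev Euc (d : ℕ) : Type := EuclideanSpace ℝ (Fin d)

/-- A convex body: compact convex set with nonempty interior. -/
def IsConvexBody {d : ℕ} (K : Set (Euc d)) : Prop :=
  Convex ℝ K ∧ IsCompact K ∧ (interior K).Nonempty

/-- A set of points is in convex position if no point lies in the convex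
hull of the others. -/
def InConvexPosition {d : ℕ} (P : Set (Euc d)) : Prop :=
  ∀ p ∈ P, p ∉ convexHull ℝ (P \ {p})

/-- `H` is a `k`-hole in `S`. -/
def IsHole {d : ℕ} (k : ℕ) (S H : Finset (Euc d)) : Prop :=
  H ⊆ S ∧ H.card = k ∧ InConvexPosition (H : Set (Euc d)) ∧
    ∀ p ∈ S, p ∉ interior (convexHull ℝ (H : Set (Euc d)))

open Classical in
/-- The number of `k`-holes in the point set given by `x`. -/
noncomputable def holeCount (d k n : ℕ) (x : Fin n → Euc d) : ℕ :=
  ((Finset.image x Finset.univ).powerset.filter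
    (fun H => IsHole k (Finset.image x Finset.univ) H)).card

/-- The uniform probability distribution on `K`. -/
noncomputable def unif {d : ℕ} (K : Set (Euc d)) : Measure (Euc d) :=
  (volume K)⁻¹ • volume.restrict K

/-- The expected number of `k`-holes among `n` points drawn uniformly and
independently at random from `K`. -/
noncomputable def EH (d k : ℕ) (K : Set (Euc d)) (n : ℕ) : ℝ :=
  ∫ x : Fin n → Euc d, (holeCount d k n x : ℝ) ∂(Measure.pi fun _ : Fin n => unif K)

/-- The probability that, for `d+2` points chosen uniformly and independently
at random from `K`, one of the points lies in the convex hull of the others. -/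
noncomputable def pSimplex (d : ℕ) (K : Set (Euc d)) : ℝ :=
  ((Measure.pi fun _ : Fin (d + 2) => unif K)
    {x : Fin (d + 2) → Euc d | ∃ i, x i ∈ convexHull ℝ (x '' {j | j ≠ i})}).toReal

/-- The maximum of `pSimplex d K` over all convex bodies `K ⊆ ℝ^d`. -/
noncomputable def pMax (d : ℕ) : ℝ :=
  sSup {p : ℝ | ∃ K : Set (Euc d), IsConvexBody K ∧ p = pSimplex d K}

end

open scoped ENNReal
open ProbabilityTheory

/-- One-dimensional Brunn–Minkowski inequality for midpoints of compact sets. -/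
lemma volume_add_volume_le_of_isCompact {A B C : Set ℝ} (hA : IsCompact A) (hB : IsCompact B)
    (hA0 : A.Nonempty) (hB0 : B.Nonempty)
    (h : ∀ a ∈ A, ∀ b ∈ B, midpoint ℝ a b ∈ C) :
    volume A + volume B ≤ 2 * volume C := by
  obtain ⟨a₀, ha₀, hamax⟩ := hA.exists_isMaxOn hA0 continuousOn_id
  obtain ⟨b₀, hb₀, hbmin⟩ := hB.exists_isMinOn hB0 continuousOn_id
  have key : ∀ s : Set ℝ, volume ((fun x : ℝ => 2⁻¹ * x) ⁻¹' s) = 2 * volume s := by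
    intro s
    rw [Real.volume_preimage_mul_left (by norm_num)]
    norm_num
  have hmid : ∀ a b : ℝ, midpoint ℝ a b = 2⁻¹ * (a + b) := by
    intro a b; rw [midpoint_eq_smul_add]; simp
  set m := 2⁻¹ * (a₀ + b₀) with hm
  have h1 : volume A ≤ 2 * volume (C ∩ Set.Iic m) := by
    have e : volume ((fun x => x + b₀) ⁻¹' ((fun x : ℝ => 2⁻¹ * x) ⁻¹' (C ∩ Set.Iic m))) =
        2 * volume (C ∩ Set.Iic m) := by rw [measure_preimage_add_right, key]
    rw [← e]
    apply measure_mono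
    intro a ha
    refine ⟨?_, ?_⟩
    · have := h a ha b₀ hb₀
      rwa [hmid] at this
    · have : a ≤ a₀ := hamax ha
      simp only [Set.mem_Iic, hm]
      linarith
  have h2 : volume B ≤ 2 * volume (C ∩ Set.Ici m) := by
    have e : volume ((fun x => a₀ + x) ⁻¹' ((fun x : ℝ => 2⁻¹ * x) ⁻¹' (C ∩ Set.Ici m))) =
        2 * volume (C ∩ Set.Ici m) := by rw [measure_preimage_add, key]
    rw [← e]
    apply measure_mono
    intro b hb
    refine ⟨?_, ?_⟩
    · have := h a₀ ha₀ b hb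
      rwa [hmid] at this
    · have : b₀ ≤ b := hbmin hb
      simp only [Set.mem_Ici, hm]
      linarith
  have h3 : volume (C ∩ Set.Ici m) = volume (C ∩ Set.Ioi m) :=
    measure_congr ((ae_eq_refl C).inter Ioi_ae_eq_Ici.symm)
  have h4 : volume (C ∩ Set.Iic m) + volume (C ∩ Set.Ioi m) = volume C := by
    rw [← Set.compl_Iic, ← Set.sdiff_eq, measure_inter_add_sdiff _ measurableSet_Iic]
  calc volume A + volume B ≤ 2 * volume (C ∩ Set.Iic m) + 2 * volume (C ∩ Set.Ici m) :=
        add_le_add h1 h2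
    _ = 2 * volume C := by rw [h3, ← mul_add, h4]

/-- One-dimensional Brunn–Minkowski inequality for midpoints of measurable sets. -/
lemma volume_add_volume_le {A B C : Set ℝ} (hA : MeasurableSet A) (hB : MeasurableSet B)
    (hA0 : A.Nonempty) (hB0 : B.Nonempty)
    (h : ∀ a ∈ A, ∀ b ∈ B, midpoint ℝ a b ∈ C) :
    volume A + volume B ≤ 2 * volume C := by
  obtain ⟨a, ha⟩ := hA0
  obtain ⟨b, hb⟩ := hB0
  rw [hA.measure_eq_iSup_isCompact, hB.measure_eq_iSup_isCompact]
  simp only [iSup_and']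
  refine ENNReal.biSup_add_biSup_le' ⟨∅, by simp⟩ ⟨∅, by simp⟩ ?_
  rintro K₁ ⟨hK₁, hK₁c⟩ K₂ ⟨hK₂, hK₂c⟩
  refine (add_le_add (measure_mono (Set.subset_insert a K₁))
    (measure_mono (Set.subset_insert b K₂))).trans ?_
  refine volume_add_volume_le_of_isCompact (hK₁c.insert a) (hK₂c.insert b)
    (Set.insert_nonempty _ _) (Set.insert_nonempty _ _) ?_
  intro x hx y hy
  exact h x (Set.insert_subset ha hK₁ hx) y (Set.insert_subset hb hK₂ hy)

/-- Additive form of the Prékopa–Leindler inequality on the line for functions with supremum 1. -/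
lemma lintegral_add_lintegral_le_of_sup_one {f g : ℝ → ℝ} {h : ℝ → ℝ≥0∞}
    (hf : Measurable f) (hg : Measurable g) (hh : Measurable h)
    (hf0 : ∀ x, 0 ≤ f x) (hg0 : ∀ x, 0 ≤ g x) (hf1 : ∀ x, f x ≤ 1) (hg1 : ∀ x, g x ≤ 1)
    (hfs : ∀ t < 1, ∃ x, t < f x) (hgs : ∀ t < 1, ∃ x, t < g x)
    (H : ∀ x y, ENNReal.ofReal (f x * g y) ≤ h (midpoint ℝ x y) ^ 2) :
    (∫⁻ x, ENNReal.ofReal (f x)) + ∫⁻ x, ENNReal.ofReal (g x) ≤ 2 * ∫⁻ x, h x := by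
  set k : ℝ → ℝ := fun x => (min (h x) 1).toReal with hk
  have hkm : Measurable k := (hh.min measurable_const).ennreal_toReal
  have hk0 : ∀ x, 0 ≤ k x := fun x => ENNReal.toReal_nonneg
  have hkh : ∀ x, ENNReal.ofReal (k x) ≤ h x := by
    intro x
    rw [hk]
    simp only
    rw [ENNReal.ofReal_toReal (ne_top_of_le_ne_top ENNReal.one_ne_top (min_le_right _ _))]
    exact min_le_left _ _
  have hfgk : ∀ x y, f x * g y ≤ k (midpoint ℝ x y) ^ 2 := by
    intro x y
    have h1 : f x * g y ≤ 1 := mul_le_one₀ (hf1 x) (hg0 y) (hg1 y)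
    rw [hk]
    simp only
    rcases le_total (h (midpoint ℝ x y)) 1 with h2 | h2
    · rw [min_eq_left h2, ← ENNReal.toReal_pow]
      apply (ENNReal.ofReal_le_iff_le_toReal _).1 (H x y)
      exact ENNReal.pow_ne_top (ne_top_of_le_ne_top ENNReal.one_ne_top h2)
    · rw [min_eq_right h2]; simpa using h1
  have key : ∀ t ∈ Set.Ioi (0 : ℝ), volume {x | t < f x} + volume {x | t < g x}
      ≤ 2 * volume {x | t < k x} := by
    intro t ht
    rcases lt_or_ge t 1 with ht1 | ht1
    · refine volume_add_volume_le (measurableSet_lt measurable_const hf)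
        (measurableSet_lt measurable_const hg) (hfs t ht1) (hgs t ht1) ?_
      intro a ha b hb
      simp only [Set.mem_ofPred_eq] at ha hb ⊢
      have ht' : (0 : ℝ) < t := ht
      have : t ^ 2 < k (midpoint ℝ a b) ^ 2 := by
        refine lt_of_lt_of_le ?_ (hfgk a b)
        nlinarith
      exact lt_of_pow_lt_pow_left₀ 2 (hk0 _) this
    · have e1 : {x | t < f x} = ∅ := by
        ext x; simpa using (hf1 x).trans ht1
      have e2 : {x | t < g x} = ∅ := by
        ext x; simpa using (hg1 x).trans ht1
      simp [e1, e2]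
  have L := fun (u : ℝ → ℝ) (hu : Measurable u) (hu0 : ∀ x, 0 ≤ u x) =>
    lintegral_eq_lintegral_meas_lt volume (f := u) (Eventually.of_forall hu0) hu.aemeasurable
  have anti : ∀ u : ℝ → ℝ, Measurable fun t : ℝ => volume {x | t < u x} := by
    intro u
    apply Antitone.measurable
    intro s t hst
    exact measure_mono fun x (hx : t < u x) => lt_of_le_of_lt hst hx
  calc (∫⁻ x, ENNReal.ofReal (f x)) + ∫⁻ x, ENNReal.ofReal (g x)
      = ∫⁻ t in Set.Ioi 0, (volume {x | t < f x} + volume {x | t < g x}) := by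
        rw [L f hf hf0, L g hg hg0, lintegral_add_left (anti f)]
    _ ≤ ∫⁻ t in Set.Ioi 0, 2 * volume {x | t < k x} :=
        setLIntegral_mono ((anti k).const_mul 2) key
    _ = 2 * ∫⁻ x, ENNReal.ofReal (k x) := by
        rw [lintegral_const_mul _ (anti k), L k hkm hk0]
    _ ≤ 2 * ∫⁻ x, h x := by gcongr with x; exact hkh x

/-- Prékopa–Leindler inequality for midpoints, as a property of a measured vector space. -/
def HasPrekopaLeindler (V : Type*) [AddCommGroup V] [Module ℝ V] [MeasurableSpace V]
    (μ : Measure V) : Prop :=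
  ∀ f g h : V → ℝ≥0∞, Measurable f → Measurable g → Measurable h →
    (∀ x y, f x * g y ≤ h (midpoint ℝ x y) ^ 2) →
    (∫⁻ x, f x ∂μ) * (∫⁻ x, g x ∂μ) ≤ (∫⁻ x, h x ∂μ) ^ 2

lemma exists_scaling_of_bounded {f : ℝ → ℝ≥0∞} (hf : Measurable f) {N : ℝ≥0∞} (hN : N ≠ ∞)
    (hfN : ∀ x, f x ≤ N) (hne : ∃ x, f x ≠ 0) :
    ∃ (α : ℝ) (F : ℝ → ℝ), 0 < α ∧ Measurable F ∧ (∀ x, 0 ≤ F x) ∧ (∀ x, F x ≤ 1) ∧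
      (∀ t < 1, ∃ x, t < F x) ∧ ∀ x, f x = ENNReal.ofReal (α * F x) := by
  have hft : ∀ x, f x ≠ ∞ := fun x => ne_top_of_le_ne_top hN (hfN x)
  have hsup : (⨆ x, f x) ≠ ∞ := ne_top_of_le_ne_top hN (iSup_le hfN)
  set α := (⨆ x, f x).toReal with hα
  have hle : ∀ x, (f x).toReal ≤ α := fun x => ENNReal.toReal_mono hsup (le_iSup f x)
  have hα0 : 0 < α := by
    obtain ⟨x, hx⟩ := hne
    exact (ENNReal.toReal_pos hx (hft x)).trans_le (hle x)
  refine ⟨α, fun x => (f x).toReal / α, hα0, hf.ennreal_toReal.div_const _, fun x => by positivity,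
    fun x => (div_le_one hα0).2 (hle x), ?_, ?_⟩
  · intro t ht
    have : ENNReal.ofReal (t * α) < ⨆ x, f x := by
      rw [← ENNReal.ofReal_toReal hsup]
      exact (ENNReal.ofReal_lt_ofReal_iff hα0).2 (by nlinarith)
    obtain ⟨x, hx⟩ := lt_iSup_iff.1 this
    refine ⟨x, (lt_div_iff₀ hα0).2 ?_⟩
    rw [← ENNReal.ofReal_toReal (hft x)] at hx
    exact (ENNReal.ofReal_lt_ofReal_iff'.1 hx).1
  · intro x
    rw [mul_div_cancel₀ _ hα0.ne', ENNReal.ofReal_toReal (hft x)]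

lemma ENNReal.four_mul_le_add_sq (a b : ℝ≥0∞) : 4 * (a * b) ≤ (a + b) ^ 2 := by
  by_cases ha : a = ∞
  · simp [ha]
  by_cases hb : b = ∞
  · simp [hb]
  lift a to NNReal using ha
  lift b to NNReal using hb
  norm_cast
  rw [← NNReal.coe_le_coe]
  push_cast
  nlinarith [sq_nonneg ((a : ℝ) - b)]

lemma prekopaLeindler_real_bounded {f g h : ℝ → ℝ≥0∞} (hf : Measurable f) (hg : Measurable g)
    (hh : Measurable h) {N : ℝ≥0∞} (hN : N ≠ ∞) (hfN : ∀ x, f x ≤ N) (hgN : ∀ x, g x ≤ N)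
    (H : ∀ x y, f x * g y ≤ h (midpoint ℝ x y) ^ 2) :
    (∫⁻ x, f x) * (∫⁻ x, g x) ≤ (∫⁻ x, h x) ^ 2 := by
  by_cases hf0 : ∃ x, f x ≠ 0
  swap
  · push Not at hf0; simp [hf0]
  by_cases hg0 : ∃ x, g x ≠ 0
  swap
  · push Not at hg0; simp [hg0]
  obtain ⟨α, F, hα, hFm, hF0, hF1, hFs, hF⟩ := exists_scaling_of_bounded hf hN hfN hf0
  obtain ⟨β, G, hβ, hGm, hG0, hG1, hGs, hG⟩ := exists_scaling_of_bounded hg hN hgN hg0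
  set c := ENNReal.ofReal (Real.sqrt (α * β)) with hc
  have hc2 : c ^ 2 = ENNReal.ofReal α * ENNReal.ofReal β := by
    rw [hc, ← ENNReal.ofReal_pow (Real.sqrt_nonneg _), Real.sq_sqrt (by positivity),
      ENNReal.ofReal_mul hα.le]
  have hc0 : c ≠ 0 := by rw [hc]; simp; positivity
  have hct : c ≠ ∞ := ENNReal.ofReal_ne_top
  have key := lintegral_add_lintegral_le_of_sup_one (h := fun x => c⁻¹ * h x) hFm hGm
    (hh.const_mul _) hF0 hG0 hF1 hG1 hFs hGs (by
      intro x y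
      have := H x y
      rw [hF, hG, ENNReal.ofReal_mul hα.le, ENNReal.ofReal_mul hβ.le] at this
      rw [mul_pow, ← ENNReal.inv_pow, mul_comm (c ^ 2)⁻¹, ← div_eq_mul_inv,
        ENNReal.le_div_iff_mul_le (Or.inl (by positivity)) (Or.inl (ENNReal.pow_ne_top hct)), hc2,
        ENNReal.ofReal_mul (hF0 x)]
      convert this using 1
      ring)
  rw [lintegral_const_mul _ hh] at key
  have e1 : ∫⁻ x, f x = ENNReal.ofReal α * ∫⁻ x, ENNReal.ofReal (F x) := by
    rw [← lintegral_const_mul _ hFm.ennreal_ofReal]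
    congr with x
    rw [hF, ENNReal.ofReal_mul hα.le]
  have e2 : ∫⁻ x, g x = ENNReal.ofReal β * ∫⁻ x, ENNReal.ofReal (G x) := by
    rw [← lintegral_const_mul _ hGm.ennreal_ofReal]
    congr with x
    rw [hG, ENNReal.ofReal_mul hβ.le]
  rw [e1, e2]
  set a := ∫⁻ x, ENNReal.ofReal (F x)
  set b := ∫⁻ x, ENNReal.ofReal (G x)
  set I := ∫⁻ x, h x
  have h4 : 4 * (a * b) ≤ 4 * (c⁻¹ * I) ^ 2 := by
    calc 4 * (a * b) ≤ (a + b) ^ 2 := ENNReal.four_mul_le_add_sq a b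
      _ ≤ (2 * (c⁻¹ * I)) ^ 2 := by gcongr
      _ = 4 * (c⁻¹ * I) ^ 2 := by ring
  have h5 : a * b ≤ (c⁻¹ * I) ^ 2 := by
    rwa [ENNReal.mul_le_mul_iff_right (by norm_num) (by norm_num)] at h4
  calc ENNReal.ofReal α * a * (ENNReal.ofReal β * b) = c ^ 2 * (a * b) := by rw [hc2]; ring
    _ ≤ c ^ 2 * (c⁻¹ * I) ^ 2 := by gcongr
    _ = (c * c⁻¹) ^ 2 * I ^ 2 := by ring
    _ = I ^ 2 := by rw [ENNReal.mul_inv_cancel hc0 hct]; simp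

theorem hasPrekopaLeindler_real : HasPrekopaLeindler ℝ volume := by
  intro f g h hf hg hh H
  have hmono : ∀ u : ℝ → ℝ≥0∞, Measurable u →
      ∫⁻ x, u x = ⨆ n : ℕ, ∫⁻ x, min (u x) (n : ℝ≥0∞) := by
    intro u hu
    rw [← lintegral_iSup (fun n => hu.min measurable_const)]
    · congr with x
      rw [← inf_iSup_eq, ENNReal.iSup_natCast, inf_top_eq]
    · intro m n hmn x
      exact min_le_min le_rfl (by exact_mod_cast hmn)
  rw [hmono f hf, hmono g hg]
  simp only [ENNReal.iSup_mul, ENNReal.mul_iSup]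
  refine iSup_le fun m => iSup_le fun n => ?_
  refine prekopaLeindler_real_bounded (N := ((max m n : ℕ) : ℝ≥0∞)) (hf.min measurable_const)
    (hg.min measurable_const) hh (ENNReal.natCast_ne_top _) ?_ ?_ ?_
  · intro x; exact (min_le_right _ _).trans (by exact_mod_cast le_max_right m n)
  · intro x; exact (min_le_right _ _).trans (by exact_mod_cast le_max_left m n)
  · intro x y
    exact (mul_le_mul' (min_le_left _ _) (min_le_left _ _)).trans (H x y)

theorem HasPrekopaLeindler.prod {V W : Type*} [AddCommGroup V] [Module ℝ V] [MeasurableSpace V]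
    [AddCommGroup W] [Module ℝ W] [MeasurableSpace W] {μ : Measure V} {ν : Measure W} [SFinite ν]
    [SFinite μ] (hV : HasPrekopaLeindler V μ) (hW : HasPrekopaLeindler W ν) :
    HasPrekopaLeindler (V × W) (μ.prod ν) := by
  intro f g h hf hg hh H
  rw [lintegral_prod _ hf.aemeasurable, lintegral_prod _ hg.aemeasurable,
    lintegral_prod _ hh.aemeasurable]
  refine hV _ _ _ hf.lintegral_prod_right' hg.lintegral_prod_right' hh.lintegral_prod_right' ?_
  intro x y
  refine hW _ _ _ (hf.comp measurable_prodMk_left) (hg.comp measurable_prodMk_left)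
    (hh.comp measurable_prodMk_left) ?_
  intro u v
  have := H (x, u) (y, v)
  simpa [midpoint_eq_smul_add] using this

theorem HasPrekopaLeindler.of_measurePreserving {V W : Type*} [AddCommGroup V] [Module ℝ V]
    [MeasurableSpace V] [AddCommGroup W] [Module ℝ W] [MeasurableSpace W]
    {μ : Measure V} {ν : Measure W} (hV : HasPrekopaLeindler V μ) (e : V →ₗ[ℝ] W)
    (he : MeasurePreserving e μ ν) : HasPrekopaLeindler W ν := by
  intro f g h hf hg hh H
  rw [← he.lintegral_comp hf, ← he.lintegral_comp hg, ← he.lintegral_comp hh]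
  refine hV _ _ _ (hf.comp he.measurable) (hg.comp he.measurable) (hh.comp he.measurable) ?_
  intro x y
  simpa [midpoint_eq_smul_add] using H (e x) (e y)

theorem hasPrekopaLeindler_pi (n : ℕ) : HasPrekopaLeindler (Fin n → ℝ) volume := by
  induction n with
  | zero =>
    intro f g h hf hg hh H
    have hv : (volume : Measure (Fin 0 → ℝ)) = Measure.dirac 0 := by
      rw [Measure.volume_pi_eq_dirac 0]
    rw [hv, lintegral_dirac' _ hf, lintegral_dirac' _ hg, lintegral_dirac' _ hh]
    simpa using H 0 0
  | succ n ih =>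
    let e : (ℝ × (Fin n → ℝ)) →ₗ[ℝ] (Fin (n + 1) → ℝ) :=
      { toFun := fun p => Fin.cons p.1 p.2
        map_add' := by
          intro p q; ext i; refine Fin.cases ?_ (fun j => ?_) i <;> simp
        map_smul' := by
          intro c p; ext i; refine Fin.cases ?_ (fun j => ?_) i <;> simp }
    refine (hasPrekopaLeindler_real.prod ih).of_measurePreserving e ?_
    have := (volume_preserving_piFinSuccAbove (fun _ : Fin (n + 1) => ℝ) 0).symm
    have he : (e : ℝ × (Fin n → ℝ) → Fin (n + 1) → ℝ) =
        (MeasurableEquiv.piFinSuccAbove (fun _ : Fin (n + 1) => ℝ) 0).symm := by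
      funext p
      simp [e, MeasurableEquiv.piFinSuccAbove, Fin.insertNthEquiv]
    rw [he]
    exact this

theorem hasPrekopaLeindler_euclidean (n : ℕ) : HasPrekopaLeindler (Euc n) volume :=
  (hasPrekopaLeindler_pi n).of_measurePreserving
    (WithLp.linearEquiv 2 ℝ (Fin n → ℝ)).symm.toLinearMap
    (PiLp.volume_preserving_toLp (Fin n))

/-- Log-concavity of a measure, tested on midpoints. -/
def IsMidLogConcave {V : Type*} [AddCommGroup V] [Module ℝ V] [MeasurableSpace V]
    (ν : Measure V) : Prop :=
  ∀ A B C : Set V, MeasurableSet A → MeasurableSet B → MeasurableSet C →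
    (∀ a ∈ A, ∀ b ∈ B, midpoint ℝ a b ∈ C) → ν A * ν B ≤ ν C ^ 2

theorem HasPrekopaLeindler.isMidLogConcave_withDensity {V : Type*} [AddCommGroup V] [Module ℝ V]
    [MeasurableSpace V] {μ : Measure V} (hV : HasPrekopaLeindler V μ) {ρ : V → ℝ≥0∞}
    (hρ : Measurable ρ) (h : ∀ x y, ρ x * ρ y ≤ ρ (midpoint ℝ x y) ^ 2) :
    IsMidLogConcave (μ.withDensity ρ) := by
  intro A B C hA hB hC H
  rw [withDensity_apply _ hA, withDensity_apply _ hB, withDensity_apply _ hC,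
    ← lintegral_indicator hA, ← lintegral_indicator hB, ← lintegral_indicator hC]
  refine hV _ _ _ (hρ.indicator hA) (hρ.indicator hB) (hρ.indicator hC) ?_
  intro x y
  by_cases hx : x ∈ A
  · by_cases hy : y ∈ B
    · simpa [hx, hy, H x hx y hy] using h x y
    · simp [hy]
  · simp [hx]

theorem IsMidLogConcave.map {V W : Type*} [AddCommGroup V] [Module ℝ V] [MeasurableSpace V]
    [AddCommGroup W] [Module ℝ W] [MeasurableSpace W] {ν : Measure V} (hν : IsMidLogConcave ν)
    (φ : V →ₗ[ℝ] W) (hφ : Measurable φ) : IsMidLogConcave (ν.map φ) := by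
  intro A B C hA hB hC H
  rw [Measure.map_apply hφ hA, Measure.map_apply hφ hB, Measure.map_apply hφ hC]
  refine hν _ _ _ (hφ hA) (hφ hB) (hφ hC) ?_
  intro a ha b hb
  have := H _ ha _ hb
  simpa [midpoint_eq_smul_add] using this

/-- Symmetric, log-concave, boundedly supported probability measures. -/
structure IsSymLogConcave {V : Type*} [NormedAddCommGroup V] [NormedSpace ℝ V] [MeasurableSpace V]
    (ν : Measure V) : Prop where
  prob : IsProbabilityMeasure ν
  symm : ν.map (fun x => -x) = ν
  lc : IsMidLogConcave ν
  bdd : ∃ R : ℝ, ∀ᵐ x ∂ν, ‖x‖ ≤ R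

namespace IsSymLogConcave

variable {V W : Type*} [NormedAddCommGroup V] [NormedSpace ℝ V] [MeasurableSpace V] [BorelSpace V]
  [NormedAddCommGroup W] [NormedSpace ℝ W] [MeasurableSpace W] [BorelSpace W]

theorem map {ν : Measure V} (hν : IsSymLogConcave ν) (φ : V →L[ℝ] W) :
    IsSymLogConcave (ν.map φ) where
  prob := by
    have := hν.prob
    exact Measure.isProbabilityMeasure_map φ.measurable.aemeasurable
  symm := by
    conv_rhs => rw [← hν.symm]
    rw [Measure.map_map measurable_neg φ.measurable, Measure.map_map φ.measurable measurable_neg]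
    congr 1
    ext x
    simp
  lc := hν.lc.map φ.toLinearMap φ.measurable
  bdd := by
    obtain ⟨R, hR⟩ := hν.bdd
    refine ⟨‖φ‖ * R, ?_⟩
    rw [ae_map_iff φ.measurable.aemeasurable (measurableSet_le measurable_norm measurable_const)]
    filter_upwards [hR] with x hx
    exact (φ.le_opNorm x).trans (by gcongr)

theorem integrable [FiniteDimensional ℝ V] {ν : Measure V} (hν : IsSymLogConcave ν)
    {F : Type*} [NormedAddCommGroup F] [SecondCountableTopology F]
    {f : V → F} (hf : Continuous f) : Integrable f ν := by
  have := hν.prob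
  have : ProperSpace V := FiniteDimensional.proper ℝ V
  obtain ⟨R, hR⟩ := hν.bdd
  obtain ⟨C, hC⟩ := (isCompact_closedBall (0 : V) R).exists_bound_of_continuousOn hf.continuousOn
  have : AEStronglyMeasurable f ν := by
    borelize F
    exact hf.measurable.aestronglyMeasurable
  refine Integrable.of_bound this C ?_
  filter_upwards [hR] with x hx
  exact hC x (by simpa using hx)

end IsSymLogConcave

section Real

variable {ν : Measure ℝ}

lemma IsSymLogConcave.measure_abs_ge (hν : IsSymLogConcave ν) {s : ℝ} (hs : 0 < s) :
    ν {x | s ≤ |x|} = 2 * ν (Set.Ici s) := by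
  have h1 : {x : ℝ | s ≤ |x|} = Set.Ici s ∪ Set.Iic (-s) := by
    ext x
    simp only [Set.mem_ofPred_eq, Set.mem_union, Set.mem_Ici, Set.mem_Iic, le_abs]
    constructor <;> rintro (h | h) <;> [left; right; left; right] <;> linarith
  have h2 : ν (Set.Iic (-s)) = ν (Set.Ici s) := by
    conv_rhs => rw [← hν.symm]
    rw [Measure.map_apply measurable_neg measurableSet_Ici]
    congr 1
    ext x
    simp only [Set.mem_Iic, Set.mem_preimage, Set.mem_Ici]
    constructor <;> intro h <;> linarith
  rw [h1, measure_union _ measurableSet_Iic, h2, two_mul]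
  rw [Set.disjoint_left]
  intro x hx hx'
  simp only [Set.mem_Ici, Set.mem_Iic] at hx hx'
  linarith

lemma IsSymLogConcave.one_le_two_mul_measure_Ici_zero (hν : IsSymLogConcave ν) :
    1 ≤ 2 * ν (Set.Ici 0) := by
  have := hν.prob
  have h2 : ν (Set.Iic 0) = ν (Set.Ici 0) := by
    conv_rhs => rw [← hν.symm]
    rw [Measure.map_apply measurable_neg measurableSet_Ici]
    congr 1
    ext x
    simp
  calc (1 : ℝ≥0∞) = ν Set.univ := measure_univ.symm
    _ = ν (Set.Ici 0 ∪ Set.Iic 0) := by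
        congr 1; ext x; simp
    _ ≤ ν (Set.Ici 0) + ν (Set.Iic 0) := measure_union_le _ _
    _ = 2 * ν (Set.Ici 0) := by rw [h2, two_mul]

/-- Geometric decay of the tails of a symmetric log-concave measure. -/
lemma IsSymLogConcave.measure_Ici_le (hν : IsSymLogConcave ν) {t : ℝ} (ht : 0 < t) {δ : ℝ≥0∞}
    (hδ : 2 * ν (Set.Ici t) ≤ δ) (m : ℕ) : ν (Set.Ici (m * t)) ≤ δ ^ m := by
  have := hν.prob
  set r : ℕ → ℝ≥0∞ := fun j => ν (Set.Ici (j * t)) with hr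
  have hlc : ∀ j, r j * r (j + 2) ≤ r (j + 1) ^ 2 := by
    intro j
    refine hν.lc _ _ _ measurableSet_Ici measurableSet_Ici measurableSet_Ici ?_
    intro a ha b hb
    rw [midpoint_eq_smul_add]
    simp only [Set.mem_Ici, invOf_eq_inv, smul_eq_mul] at ha hb ⊢
    push_cast at ha hb ⊢
    linarith
  have hanti : ∀ j, r (j + 1) ≤ r j := by
    intro j
    refine measure_mono (Set.Ici_subset_Ici.2 ?_)
    push_cast; nlinarith
  have hstep : ∀ j, r (j + 1) ≤ δ * r j := by
    intro j
    induction j with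
    | zero =>
      have h0 := hν.one_le_two_mul_measure_Ici_zero
      have e0 : r 0 = ν (Set.Ici 0) := by simp [hr]
      have e1 : r 1 = ν (Set.Ici t) := by simp [hr]
      rw [zero_add, e1, e0]
      calc ν (Set.Ici t) = ν (Set.Ici t) * 1 := by ring
        _ ≤ ν (Set.Ici t) * (2 * ν (Set.Ici 0)) := by gcongr
        _ = (2 * ν (Set.Ici t)) * ν (Set.Ici 0) := by ring
        _ ≤ δ * ν (Set.Ici 0) := by gcongr
    | succ j ih =>
      by_cases h0 : r j = 0
      · have : r (j + 1 + 1) = 0 := by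
          have := (hanti (j + 1)).trans (hanti j)
          rw [h0] at this
          exact le_antisymm this bot_le
        rw [this]; exact bot_le
      · have h1 : r j * r (j + 1 + 1) ≤ r j * (δ * r (j + 1)) := by
          calc r j * r (j + 1 + 1) ≤ r (j + 1) ^ 2 := hlc j
            _ = r (j + 1) * r (j + 1) := sq _
            _ ≤ (δ * r j) * r (j + 1) := by gcongr
            _ = r j * (δ * r (j + 1)) := by ring
        exact (ENNReal.mul_le_mul_iff_right h0 (measure_ne_top _ _)).1 h1
  change r m ≤ δ ^ m
  induction m with
  | zero => simpa [hr] using prob_le_one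
  | succ m ih =>
    calc r (m + 1) ≤ δ * r m := hstep m
      _ ≤ δ * δ ^ m := by gcongr
      _ = δ ^ (m + 1) := by ring

/-- Exponential moments of a symmetric log-concave measure on the line. -/
lemma IsSymLogConcave.lintegral_exp_le (hν : IsSymLogConcave ν) {t : ℝ} (ht : 0 < t) {δ l : ℝ}
    (hl : 0 ≤ l) (hδ0 : 0 ≤ δ) (hδ : 2 * ν (Set.Ici t) ≤ ENNReal.ofReal δ)
    (hlt : δ * Real.exp (l * t) ≤ 1 / 2) :
    ∫⁻ w, ENNReal.ofReal (Real.exp (l * |w|)) ∂ν ≤ ENNReal.ofReal (4 * Real.exp (l * t)) := by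
  have := hν.prob
  have hmeas : ∀ m : ℕ, MeasurableSet {w : ℝ | m * t ≤ |w|} := fun m =>
    measurableSet_le measurable_const measurable_norm
  have hpt : ∀ w : ℝ, ENNReal.ofReal (Real.exp (l * |w|)) ≤
      ∑' m : ℕ, Set.indicator {w : ℝ | m * t ≤ |w|}
        (fun _ => ENNReal.ofReal (Real.exp (l * ((m + 1) * t)))) w := by
    intro w
    set m := ⌊|w| / t⌋₊
    have h1 : (m : ℝ) ≤ |w| / t := Nat.floor_le (by positivity)
    have h2 : |w| / t < m + 1 := Nat.lt_floor_add_one _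
    rw [le_div_iff₀ ht] at h1
    rw [div_lt_iff₀ ht] at h2
    refine le_trans ?_ (ENNReal.le_tsum m)
    rw [Set.indicator_of_mem (by simpa using h1)]
    gcongr
  calc ∫⁻ w, ENNReal.ofReal (Real.exp (l * |w|)) ∂ν
      ≤ ∫⁻ w, ∑' m : ℕ, Set.indicator {w : ℝ | m * t ≤ |w|}
        (fun _ => ENNReal.ofReal (Real.exp (l * ((m + 1) * t)))) w ∂ν := lintegral_mono hpt
    _ = ∑' m : ℕ, ENNReal.ofReal (Real.exp (l * ((m + 1) * t))) * ν {w : ℝ | m * t ≤ |w|} := by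
        rw [lintegral_tsum fun m => (measurable_const.indicator (hmeas m)).aemeasurable]
        congr with m
        rw [lintegral_indicator_const (hmeas m)]
    _ ≤ ∑' m : ℕ, ENNReal.ofReal (2 * Real.exp (l * t)) * ENNReal.ofReal (1 / 2) ^ m := by
        refine ENNReal.tsum_le_tsum fun m => ?_
        have hb : ν {w : ℝ | m * t ≤ |w|} ≤ 2 * ENNReal.ofReal δ ^ m := by
          rcases Nat.eq_zero_or_pos m with rfl | hm
          · refine prob_le_one.trans ?_
            norm_num
          · rw [hν.measure_abs_ge (by positivity)]
            gcongr
            exact hν.measure_Ici_le ht hδ m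
        refine (mul_le_mul' le_rfl hb).trans ?_
        rw [← ENNReal.ofReal_pow hδ0, ← ENNReal.ofReal_pow (by norm_num),
          ← ENNReal.ofReal_mul (by positivity)]
        have : (2 : ℝ≥0∞) = ENNReal.ofReal 2 := by simp
        rw [this, ← ENNReal.ofReal_mul (by norm_num), ← ENNReal.ofReal_mul (by positivity)]
        apply ENNReal.ofReal_le_ofReal
        have e : Real.exp (l * ((m + 1) * t)) = Real.exp (l * t) * Real.exp (l * t) ^ m := by
          rw [← Real.exp_nat_mul, ← Real.exp_add]; ring_nf
        rw [e]
        calc Real.exp (l * t) * Real.exp (l * t) ^ m * (2 * δ ^ m)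
            = 2 * Real.exp (l * t) * (δ * Real.exp (l * t)) ^ m := by rw [mul_pow]; ring
          _ ≤ 2 * Real.exp (l * t) * (1 / 2) ^ m := by gcongr
    _ = ENNReal.ofReal (4 * Real.exp (l * t)) := by
        rw [ENNReal.tsum_mul_left, ENNReal.tsum_geometric]
        have : (1 - ENNReal.ofReal (1 / 2))⁻¹ = ENNReal.ofReal 2 := by
          rw [← ENNReal.ofReal_one, ← ENNReal.ofReal_sub _ (by norm_num),
            ← ENNReal.ofReal_inv_of_pos (by norm_num)]
          norm_num
        rw [this, ← ENNReal.ofReal_mul (by positivity)]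
        congr 1
        ring

lemma IsSymLogConcave.two_mul_measure_Ici_le (hν : IsSymLogConcave ν) {t : ℝ} (ht : 0 < t) {δ : ℝ}
    {p : ℕ} (h : ∫ w, |w| ^ p ∂ν ≤ δ * t ^ p) : 2 * ν (Set.Ici t) ≤ ENNReal.ofReal δ := by
  have := hν.prob
  rw [← hν.measure_abs_ge ht]
  have hi : Integrable (fun w : ℝ => |w| ^ p) ν := hν.integrable (by fun_prop)
  have h1 : t ^ p * ν.real {w : ℝ | t ^ p ≤ |w| ^ p} ≤ ∫ w, |w| ^ p ∂ν :=
    mul_meas_ge_le_integral_of_nonneg (Eventually.of_forall fun w => by positivity) hi _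
  have h2 : ν.real {w : ℝ | t ≤ |w|} ≤ ν.real {w : ℝ | t ^ p ≤ |w| ^ p} := by
    refine measureReal_mono (fun w hw => ?_) (measure_ne_top _ _)
    exact pow_le_pow_left₀ ht.le hw p
  have h3 : ν.real {w : ℝ | t ≤ |w|} ≤ δ := by
    have : 0 < t ^ p := by positivity
    nlinarith
  rw [← ENNReal.ofReal_toReal (measure_ne_top ν {w : ℝ | t ≤ |w|})]
  exact ENNReal.ofReal_le_ofReal h3

lemma IsSymLogConcave.integral_exp_le_aux (hν : IsSymLogConcave ν) {t : ℝ} (ht : 0 < t) {δ l : ℝ}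
    (hl : 0 ≤ l) (hδ0 : 0 ≤ δ) {p : ℕ} (h : ∫ w, |w| ^ p ∂ν ≤ δ * t ^ p)
    (hlt : δ * Real.exp (l * t) ≤ 1 / 2) :
    ∫ w, Real.exp (l * |w|) ∂ν ≤ 4 * Real.exp (l * t) := by
  have hi : Integrable (fun w : ℝ => Real.exp (l * |w|)) ν := hν.integrable (by fun_prop)
  have h1 := hν.lintegral_exp_le ht hl hδ0 (hν.two_mul_measure_Ici_le ht h) hlt
  rw [integral_eq_lintegral_of_nonneg_ae (Eventually.of_forall fun w => (Real.exp_pos _).le)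
    hi.aestronglyMeasurable]
  exact ENNReal.toReal_le_of_le_ofReal (by positivity) h1

/-- Moments of a symmetric log-concave measure on the line are controlled by its variance. -/
lemma IsSymLogConcave.integral_abs_pow_le (hν : IsSymLogConcave ν) {σ : ℝ} (hσ : 0 < σ)
    (h : ∫ w, w ^ 2 ∂ν ≤ σ ^ 2) {p : ℕ} (hp : 2 ≤ p) :
    ∫ w, |w| ^ p ∂ν ≤ (12 * σ * p) ^ p := by
  have h1 : ∫ w, Real.exp ((3 * σ)⁻¹ * |w|) ∂ν ≤ 4 * Real.exp ((3 * σ)⁻¹ * (3 * σ)) := by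
    refine hν.integral_exp_le_aux (t := 3 * σ) (δ := 1 / 9) (p := 2) (by positivity) (by positivity)
      (by norm_num) ?_ ?_
    · simp only [sq_abs]; linarith
    · rw [inv_mul_cancel₀ (by positivity)]
      have := Real.exp_one_lt_d9
      linarith
  rw [inv_mul_cancel₀ (by positivity)] at h1
  have h2 : ∀ w : ℝ, |w| ^ p ≤ ((3 * σ) ^ p * (p ^ p : ℝ)) * Real.exp ((3 * σ)⁻¹ * |w|) := by
    intro w
    have := Real.pow_div_factorial_le_exp ((3 * σ)⁻¹ * |w|) (by positivity) p
    rw [div_le_iff₀ (by positivity)] at this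
    have hf : ((p.factorial : ℕ) : ℝ) ≤ (p : ℝ) ^ p := by exact_mod_cast Nat.factorial_le_pow p
    calc |w| ^ p = (3 * σ) ^ p * ((3 * σ)⁻¹ * |w|) ^ p := by
          rw [← mul_pow, mul_inv_cancel_left₀ (by positivity)]
      _ ≤ (3 * σ) ^ p * (Real.exp ((3 * σ)⁻¹ * |w|) * p.factorial) := by gcongr
      _ ≤ (3 * σ) ^ p * (Real.exp ((3 * σ)⁻¹ * |w|) * (p : ℝ) ^ p) := by gcongr
      _ = _ := by ring
  have hi : Integrable (fun w : ℝ => Real.exp ((3 * σ)⁻¹ * |w|)) ν := hν.integrable (by fun_prop)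
  calc ∫ w, |w| ^ p ∂ν
      ≤ ∫ w, ((3 * σ) ^ p * (p ^ p : ℝ)) * Real.exp ((3 * σ)⁻¹ * |w|) ∂ν :=
        integral_mono (hν.integrable (by fun_prop)) (hi.const_mul _) h2
    _ = ((3 * σ) ^ p * (p ^ p : ℝ)) * ∫ w, Real.exp ((3 * σ)⁻¹ * |w|) ∂ν := integral_const_mul _ _
    _ ≤ ((3 * σ) ^ p * (p ^ p : ℝ)) * 4 ^ p := by
        gcongr
        have := Real.exp_one_lt_d9
        have h4 : (4 : ℝ) ^ 2 ≤ 4 ^ p := pow_le_pow_right₀ (by norm_num) hp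
        linarith
    _ = (12 * σ * p) ^ p := by rw [← mul_pow, ← mul_pow]; ring

lemma IsSymLogConcave.integral_exp_le (hν : IsSymLogConcave ν) {p : ℕ} (hp : 1 ≤ p)
    (h : ∫ w, |w| ^ p ∂ν ≤ ((p : ℝ) / 6) ^ p) : ∫ w, Real.exp |w| ∂ν ≤ 4 * Real.exp p := by
  have h1 : ∫ w, Real.exp (1 * |w|) ∂ν ≤ 4 * Real.exp (1 * p) := by
    refine hν.integral_exp_le_aux (t := p) (δ := (1 / 6) ^ p) (p := p) (by positivity) (by positivity)
      (by positivity) ?_ ?_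
    · rw [← mul_pow]
      convert h using 2
      ring
    · rw [one_mul, ← Real.exp_one_pow, ← mul_pow]
      have := Real.exp_one_lt_d9
      calc (1 / 6 * Real.exp 1) ^ p ≤ (1 / 2) ^ p := by gcongr; linarith
        _ ≤ (1 / 2) ^ 1 := pow_le_pow_of_le_one (by norm_num) (by norm_num) hp
        _ = 1 / 2 := by norm_num
  simpa using h1

end Real

section Functional

variable {V : Type*} [NormedAddCommGroup V] [NormedSpace ℝ V] [MeasurableSpace V] [BorelSpace V]
  {ν : Measure V}

lemma IsSymLogConcave.integral_abs_pow_functional_le (hν : IsSymLogConcave ν) (φ : V →L[ℝ] ℝ)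
    {σ : ℝ} (hσ : 0 < σ) (h : ∫ x, φ x ^ 2 ∂ν ≤ σ ^ 2) {p : ℕ} (hp : 2 ≤ p) :
    ∫ x, |φ x| ^ p ∂ν ≤ (12 * σ * p) ^ p := by
  have e : ∀ f : ℝ → ℝ, Continuous f → ∫ x, f (φ x) ∂ν = ∫ w, f w ∂(ν.map φ) := fun f hf =>
    (integral_map φ.measurable.aemeasurable hf.aestronglyMeasurable).symm
  rw [e (fun w => w ^ 2) (by fun_prop)] at h
  rw [e (fun w => |w| ^ p) (by fun_prop)]
  exact (hν.map φ).integral_abs_pow_le hσ h hp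

lemma IsSymLogConcave.integral_exp_functional_le (hν : IsSymLogConcave ν) (φ : V →L[ℝ] ℝ)
    {p : ℕ} (hp : 1 ≤ p) (h : ∫ x, |φ x| ^ p ∂ν ≤ ((p : ℝ) / 6) ^ p) :
    ∫ x, Real.exp |φ x| ∂ν ≤ 4 * Real.exp p := by
  have e : ∀ f : ℝ → ℝ, Continuous f → ∫ x, f (φ x) ∂ν = ∫ w, f w ∂(ν.map φ) := fun f hf =>
    (integral_map φ.measurable.aemeasurable hf.aestronglyMeasurable).symm
  rw [e (fun w => |w| ^ p) (by fun_prop)] at h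
  rw [e (fun w => Real.exp |w|) (by fun_prop)]
  exact (hν.map φ).integral_exp_le hp h

end Functional

/-- Separation of a point from a closed midpoint-convex set. -/
lemma exists_inner_le_lt_of_midpoint_closed {k : ℕ} {D : Set (Euc k)} (hD : IsClosed D)
    (hne : D.Nonempty) (hmid : ∀ x ∈ D, ∀ y ∈ D, midpoint ℝ x y ∈ D) {v : Euc k} (hv : v ∉ D) :
    ∃ (t : Euc k) (s : ℝ), (∀ w ∈ D, inner ℝ t w ≤ s) ∧ s < inner ℝ t v := by
  obtain ⟨u, huD, hu⟩ := hD.exists_infDist_eq_dist hne v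
  have hmin : ∀ w ∈ D, ‖v - u‖ ≤ ‖v - w‖ := by
    intro w hw
    rw [← dist_eq_norm, ← dist_eq_norm, ← hu]
    exact Metric.infDist_le_dist_of_mem hw
  have hvu : 0 < ‖v - u‖ := by
    rw [norm_pos_iff, sub_ne_zero]
    rintro rfl
    exact hv huD
  refine ⟨v - u, inner ℝ (v - u) u, ?_, ?_⟩
  · intro w hw
    have hiter : ∀ j : ℕ, u + ((2 : ℝ)⁻¹ ^ j) • (w - u) ∈ D := by
      intro j
      induction j with
      | zero => simpa using hw
      | succ j ih =>
        have := hmid _ huD _ ih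
        convert this using 1
        rw [midpoint_eq_smul_add, pow_succ]
        simp only [invOf_eq_inv]
        module
    have hineq : ∀ j : ℕ, 2 * inner ℝ (v - u) (w - u) ≤ (2 : ℝ)⁻¹ ^ j * ‖w - u‖ ^ 2 := by
      intro j
      have h1 := hmin _ (hiter j)
      have h2 : v - (u + ((2 : ℝ)⁻¹ ^ j) • (w - u)) = (v - u) - ((2 : ℝ)⁻¹ ^ j) • (w - u) := by
        abel
      rw [h2] at h1
      have h3 : ‖v - u‖ ^ 2 ≤ ‖(v - u) - ((2 : ℝ)⁻¹ ^ j) • (w - u)‖ ^ 2 := by gcongr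
      rw [norm_sub_sq_real (v - u) (((2 : ℝ)⁻¹ ^ j) • (w - u)), inner_smul_right, norm_smul,
        mul_pow, Real.norm_eq_abs, sq_abs] at h3
      have h4 : (0 : ℝ) < (2 : ℝ)⁻¹ ^ j := by positivity
      nlinarith
    have hlim : Tendsto (fun j : ℕ => (2 : ℝ)⁻¹ ^ j * ‖w - u‖ ^ 2) atTop (nhds (0 * ‖w - u‖ ^ 2)) :=
      (tendsto_pow_atTop_nhds_zero_of_lt_one (by norm_num) (by norm_num)).mul_const _
    have := ge_of_tendsto' hlim hineq
    rw [inner_sub_right] at this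
    linarith
  · have : inner ℝ (v - u) v - inner ℝ (v - u) u = ‖v - u‖ ^ 2 := by
      rw [← inner_sub_right, real_inner_self_eq_norm_sq]
    have h2 : 0 < ‖v - u‖ ^ 2 := by positivity
    linarith

section SmallBall

variable {k : ℕ} {ν : Measure (Euc k)}

lemma lintegral_mul_measure_closedBall [SFinite ν] (ε : ℝ) {g : Euc k → ℝ≥0∞} (hg : Measurable g) :
    ∫⁻ v, g v * ν (Metric.closedBall v ε) = ∫⁻ x, (∫⁻ v in Metric.closedBall x ε, g v) ∂ν := by
  have hm : MeasurableSet {q : Euc k × Euc k | dist q.2 q.1 ≤ ε} :=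
    measurableSet_le (by fun_prop) measurable_const
  have hF : Measurable (Function.uncurry fun v x : Euc k =>
      Set.indicator {q : Euc k × Euc k | dist q.2 q.1 ≤ ε} (fun q => g q.1) (v, x)) :=
    (hg.comp measurable_fst).indicator hm
  calc ∫⁻ v, g v * ν (Metric.closedBall v ε)
      = ∫⁻ v, ∫⁻ x, Set.indicator {q : Euc k × Euc k | dist q.2 q.1 ≤ ε} (fun q => g q.1) (v, x) ∂ν := by
        congr with v
        rw [← setLIntegral_const, ← lintegral_indicator Metric.isClosed_closedBall.measurableSet]
        rfl
    _ = ∫⁻ x, (∫⁻ v, Set.indicator {q : Euc k × Euc k | dist q.2 q.1 ≤ ε}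
          (fun q => g q.1) (v, x)) ∂ν :=
        lintegral_lintegral_swap hF.aemeasurable
    _ = _ := by
        congr with x
        rw [← lintegral_indicator Metric.isClosed_closedBall.measurableSet]
        congr with v
        simp only [Set.indicator, Set.mem_ofPred_eq, Metric.mem_closedBall, dist_comm]

lemma le_setLIntegral_closedBall (t x : Euc k) (ε : ℝ) (n : ℕ) :
    ENNReal.ofReal (|inner ℝ t x| ^ n) * volume (Metric.closedBall x ε) ≤
      ∫⁻ v in Metric.closedBall x ε, ENNReal.ofReal (|inner ℝ t v| ^ n) := by
  set f : Euc k → ℝ≥0∞ := fun v => ENNReal.ofReal (|inner ℝ t v| ^ n) with hf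
  have hfm : Measurable f := by fun_prop
  have hrefl : ∫⁻ v in Metric.closedBall x ε, f v =
      ∫⁻ v in Metric.closedBall x ε, f ((2 : ℝ) • x - v) := by
    have hp : MeasurePreserving (fun v : Euc k => (2 : ℝ) • x - v) volume volume :=
      Measure.measurePreserving_sub_left volume _
    have := (hp.restrict_preimage (s := Metric.closedBall x ε)
      Metric.isClosed_closedBall.measurableSet).lintegral_comp hfm
    rw [← this]
    congr 2
    ext v
    simp only [Set.mem_preimage, Metric.mem_closedBall, dist_eq_norm]
    rw [show (2 : ℝ) • x - v - x = -(v - x) by rw [two_smul]; abel, norm_neg]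
  have hpt : ∀ v, 2 * f x ≤ f v + f ((2 : ℝ) • x - v) := by
    intro v
    have hc : ConvexOn ℝ Set.univ (fun y : ℝ => |y| ^ n) :=
      ((convexOn_norm (E := ℝ) convex_univ).pow (fun _ _ => norm_nonneg _) n)
    have := hc.2 (Set.mem_univ (inner ℝ t v)) (Set.mem_univ (inner ℝ t ((2 : ℝ) • x - v)))
      (by norm_num : (0 : ℝ) ≤ 1 / 2) (by norm_num : (0 : ℝ) ≤ 1 / 2) (by norm_num)
    simp only [hf, smul_eq_mul] at this ⊢
    rw [two_mul, ← ENNReal.ofReal_add (by positivity) (by positivity),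
      ← ENNReal.ofReal_add (by positivity) (by positivity)]
    apply ENNReal.ofReal_le_ofReal
    have e : 1 / 2 * inner ℝ t v + 1 / 2 * inner ℝ t ((2 : ℝ) • x - v) = inner ℝ t x := by
      rw [inner_sub_right, inner_smul_right]; ring
    rw [e] at this
    linarith
  have h2 : 2 * (f x * volume (Metric.closedBall x ε)) ≤ 2 * ∫⁻ v in Metric.closedBall x ε, f v := by
    calc 2 * (f x * volume (Metric.closedBall x ε))
        = ∫⁻ v in Metric.closedBall x ε, 2 * f x := by rw [setLIntegral_const]; ring
      _ ≤ ∫⁻ v in Metric.closedBall x ε, (f v + f ((2 : ℝ) • x - v)) := lintegral_mono hpt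
      _ = 2 * ∫⁻ v in Metric.closedBall x ε, f v := by
          rw [lintegral_add_left hfm, ← hrefl, two_mul]
  exact (ENNReal.mul_le_mul_iff_right (by norm_num) (by norm_num)).1 h2

lemma isClosed_le_measure_closedBall [IsFiniteMeasure ν] (ε : ℝ) (c : ℝ≥0∞) :
    IsClosed {v | c ≤ ν (Metric.closedBall v ε)} := by
  rw [← isSeqClosed_iff_isClosed]
  intro u v hu hlim
  have hanti : Antitone fun j : ℕ => Metric.closedBall v (ε + 1 / ((j : ℝ) + 1)) := by
    intro i j hij
    apply Metric.closedBall_subset_closedBall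
    gcongr
  have hInter : ⋂ j : ℕ, Metric.closedBall v (ε + 1 / ((j : ℝ) + 1)) = Metric.closedBall v ε := by
    ext x
    simp only [Set.mem_iInter, Metric.mem_closedBall]
    constructor
    · intro h
      have hl : Tendsto (fun j : ℕ => ε + 1 / ((j : ℝ) + 1)) atTop (nhds (ε + 0)) :=
        tendsto_one_div_add_atTop_nhds_zero_nat.const_add ε
      rw [add_zero] at hl
      exact ge_of_tendsto' hl h
    · intro h j
      have : 0 < 1 / ((j : ℝ) + 1) := by positivity
      linarith
  have ht := tendsto_measure_iInter_atTop (μ := ν)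
    (fun j : ℕ => (Metric.isClosed_closedBall (x := v)
      (ε := ε + 1 / ((j : ℝ) + 1))).measurableSet.nullMeasurableSet) hanti
    ⟨0, measure_ne_top _ _⟩
  rw [hInter] at ht
  refine ge_of_tendsto' ht fun j => ?_
  obtain ⟨i, hi⟩ := (Metric.tendsto_atTop.1 hlim (1 / ((j : ℝ) + 1)) (by positivity))
  refine (hu i).trans (measure_mono (Metric.closedBall_subset_closedBall' ?_))
  have := hi i le_rfl
  linarith

lemma lintegral_comp_half_smul {g : Euc k → ℝ≥0∞} (hg : Measurable g) :
    ∫⁻ v, g ((2 : ℝ)⁻¹ • v) = 2 ^ k * ∫⁻ v, g v := by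
  have h := Measure.map_addHaar_smul (volume : Measure (Euc k)) (r := (2 : ℝ)⁻¹) (by norm_num)
  have h1 : ∫⁻ v, g v ∂(Measure.map (fun v : Euc k => (2 : ℝ)⁻¹ • v) volume) =
      ∫⁻ v, g ((2 : ℝ)⁻¹ • v) := lintegral_map hg (by fun_prop)
  rw [← h1, h, lintegral_smul_measure]
  have : ENNReal.ofReal |(((2 : ℝ)⁻¹) ^ Module.finrank ℝ (Euc k))⁻¹| = 2 ^ k := by
    simp
  rw [this, smul_eq_mul]

lemma IsSymLogConcave.measure_closedBall_mul_le (hν : IsSymLogConcave ν) (ε : ℝ) (v w : Euc k) :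
    ν (Metric.closedBall v ε) * ν (Metric.closedBall w ε) ≤
      ν (Metric.closedBall (midpoint ℝ v w) ε) ^ 2 := by
  refine hν.lc _ _ _ Metric.isClosed_closedBall.measurableSet
    Metric.isClosed_closedBall.measurableSet Metric.isClosed_closedBall.measurableSet ?_
  intro a ha b hb
  rw [Metric.mem_closedBall] at *
  refine (dist_midpoint_midpoint_le a b v w).trans ?_
  linarith

lemma IsSymLogConcave.measure_closedBall_neg (hν : IsSymLogConcave ν) (ε : ℝ) (v : Euc k) :
    ν (Metric.closedBall (-v) ε) = ν (Metric.closedBall v ε) := by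
  conv_lhs => rw [← hν.symm]
  rw [Measure.map_apply measurable_neg Metric.isClosed_closedBall.measurableSet]
  congr 1
  ext x
  simp only [Set.mem_preimage, Metric.mem_closedBall]
  rw [dist_neg_neg]

lemma ENNReal.le_of_sq_le_sq {a b : ℝ≥0∞} (h : a ^ 2 ≤ b ^ 2) : a ≤ b :=
  (ENNReal.pow_le_pow_left_iff (by norm_num)).1 h

lemma four_pow_mul_exp_le {k : ℕ} (hk : 2 ≤ k) : (4 : ℝ) ^ k * Real.exp (-(2 * k)) ≤ 1 / 2 := by
  have e : (4 : ℝ) ^ k * Real.exp (-(2 * k)) = (4 * Real.exp (-2)) ^ k := by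
    rw [mul_pow, ← Real.exp_nat_mul]; ring_nf
  have h2 : Real.exp (-2) ≤ 1 / 6 := by
    rw [Real.exp_neg, one_div]
    apply inv_anti₀ (by norm_num)
    have := Real.exp_one_gt_d9
    have e2 : Real.exp 2 = Real.exp 1 * Real.exp 1 := by rw [← Real.exp_add]; norm_num
    rw [e2]; nlinarith
  rw [e]
  calc (4 * Real.exp (-2)) ^ k ≤ (2 / 3) ^ k := by gcongr; linarith
    _ ≤ (2 / 3) ^ 2 := pow_le_pow_of_le_one (by norm_num) (by norm_num) hk
    _ ≤ 1 / 2 := by norm_num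

/-- The super-level set of the local mass contains a ball of radius comparable to the moments. -/
lemma IsSymLogConcave.le_measure_closedBall (hν : IsSymLogConcave ν) (hk : 2 ≤ k) {m ε : ℝ}
    (hm : 0 < m) (hε : 0 < ε) (h : ∀ t : Euc k, (m * ‖t‖) ^ k ≤ ∫ x, |inner ℝ t x| ^ k ∂ν)
    {v : Euc k} (hv : ‖v‖ ≤ m / 2) :
    ENNReal.ofReal (Real.exp (-(2 * k))) ^ 2 * ν (Metric.closedBall 0 ε) ≤
      ν (Metric.closedBall v ε) := by
  have := hν.prob
  set F : Euc k → ℝ≥0∞ := fun v => ν (Metric.closedBall v ε) with hF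
  set q := ENNReal.ofReal (Real.exp (-(2 * k))) with hq
  set D := {v | q ^ 2 * F 0 ≤ F v} with hD
  have hq1 : q ≤ 1 := by
    rw [hq, ← ENNReal.ofReal_one]
    apply ENNReal.ofReal_le_ofReal
    rw [Real.exp_le_one_iff]
    have : (0 : ℝ) ≤ k := by positivity
    linarith
  have hDc : IsClosed D := isClosed_le_measure_closedBall ε _
  by_contra hvD
  have h0D : (0 : Euc k) ∈ D := by
    change q ^ 2 * F 0 ≤ F 0
    exact mul_le_of_le_one_left' (pow_le_one₀ bot_le hq1)
  obtain ⟨t, s, hts, hst⟩ := exists_inner_le_lt_of_midpoint_closed hDc ⟨0, h0D⟩ (by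
    intro x hx y hy
    apply ENNReal.le_of_sq_le_sq
    calc (q ^ 2 * F 0) ^ 2 = (q ^ 2 * F 0) * (q ^ 2 * F 0) := sq _
      _ ≤ F x * F y := mul_le_mul' hx hy
      _ ≤ _ := hν.measure_closedBall_mul_le ε x y) hvD
  have hs0 : 0 ≤ s := by simpa using hts 0 h0D
  have habs : ∀ w ∈ D, |inner ℝ t w| ≤ s := by
    intro w hw
    rw [abs_le]
    refine ⟨?_, hts w hw⟩
    have : -w ∈ D := by
      change q ^ 2 * F 0 ≤ F (-w)
      rw [hF]
      simp only
      rw [hν.measure_closedBall_neg]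
      exact hw
    have := hts _ this
    rw [inner_neg_right] at this
    linarith
  have hst' : s < ‖t‖ * (m / 2) :=
    hst.trans_le ((real_inner_le_norm t v).trans (by gcongr))
  have htpos : 0 < ‖t‖ := by
    by_contra h0
    have : ‖t‖ = 0 := le_antisymm (not_lt.1 h0) (norm_nonneg _)
    rw [this] at hst'
    linarith
  set f : Euc k → ℝ≥0∞ := fun v => ENNReal.ofReal (|inner ℝ t v| ^ k) with hf
  have hfm : Measurable f := by fun_prop
  have hFm : Measurable F := by
    apply measurable_of_Ici
    intro c
    exact (isClosed_le_measure_closedBall ε c).measurableSet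
  set B := volume (Metric.closedBall (0 : Euc k) ε) with hB
  have hB0 : B ≠ 0 := (Metric.measure_closedBall_pos _ _ hε).ne'
  have hBt : B ≠ ∞ := measure_closedBall_lt_top.ne
  have hBx : ∀ x : Euc k, volume (Metric.closedBall x ε) = B := fun x =>
    Measure.addHaar_closedBall_center _ _ _
  have hFint : ∫⁻ v, F v = B := by
    have := lintegral_mul_measure_closedBall (ν := ν) ε (g := fun _ => 1) measurable_const
    simp only [one_mul] at this
    rw [hF, this]
    simp [hBx]
  set I := ∫⁻ v, f v * F v with hI
  have hI1 : ENNReal.ofReal ((m * ‖t‖) ^ k) * B ≤ I := by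
    rw [hI, lintegral_mul_measure_closedBall ε hfm]
    have hinteg : Integrable (fun x => |inner ℝ t x| ^ k) ν := hν.integrable (by fun_prop)
    calc ENNReal.ofReal ((m * ‖t‖) ^ k) * B
        ≤ ENNReal.ofReal (∫ x, |inner ℝ t x| ^ k ∂ν) * B := by gcongr; exact h t
      _ = (∫⁻ x, f x ∂ν) * B := by
          rw [ofReal_integral_eq_lintegral_ofReal hinteg
            (Eventually.of_forall fun x => by positivity)]
      _ = ∫⁻ x, f x * B ∂ν := by rw [lintegral_mul_const _ hfm]
      _ ≤ _ := by
          refine lintegral_mono fun x => ?_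
          rw [← hBx x]
          exact le_setLIntegral_closedBall t x ε k
  have hIt : I ≠ ∞ := by
    obtain ⟨R, hR⟩ := hν.bdd
    rw [hI, lintegral_mul_measure_closedBall ε hfm]
    refine ne_top_of_le_ne_top (b := ENNReal.ofReal ((‖t‖ * (R + ε)) ^ k) * B)
      (ENNReal.mul_ne_top ENNReal.ofReal_ne_top hBt) ?_
    calc ∫⁻ x, (∫⁻ v in Metric.closedBall x ε, f v) ∂ν
        ≤ ∫⁻ x, ENNReal.ofReal ((‖t‖ * (R + ε)) ^ k) * B ∂ν := by
          refine lintegral_mono_ae ?_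
          filter_upwards [hR] with x hx
          rw [← hBx x, ← setLIntegral_const]
          refine setLIntegral_mono' Metric.isClosed_closedBall.measurableSet fun v hv => ?_
          apply ENNReal.ofReal_le_ofReal
          gcongr
          refine (abs_real_inner_le_norm t v).trans ?_
          gcongr
          rw [Metric.mem_closedBall, dist_eq_norm] at hv
          calc ‖v‖ = ‖x + (v - x)‖ := by congr 1; abel
            _ ≤ ‖x‖ + ‖v - x‖ := norm_add_le _ _
            _ ≤ R + ε := add_le_add hx hv
      _ = _ := by simp
  have hout : ∫⁻ v in Dᶜ, f v * F v ≤ 2⁻¹ * I := by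
    calc ∫⁻ v in Dᶜ, f v * F v
        ≤ ∫⁻ v in Dᶜ, (2 ^ k * q) * (f ((2 : ℝ)⁻¹ • v) * F ((2 : ℝ)⁻¹ • v)) := by
          refine setLIntegral_mono' hDc.measurableSet.compl fun v hv => ?_
          have h1 : F v ≤ q ^ 2 * F 0 := le_of_lt (not_le.1 (show ¬ q ^ 2 * F 0 ≤ F v from hv))
          have h2 : F v ≤ q * F ((2 : ℝ)⁻¹ • v) := by
            apply ENNReal.le_of_sq_le_sq
            have h3 := hν.measure_closedBall_mul_le ε v 0
            rw [midpoint_eq_smul_add, add_zero, invOf_eq_inv] at h3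
            calc F v ^ 2 = F v * F v := sq _
              _ ≤ F v * (q ^ 2 * F 0) := by gcongr
              _ = q ^ 2 * (F v * F 0) := by ring
              _ ≤ q ^ 2 * F ((2 : ℝ)⁻¹ • v) ^ 2 := by gcongr
              _ = _ := by ring
          have h4 : f v = 2 ^ k * f ((2 : ℝ)⁻¹ • v) := by
            have e2 : ((2 : ℝ≥0∞) ^ k) = ENNReal.ofReal (2 ^ k) := by
              rw [ENNReal.ofReal_pow (by norm_num)]; simp
            simp only [hf]
            rw [e2, ← ENNReal.ofReal_mul (by positivity), ← mul_pow, inner_smul_right, abs_mul]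
            congr 2
            norm_num
            ring
          calc f v * F v ≤ (2 ^ k * f ((2 : ℝ)⁻¹ • v)) * (q * F ((2 : ℝ)⁻¹ • v)) := by
                rw [← h4]; gcongr
            _ = _ := by ring
      _ ≤ ∫⁻ v, (2 ^ k * q) * (f ((2 : ℝ)⁻¹ • v) * F ((2 : ℝ)⁻¹ • v)) :=
          setLIntegral_le_lintegral _ _
      _ = (2 ^ k * q) * (2 ^ k * I) := by
          rw [lintegral_const_mul _ (by fun_prop),
            lintegral_comp_half_smul (g := fun v => f v * F v) (hfm.mul hFm)]
      _ = (4 ^ k * q) * I := by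
          rw [show (4 : ℝ≥0∞) = 2 * 2 by norm_num, mul_pow]; ring
      _ ≤ 2⁻¹ * I := by
          gcongr
          have e4 : ((4 : ℝ≥0∞) ^ k) = ENNReal.ofReal (4 ^ k) := by
            rw [ENNReal.ofReal_pow (by norm_num)]; simp
          have e2 : (2⁻¹ : ℝ≥0∞) = ENNReal.ofReal (1 / 2) := by
            rw [one_div, ENNReal.ofReal_inv_of_pos (by norm_num)]; simp
          rw [e4, hq, ← ENNReal.ofReal_mul (by positivity), e2]
          exact ENNReal.ofReal_le_ofReal (four_pow_mul_exp_le hk)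
  have hin : ∫⁻ v in D, f v * F v ≤ ENNReal.ofReal (s ^ k) * B := by
    calc ∫⁻ v in D, f v * F v ≤ ∫⁻ v in D, ENNReal.ofReal (s ^ k) * F v := by
          refine setLIntegral_mono' hDc.measurableSet fun v hv => ?_
          gcongr
          apply ENNReal.ofReal_le_ofReal
          gcongr
          exact habs v hv
      _ ≤ ∫⁻ v, ENNReal.ofReal (s ^ k) * F v := setLIntegral_le_lintegral _ _
      _ = _ := by rw [lintegral_const_mul _ hFm, hFint]
  have hI2 : I ≤ 2 * (ENNReal.ofReal (s ^ k) * B) := by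
    have h1 : I ≤ ENNReal.ofReal (s ^ k) * B + 2⁻¹ * I := by
      calc I = (∫⁻ v in D, f v * F v) + ∫⁻ v in Dᶜ, f v * F v :=
            (lintegral_add_compl _ hDc.measurableSet).symm
        _ ≤ _ := add_le_add hin hout
    have h2 : I = 2⁻¹ * I + 2⁻¹ * I := by
      rw [← add_mul, ENNReal.inv_two_add_inv_two, one_mul]
    have h3 : 2⁻¹ * I ≤ ENNReal.ofReal (s ^ k) * B := by
      have h4 : 2⁻¹ * I ≠ ∞ := ENNReal.mul_ne_top (by simp) hIt
      have h5 : 2⁻¹ * I + 2⁻¹ * I ≤ ENNReal.ofReal (s ^ k) * B + 2⁻¹ * I := by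
        rw [← h2]; exact h1
      exact (ENNReal.add_le_add_iff_right h4).1 h5
    calc I = 2 * (2⁻¹ * I) := by
          rw [← mul_assoc, ENNReal.mul_inv_cancel (by norm_num) (by norm_num), one_mul]
      _ ≤ _ := by gcongr
  have hfin := hI1.trans hI2
  rw [← mul_assoc, ENNReal.mul_le_mul_iff_left hB0 hBt] at hfin
  rw [two_mul, ← ENNReal.ofReal_add (by positivity) (by positivity),
    ENNReal.ofReal_le_ofReal_iff (by positivity)] at hfin
  have h6 : s ^ k ≤ (m * ‖t‖) ^ k * (1 / 2) ^ k := by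
    rw [← mul_pow]
    gcongr
    linarith
  have h7 : ((1 : ℝ) / 2) ^ k ≤ (1 / 2) ^ 2 :=
    pow_le_pow_of_le_one (by norm_num) (by norm_num) hk
  have h8 : 0 < (m * ‖t‖) ^ k := by positivity
  nlinarith

/-- If all directional `k`-th moments of a symmetric log-concave vector in `ℝᵏ` are at least
`mᵏ`, then its second moment is at least of order `m²`. -/
theorem IsSymLogConcave.sq_le_integral_norm_sq (hν : IsSymLogConcave ν) (hk : 2 ≤ k) {m : ℝ}
    (hm : 0 < m) (h : ∀ t : Euc k, (m * ‖t‖) ^ k ≤ ∫ x, |inner ℝ t x| ^ k ∂ν) :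
    (m / 1000) ^ 2 ≤ ∫ x, ‖x‖ ^ 2 ∂ν := by
  have := hν.prob
  set ε := m / 440 with hε
  have hε0 : 0 < ε := by positivity
  set F0 := ν (Metric.closedBall (0 : Euc k) ε) with hF0
  set q := ENNReal.ofReal (Real.exp (-(2 * k))) with hq
  set B1 := volume (Metric.closedBall (0 : Euc k) 1) with hB1
  have hB10 : B1 ≠ 0 := (Metric.measure_closedBall_pos _ _ one_pos).ne'
  have hB1t : B1 ≠ ∞ := measure_closedBall_lt_top.ne
  have hball : ∀ (x : Euc k) (r : ℝ), 0 ≤ r →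
      volume (Metric.closedBall x r) = ENNReal.ofReal (r ^ k) * B1 := by
    intro x r hr
    rw [Measure.addHaar_closedBall' _ _ hr]
    simp [hB1]
  have hFint : ∫⁻ v, ν (Metric.closedBall v ε) = ENNReal.ofReal (ε ^ k) * B1 := by
    have := lintegral_mul_measure_closedBall (ν := ν) ε (g := fun _ => 1) measurable_const
    simp only [one_mul] at this
    rw [this]
    simp [hball _ _ hε0.le]
  have h1 : q ^ 2 * F0 * ENNReal.ofReal ((m / 2) ^ k) ≤ ENNReal.ofReal (ε ^ k) := by
    have : q ^ 2 * F0 * (ENNReal.ofReal ((m / 2) ^ k) * B1) ≤ ENNReal.ofReal (ε ^ k) * B1 := by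
      rw [← hball 0 _ (by positivity), ← setLIntegral_const, ← hFint]
      refine (setLIntegral_mono' Metric.isClosed_closedBall.measurableSet fun v hv => ?_).trans
        (setLIntegral_le_lintegral _ _)
      exact hν.le_measure_closedBall hk hm hε0 h (by simpa using hv)
    rw [← mul_assoc] at this
    exact (ENNReal.mul_le_mul_iff_left hB10 hB1t).1 this
  set P := ν.real (Metric.closedBall (0 : Euc k) ε) with hP
  have hPF : F0 = ENNReal.ofReal P := by
    rw [hP, measureReal_def, ENNReal.ofReal_toReal (measure_ne_top _ _)]
  have h3 : Real.exp (-(2 * k)) ^ 2 * P * (m / 2) ^ k ≤ ε ^ k := by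
    rw [hPF, hq, ← ENNReal.ofReal_pow (Real.exp_pos _).le, ← ENNReal.ofReal_mul (by positivity),
      ← ENNReal.ofReal_mul (by positivity), ENNReal.ofReal_le_ofReal_iff (by positivity)] at h1
    exact h1
  have h4 : P ≤ 1 / 2 := by
    have e1 : Real.exp (-(2 * k)) ^ 2 * (m / 2) ^ k = (Real.exp (-4) * (m / 2)) ^ k := by
      rw [mul_pow, ← Real.exp_nat_mul, ← Real.exp_nat_mul]
      congr 2; push_cast; ring
    have e2 : (1 : ℝ) / 55 ≤ Real.exp (-4) := by
      rw [Real.exp_neg, one_div]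
      apply inv_anti₀ (Real.exp_pos _)
      have := Real.exp_one_lt_d9
      have e4 : Real.exp 4 = Real.exp 1 ^ 4 := by rw [← Real.exp_nat_mul]; norm_num
      rw [e4]
      calc Real.exp 1 ^ 4 ≤ 2.7182818286 ^ 4 := by gcongr
        _ ≤ 55 := by norm_num
    have e3 : (4 * ε) ^ k ≤ (Real.exp (-4) * (m / 2)) ^ k := by
      refine pow_le_pow_left₀ (by positivity) ?_ k
      rw [hε]
      nlinarith
    have e5 : P * (4 * ε) ^ k ≤ ε ^ k := by
      calc P * (4 * ε) ^ k ≤ P * (Real.exp (-4) * (m / 2)) ^ k := by gcongr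
        _ = Real.exp (-(2 * k)) ^ 2 * P * (m / 2) ^ k := by rw [← e1]; ring
        _ ≤ ε ^ k := h3
    rw [mul_pow] at e5
    have e6 : (0 : ℝ) < ε ^ k := by positivity
    have e7 : (4 : ℝ) ^ 2 ≤ 4 ^ k := pow_le_pow_right₀ (by norm_num) hk
    have e8 : 0 ≤ P := measureReal_nonneg
    have e9 : P * 4 ^ k ≤ 1 := by
      by_contra hc
      push Not at hc
      nlinarith
    nlinarith
  have h5 : 1 / 2 ≤ ν.real {x : Euc k | ε ^ 2 ≤ ‖x‖ ^ 2} := by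
    have hc : ν.real (Metric.closedBall (0 : Euc k) ε)ᶜ = 1 - P :=
      probReal_compl_eq_one_sub Metric.isClosed_closedBall.measurableSet
    have hsub : ν.real (Metric.closedBall (0 : Euc k) ε)ᶜ ≤ ν.real {x : Euc k | ε ^ 2 ≤ ‖x‖ ^ 2} := by
      refine measureReal_mono (fun x hx => ?_) (measure_ne_top _ _)
      simp only [Set.mem_compl_iff, Metric.mem_closedBall, dist_zero_right, not_le] at hx
      exact pow_le_pow_left₀ hε0.le hx.le 2
    linarith
  have h6 := mul_meas_ge_le_integral_of_nonneg (μ := ν) (f := fun x : Euc k => ‖x‖ ^ 2)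
    (Eventually.of_forall fun x => by positivity) (hν.integrable (by fun_prop)) (ε ^ 2)
  have h7 : ε ^ 2 * (1 / 2) ≤ ∫ x, ‖x‖ ^ 2 ∂ν :=
    (mul_le_mul_of_nonneg_left h5 (by positivity)).trans h6
  refine le_trans ?_ h7
  rw [hε]
  nlinarith [sq_nonneg m]

end SmallBall

/-- The absolute moments of the standard Gaussian on the line. -/
noncomputable def gaussMoment (p : ℕ) : ℝ := ∫ x, |x| ^ p ∂gaussianReal 0 1

lemma gaussMoment_two_mul (q : ℕ) : gaussMoment (2 * q) = ((2 * q - 1 : ℕ).doubleFactorial : ℝ) := by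
  have hG := integral_rpow_mul_exp_neg_mul_rpow (p := 2) (q := 2 * q) (b := 1 / 2) two_pos
    (by linarith [(Nat.cast_nonneg q : (0 : ℝ) ≤ q)]) (by norm_num)
  have h1 : ∫ x in Set.Ioi (0 : ℝ), x ^ (2 * q : ℝ) * Real.exp (-(1 / 2) * x ^ (2 : ℝ)) =
      ∫ x in Set.Ioi (0 : ℝ), |x| ^ (2 * q) * Real.exp (-(1 / 2) * |x| ^ 2) := by
    refine setIntegral_congr_fun measurableSet_Ioi fun x hx => ?_
    have hx' : 0 < x := hx
    simp only [abs_of_pos hx']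
    norm_cast
  have h2 := integral_comp_abs (f := fun x : ℝ => x ^ (2 * q) * Real.exp (-(1 / 2) * x ^ 2))
  rw [gaussMoment, integral_gaussianReal_eq_integral_smul one_ne_zero]
  have h3 : ∀ x : ℝ, gaussianPDFReal 0 1 x • |x| ^ (2 * q) =
      (√(2 * Real.pi))⁻¹ * (|x| ^ (2 * q) * Real.exp (-(1 / 2) * |x| ^ 2)) := by
    intro x
    simp only [gaussianPDFReal, smul_eq_mul, NNReal.coe_one, mul_one, sub_zero, sq_abs]
    rw [show -x ^ 2 / 2 = -(1 / 2) * x ^ 2 by ring]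
    ring
  simp_rw [h3]
  rw [integral_const_mul, h2]
  have h4 : ∫ x in Set.Ioi (0 : ℝ), x ^ (2 * q) * Real.exp (-(1 / 2) * x ^ 2) =
      (1 / 2 : ℝ) ^ (-(2 * q + 1 : ℝ) / 2) * (1 / 2) * Real.Gamma ((2 * q + 1) / 2) := by
    rw [← hG, h1]
    refine setIntegral_congr_fun measurableSet_Ioi fun x hx => ?_
    have hx' : 0 < x := hx
    simp only [abs_of_pos hx']
  rw [h4, show ((2 * q + 1) / 2 : ℝ) = q + 1 / 2 by ring, Real.Gamma_nat_add_half]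
  have h5 : (1 / 2 : ℝ) ^ (-(2 * q + 1 : ℝ) / 2) = 2 ^ q * √2 := by
    rw [one_div, Real.inv_rpow two_pos.le, ← Real.rpow_neg two_pos.le, Real.sqrt_eq_rpow,
      ← Real.rpow_natCast, ← Real.rpow_add two_pos]
    congr 1
    ring
  rw [h5, Real.sqrt_mul two_pos.le]
  have : 0 < √Real.pi := Real.sqrt_pos.2 Real.pi_pos
  field_simp

open scoped Nat in
lemma le_gaussMoment_two_mul (q : ℕ) : ((q : ℝ) / 2) ^ q ≤ gaussMoment (2 * q) := by
  rw [gaussMoment_two_mul]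
  rcases Nat.eq_zero_or_pos q with rfl | hq
  · simp
  have h1 : q ! * (q + 1) ^ q ≤ (q + q)! := Nat.factorial_mul_pow_le_factorial
  have h2 : (2 * q)! = (2 * q).doubleFactorial * (2 * q - 1).doubleFactorial := by
    obtain ⟨r, rfl⟩ : ∃ r, q = r + 1 := ⟨q - 1, by omega⟩
    exact Nat.factorial_eq_mul_doubleFactorial (2 * r + 1)
  rw [Nat.doubleFactorial_two_mul, two_mul] at h2
  rw [h2] at h1
  have h3 : (q + 1) ^ q ≤ 2 ^ q * (q + q - 1).doubleFactorial := by
    refine le_of_mul_le_mul_left (a := q !) ?_ (Nat.factorial_pos q)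
    linarith
  have h4 : ((q : ℝ) + 1) ^ q ≤ 2 ^ q * ((2 * q - 1).doubleFactorial : ℝ) := by
    rw [two_mul]
    exact_mod_cast h3
  rw [div_pow, div_le_iff₀ (by positivity)]
  calc (q : ℝ) ^ q ≤ ((q : ℝ) + 1) ^ q := by gcongr; linarith
    _ ≤ _ := by linarith

lemma gaussMoment_two_mul_le (q : ℕ) : gaussMoment (2 * q) ≤ (2 * q : ℝ) ^ q := by
  rw [gaussMoment_two_mul]
  induction q with
  | zero => simp
  | succ q ih =>
    rcases Nat.eq_zero_or_pos q with rfl | hq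
    · simp
    have : (2 * (q + 1) - 1).doubleFactorial = (2 * q + 1) * (2 * q - 1).doubleFactorial := by
      obtain ⟨r, rfl⟩ : ∃ r, q = r + 1 := ⟨q - 1, by omega⟩
      exact Nat.doubleFactorial_add_two _
    rw [this]
    push_cast
    calc (2 * q + 1 : ℝ) * ((2 * q - 1).doubleFactorial : ℝ) ≤ (2 * (q + 1)) * (2 * q : ℝ) ^ q := by
          gcongr
          linarith
      _ ≤ (2 * (q + 1)) * (2 * (q + 1) : ℝ) ^ q := by
          gcongr
          linarith
      _ = _ := by ring

section std

variable {E : Type*} [NormedAddCommGroup E] [InnerProductSpace ℝ E] [FiniteDimensional ℝ E]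
  [MeasurableSpace E] [BorelSpace E]
variable {F : Type*} [NormedAddCommGroup F] [InnerProductSpace ℝ F] [FiniteDimensional ℝ F]
  [MeasurableSpace F] [BorelSpace F]

/-- A linear map whose adjoint is a dilation with factor `r` pushes the standard Gaussian to the
dilate of the standard Gaussian. -/
lemma map_stdGaussian_eq (L : E →L[ℝ] F) {r : ℝ}
    (h : ∀ v, ‖ContinuousLinearMap.adjoint L v‖ = |r| * ‖v‖) :
    (stdGaussian E).map L = (stdGaussian F).map (fun x => r • x) := by
  have h1 : IsFiniteMeasure ((stdGaussian E).map L) := inferInstance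
  have h2 : IsFiniteMeasure ((stdGaussian F).map (fun x => r • x)) := inferInstance
  refine Measure.ext_of_charFun ?_
  ext t
  rw [charFun_map_smul, charFun_stdGaussian, charFun_apply, integral_map (by fun_prop) (by fun_prop)]
  have : ∀ x, inner ℝ (L x) t = inner ℝ x (ContinuousLinearMap.adjoint L t) := by
    intro x
    rw [ContinuousLinearMap.adjoint_inner_right]
  simp_rw [this]
  rw [← charFun_apply, charFun_stdGaussian, h, norm_smul, Real.norm_eq_abs]

lemma map_inner_stdGaussian (v : E) :
    (stdGaussian E).map (fun x => inner ℝ v x) = (gaussianReal 0 1).map (fun x => ‖v‖ * x) := by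
  have h1 : IsFiniteMeasure ((stdGaussian E).map (fun x => inner ℝ v x)) := inferInstance
  have h2 : IsFiniteMeasure ((gaussianReal 0 1).map (fun x => ‖v‖ * x)) := inferInstance
  refine Measure.ext_of_charFun ?_
  ext t
  rw [charFun_map_mul, charFun_gaussianReal, charFun_apply,
    integral_map (by fun_prop) (by fun_prop)]
  have : ∀ x, inner ℝ (inner ℝ v x : ℝ) t = inner ℝ x (t • v) := by
    intro x
    rw [inner_smul_right, real_inner_comm v x]
    simp
  simp_rw [this]
  rw [← charFun_apply, charFun_stdGaussian, norm_smul]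
  congr 1
  push_cast
  have h3 : ((‖t‖ : ℝ) : ℂ) ^ 2 = (t : ℂ) ^ 2 := by
    norm_cast
    simp
  rw [mul_pow, h3]
  simp
  ring

lemma integral_abs_inner_pow_stdGaussian (v : E) (p : ℕ) :
    ∫ x, |inner ℝ v x| ^ p ∂stdGaussian E = ‖v‖ ^ p * gaussMoment p := by
  have h := integral_map (μ := stdGaussian E) (φ := fun x => inner ℝ v x) (by fun_prop)
    (f := fun y : ℝ => |y| ^ p) (by fun_prop)
  rw [map_inner_stdGaussian, integral_map (by fun_prop) (by fun_prop)] at h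
  rw [← h]
  simp only [abs_mul, mul_pow, abs_norm]
  rw [integral_const_mul]
  rfl

lemma integral_norm_sq_stdGaussian (n : ℕ) : ∫ x, ‖x‖ ^ 2 ∂stdGaussian (Euc n) = n := by
  have h1 : ∀ x : Euc n, ‖x‖ ^ 2 = ∑ i, |inner ℝ (EuclideanSpace.basisFun (Fin n) ℝ i) x| ^ 2 := by
    intro x
    rw [← (EuclideanSpace.basisFun (Fin n) ℝ).sum_sq_norm_inner_right x]
    simp
  simp_rw [h1]
  rw [integral_finsetSum]
  · simp_rw [integral_abs_inner_pow_stdGaussian]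
    have : gaussMoment 2 = 1 := by simpa using gaussMoment_two_mul 1
    simp [this]
  · intro i _
    have := (IsGaussian.memLp_dual (stdGaussian (Euc n))
      (innerSL ℝ (EuclideanSpace.basisFun (Fin n) ℝ i)) 2 (by norm_num)).integrable_norm_pow (by norm_num)
    simpa using this

end std

lemma eLpNorm_natCast_pow {α : Type*} [MeasurableSpace α] {μ : Measure α} (f : α → ℝ) {p : ℕ}
    (hp : p ≠ 0) : eLpNorm f p μ ^ p = ∫⁻ x, ‖f x‖ₑ ^ p ∂μ := by
  have := eLpNorm_nnreal_pow_eq_lintegral (f := f) (μ := μ) (p := (p : NNReal)) (by exact_mod_cast hp)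
  simpa using this

lemma lintegral_enorm_pow_eq {α : Type*} [MeasurableSpace α] {μ : Measure α} {f : α → ℝ} {p : ℕ}
    (hf : Integrable (fun x => |f x| ^ p) μ) :
    ∫⁻ x, ‖f x‖ₑ ^ p ∂μ = ENNReal.ofReal (∫ x, |f x| ^ p ∂μ) := by
  rw [ofReal_integral_eq_lintegral_ofReal hf (ae_of_all _ fun x => by positivity)]
  refine lintegral_congr fun x => ?_
  rw [← ofReal_norm, ENNReal.ofReal_pow (by positivity), Real.norm_eq_abs]

lemma eLpNorm_natCast_eq_ofReal {α : Type*} [MeasurableSpace α] {μ : Measure α} {f : α → ℝ} {p : ℕ}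
    (hp : p ≠ 0) (hf : Integrable (fun x => |f x| ^ p) μ) {a : ℝ} (ha : 0 ≤ a)
    (h : ∫ x, |f x| ^ p ∂μ = a ^ p) : eLpNorm f p μ = ENNReal.ofReal a := by
  have h1 := eLpNorm_natCast_pow (μ := μ) f hp
  rw [lintegral_enorm_pow_eq hf, h, ENNReal.ofReal_pow ha] at h1
  exact (ENNReal.pow_right_strictMono hp).injective h1

lemma Seminorm.exists_inner_le {E : Type*} [NormedAddCommGroup E] [InnerProductSpace ℝ E]
    [FiniteDimensional ℝ E] (N : Seminorm ℝ E) {b : ℝ} (hb : 0 ≤ b) (hN : ∀ x, N x ≤ b * ‖x‖) (z : E) :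
    ∃ v : E, ‖v‖ ≤ b ∧ inner ℝ v z = N z ∧ ∀ w, inner ℝ v w ≤ N w := by
  rcases eq_or_ne z 0 with rfl | hz
  · exact ⟨0, by simpa, by simp, fun w => by simp⟩
  obtain ⟨g, hg1, hg2⟩ := exists_extension_of_le_sublinear
    (LinearPMap.mkSpanSingleton (K := ℝ) z (N z) hz) N
    (fun c hc x => by rw [map_smul_eq_mul, Real.norm_of_nonneg hc.le]) (fun x y => map_add_le_add N x y) (by
      rintro ⟨x, hx⟩
      obtain ⟨c, rfl⟩ := Submodule.mem_span_singleton.1 hx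
      have hc : LinearPMap.mkSpanSingleton (K := ℝ) z (N z) hz ⟨c • z, hx⟩ = c • N z :=
        LinearPMap.mkSpanSingleton'_apply _ _ _ _ _
      rw [hc]
      change c • N z ≤ N (c • z)
      rw [map_smul_eq_mul, smul_eq_mul]
      gcongr
      exact le_abs_self c)
  have hgc : Continuous g := g.continuous_of_finiteDimensional
  let v := (InnerProductSpace.toDual ℝ E).symm ⟨g, hgc⟩
  have hv : ∀ w, inner ℝ v w = g w := fun w => InnerProductSpace.toDual_symm_apply
  refine ⟨v, ?_, ?_, fun w => (hv w).trans_le (hg2 w)⟩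
  · have h1 : ‖v‖ ^ 2 ≤ b * ‖v‖ := by
      rw [← real_inner_self_eq_norm_sq, hv]
      exact (hg2 v).trans (hN v)
    rcases (norm_nonneg v).eq_or_lt with h | h
    · rw [← h]; exact hb
    · nlinarith
  · rw [hv]
    have := hg1 ⟨z, Submodule.mem_span_singleton_self z⟩
    rw [this]
    exact LinearPMap.mkSpanSingleton_apply _ _ hz _

section

variable {E : Type*} [NormedAddCommGroup E] [InnerProductSpace ℝ E] [FiniteDimensional ℝ E]
  [MeasurableSpace E] [BorelSpace E] {N : Seminorm ℝ E} {b g : ℝ} {p : ℕ}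

lemma Seminorm.continuous_of_le_mul_norm {E : Type*} [NormedAddCommGroup E]
    [InnerProductSpace ℝ E] {N : Seminorm ℝ E} (hN : ∀ x, N x ≤ b * ‖x‖) : Continuous N := by
  have : LipschitzWith b.toNNReal N := by
    refine LipschitzWith.of_dist_le_mul fun x y => ?_
    rw [Real.dist_eq, dist_eq_norm]
    refine (abs_sub_map_le_sub N x y).trans ((hN _).trans ?_)
    gcongr
    exact Real.le_coe_toNNReal b
  exact this.continuous

lemma integrable_abs_inner_pow_stdGaussian (v : E) (p : ℕ) :
    Integrable (fun x => |inner ℝ v x| ^ p) (stdGaussian E) := by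
  rcases Nat.eq_zero_or_pos p with rfl | hp
  · simp
  have := (IsGaussian.memLp_dual (stdGaussian E) (innerSL ℝ v) p (by simp)).integrable_norm_pow
    (by omega)
  simpa using this

lemma eLpNorm_inner_stdGaussian (hp : 1 ≤ p) (hg : 0 ≤ g) (hgp : g ^ p = gaussMoment p) (v : E) :
    eLpNorm (fun x => inner ℝ v x) p (stdGaussian E) = ENNReal.ofReal (‖v‖ * g) := by
  refine eLpNorm_natCast_eq_ofReal (by omega) (integrable_abs_inner_pow_stdGaussian v p)
    (by positivity) ?_
  rw [integral_abs_inner_pow_stdGaussian, mul_pow, hgp]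

lemma eLpNorm_seminorm_step_le (hp : 1 ≤ p) (hb : 0 ≤ b) (hN : ∀ x, N x ≤ b * ‖x‖) (hg : 0 ≤ g)
    (hgp : g ^ p = gaussMoment p) {c s : ℝ} (hc : c ≤ 1) (hs : 0 ≤ s) (z : E) :
    eLpNorm (fun y => max (N z - N (c • z + s • y)) 0) p (stdGaussian E) ≤
      ENNReal.ofReal ((1 - c) * N z + s * b * g) := by
  obtain ⟨v, hv1, hv2, hv3⟩ := N.exists_inner_le hb hN z
  have h0 : 0 ≤ (1 - c) * N z := mul_nonneg (by linarith) (apply_nonneg N z)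
  have h1 : ∀ y, ‖max (N z - N (c • z + s • y)) 0‖ ≤ (1 - c) * N z + |inner ℝ (s • v) y| := by
    intro y
    rw [Real.norm_of_nonneg (le_max_right _ _)]
    refine max_le ?_ (by positivity)
    have := hv3 (c • z + s • y)
    rw [inner_add_right, inner_smul_right, inner_smul_right, hv2] at this
    rw [inner_smul_left]
    have h2 := neg_abs_le (s * inner ℝ v y)
    simp only [conj_trivial]
    linarith
  have hp1 : (1 : ℝ≥0∞) ≤ p := by exact_mod_cast hp
  calc _ ≤ eLpNorm ((fun _ : E => (1 - c) * N z) + fun y => |inner ℝ (s • v) y|) p (stdGaussian E) :=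
        eLpNorm_mono_real h1
    _ ≤ eLpNorm (fun _ : E => (1 - c) * N z) p (stdGaussian E) +
        eLpNorm (fun y => |inner ℝ (s • v) y|) p (stdGaussian E) :=
        eLpNorm_add_le (by fun_prop) (by fun_prop) hp1
    _ ≤ ENNReal.ofReal ((1 - c) * N z) + ENNReal.ofReal (s * b * g) := by
        gcongr
        · rw [eLpNorm_const _ (by simp; omega) (NeZero.ne _)]
          simp [Real.enorm_of_nonneg h0]
        · have h2 : eLpNorm (fun y => |inner ℝ (s • v) y|) p (stdGaussian E) =
              eLpNorm (fun y => inner ℝ (s • v) y) p (stdGaussian E) :=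
            eLpNorm_norm (fun y => inner ℝ (s • v) y)
          rw [h2, eLpNorm_inner_stdGaussian hp hg hgp, norm_smul, Real.norm_of_nonneg hs]
          gcongr
    _ = _ := by rw [ENNReal.ofReal_add h0 (by positivity)]

lemma eLpNorm_seminorm_step_prod_le (hp : 1 ≤ p) (hb : 0 ≤ b) (hN : ∀ x, N x ≤ b * ‖x‖) (hg : 0 ≤ g)
    (hgp : g ^ p = gaussMoment p) {M : ℝ} (hM : eLpNorm N p (stdGaussian E) = ENNReal.ofReal M)
    (hM0 : 0 ≤ M)
    {c s : ℝ} (hc : c ≤ 1) (hs : 0 ≤ s) :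
    eLpNorm (fun z : E × E => max (N z.1 - N (c • z.1 + s • z.2)) 0) p
      ((stdGaussian E).prod (stdGaussian E)) ≤ ENNReal.ofReal ((1 - c) * M + s * b * g) := by
  have hp0 : p ≠ 0 := by omega
  have hp1 : (1 : ℝ≥0∞) ≤ p := by exact_mod_cast hp
  have hNc := Seminorm.continuous_of_le_mul_norm hN
  have h0 : ∀ z : E, 0 ≤ (1 - c) * N z := fun z => mul_nonneg (by linarith) (apply_nonneg N z)
  have hF : Continuous fun z : E × E => max (N z.1 - N (c • z.1 + s • z.2)) 0 := by fun_prop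
  have hFm : Measurable fun z : E × E => ‖max (N z.1 - N (c • z.1 + s • z.2)) 0‖ₑ ^ p :=
    hF.measurable.enorm.pow_const p
  refine (ENNReal.pow_le_pow_left_iff hp0).1 ?_
  have hstep : ∀ z : E, ∫⁻ y, ‖max (N z - N (c • z + s • y)) 0‖ₑ ^ p ∂stdGaussian E ≤
      ‖(1 - c) * N z + s * b * g‖ₑ ^ p := by
    intro z
    have := eLpNorm_seminorm_step_le hp hb hN hg hgp hc hs z
    rw [← ENNReal.pow_le_pow_left_iff hp0, eLpNorm_natCast_pow _ hp0] at this
    rwa [Real.enorm_of_nonneg (by have := h0 z; positivity)]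
  rw [eLpNorm_natCast_pow _ hp0, lintegral_prod _ hFm.aemeasurable]
  calc ∫⁻ z, ∫⁻ y, ‖max (N z - N (c • z + s • y)) 0‖ₑ ^ p ∂stdGaussian E ∂stdGaussian E
      ≤ ∫⁻ z : E, ‖(1 - c) * N z + s * b * g‖ₑ ^ p ∂stdGaussian E := lintegral_mono hstep
    _ = eLpNorm (fun z : E => (1 - c) * N z + s * b * g) p (stdGaussian E) ^ p :=
        (eLpNorm_natCast_pow (fun z : E => (1 - c) * N z + s * b * g) hp0).symm
    _ ≤ (eLpNorm (fun z : E => (1 - c) * N z) p (stdGaussian E) +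
          eLpNorm (fun _ : E => s * b * g) p (stdGaussian E)) ^ p := by
        refine pow_le_pow_left' ?_ p
        exact eLpNorm_add_le (f := fun z : E => (1 - c) * N z) (g := fun _ : E => s * b * g)
          (by fun_prop) (by fun_prop) hp1
    _ = _ := by
        have e1 : eLpNorm (fun z : E => (1 - c) * N z) p (stdGaussian E) =
            ENNReal.ofReal (1 - c) * ENNReal.ofReal M := by
          have := eLpNorm_const_smul (1 - c) (N : E → ℝ) p (stdGaussian E)
          rw [hM, Real.enorm_of_nonneg (by linarith)] at this
          exact this
        have e2 : eLpNorm (fun _ : E => s * b * g) p (stdGaussian E) = ENNReal.ofReal (s * b * g) := by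
          rw [eLpNorm_const _ (by simpa using hp0) (NeZero.ne _), Real.enorm_of_nonneg (by positivity)]
          simp
        rw [e1, e2, ENNReal.ofReal_add (mul_nonneg (by linarith) hM0) (by positivity),
          ENNReal.ofReal_mul (p := 1 - c) (by linarith)]

lemma eLpNorm_seminorm_chain_le (hp : 1 ≤ p) (hb : 0 ≤ b) (hN : ∀ x, N x ≤ b * ‖x‖) (hg : 0 ≤ g)
    (hgp : g ^ p = gaussMoment p) {M : ℝ} (hM : eLpNorm N p (stdGaussian E) = ENNReal.ofReal M)
    (hM0 : 0 ≤ M) (m : ℕ) (hm : 0 < m) :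
    eLpNorm (fun z : E × E => max (N z.1 - N z.2) 0) p
      ((stdGaussian E).prod (stdGaussian E)) ≤ ENNReal.ofReal (m *
        ((1 - Real.cos (Real.pi / 2 / m)) * M + Real.sin (Real.pi / 2 / m) * b * g)) := by
  have hp0 : p ≠ 0 := by omega
  have hp1 : (1 : ℝ≥0∞) ≤ p := by exact_mod_cast hp
  have hNc := Seminorm.continuous_of_le_mul_norm hN
  set δ := Real.pi / 2 / m with hδ
  have hm1 : (1 : ℝ) ≤ m := by exact_mod_cast hm
  have hpi := Real.pi_pos
  have hδ0 : 0 ≤ δ := by positivity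
  have hδ1 : δ ≤ Real.pi / 2 := div_le_self (by positivity) hm1
  let F : E × E → ℝ := fun z => max (N z.1 - N (Real.cos δ • z.1 + Real.sin δ • z.2)) 0
  have hFc : Continuous F := by fun_prop
  let X : ℕ → E × E → E := fun j z => Real.cos (j * δ) • z.1 + Real.sin (j * δ) • z.2
  have hstep : ∀ (j : ℕ) z, F (ContinuousLinearMap.rotation (j * δ) z) =
      max (N (X j z) - N (X (j + 1) z)) 0 := by
    intro j z
    simp only [F, X, ContinuousLinearMap.rotation_apply]
    congr 3
    push_cast
    rw [add_mul, one_mul, Real.cos_add, Real.sin_add]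
    module
  have hrot : ∀ j : ℕ, eLpNorm (F ∘ ContinuousLinearMap.rotation (j * δ)) p
      ((stdGaussian E).prod (stdGaussian E)) = eLpNorm F p ((stdGaussian E).prod (stdGaussian E)) := by
    intro j
    rw [← eLpNorm_map_measure hFc.aestronglyMeasurable (by fun_prop),
      IsGaussian.map_rotation_eq_self_of_forall_strongDual_eq_zero integral_strongDual_stdGaussian]
  have hsum : ∀ z : E × E, ∀ k : ℕ,
      N (X 0 z) - N (X k z) ≤ ∑ j ∈ Finset.range k, max (N (X j z) - N (X (j + 1) z)) 0 := by
    intro z k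
    rw [← Finset.sum_range_sub' (fun j => N (X j z))]
    exact Finset.sum_le_sum fun j _ => le_max_left _ _
  have hmono : ∀ z : E × E, ‖max (N z.1 - N z.2) 0‖ ≤
      (∑ j ∈ Finset.range m, F ∘ ContinuousLinearMap.rotation (j * δ)) z := by
    intro z
    rw [Real.norm_of_nonneg (le_max_right _ _), Finset.sum_apply]
    simp only [Function.comp_apply, hstep]
    refine max_le ?_ (Finset.sum_nonneg fun j _ => le_max_right _ _)
    have e0 : X 0 z = z.1 := by simp [X]
    have em : X m z = z.2 := by
      have : (m : ℝ) * δ = Real.pi / 2 := by rw [hδ]; field_simp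
      simp [X, this]
    have := hsum z m
    rwa [e0, em] at this
  calc _ ≤ eLpNorm (∑ j ∈ Finset.range m, F ∘ ContinuousLinearMap.rotation (j * δ)) p
        ((stdGaussian E).prod (stdGaussian E)) := eLpNorm_mono_real hmono
    _ ≤ ∑ j ∈ Finset.range m, eLpNorm (F ∘ ContinuousLinearMap.rotation (j * δ)) p
        ((stdGaussian E).prod (stdGaussian E)) := by
        refine eLpNorm_sum_le (fun j _ => ?_) hp1
        exact (hFc.comp (ContinuousLinearMap.continuous _)).aestronglyMeasurable
    _ = m * eLpNorm F p ((stdGaussian E).prod (stdGaussian E)) := by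
        rw [Finset.sum_congr rfl fun j _ => hrot j]
        simp
    _ ≤ _ := by
        rw [ENNReal.ofReal_mul (by positivity), ENNReal.ofReal_natCast]
        gcongr
        exact eLpNorm_seminorm_step_prod_le hp hb hN hg hgp hM hM0 (Real.cos_le_one _)
          (Real.sin_nonneg_of_nonneg_of_le_pi hδ0 (by linarith))

/-- Lower deviations of a seminorm with small Lipschitz constant under the standard Gaussian. -/
lemma stdGaussian_seminorm_small_le (hp : 1 ≤ p) (hb : 0 ≤ b) (hN : ∀ x, N x ≤ b * ‖x‖) (hg : 0 ≤ g)
    (hgp : g ^ p = gaussMoment p) {M : ℝ} (hM : eLpNorm N p (stdGaussian E) = ENNReal.ofReal M)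
    (hM0 : 0 < M) (hbM : 1600 * b * g ≤ M) :
    stdGaussian E {x | N x ≤ M / 4} ≤ ENNReal.ofReal (1 / 300) ^ p := by
  have hp0 : p ≠ 0 := by omega
  have hp1 : (1 : ℝ≥0∞) ≤ p := by exact_mod_cast hp
  have hNc := Seminorm.continuous_of_le_mul_norm hN
  have h1 : eLpNorm (fun z : E × E => max (N z.1 - N z.2) 0) p
      ((stdGaussian E).prod (stdGaussian E)) ≤ ENNReal.ofReal (M / 400) := by
    refine (eLpNorm_seminorm_chain_le hp hb hN hg hgp hM hM0.le 1000 (by norm_num)).trans ?_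
    refine ENNReal.ofReal_le_ofReal ?_
    set δ := Real.pi / 2 / (1000 : ℕ) with hδ
    have hδ0 : 0 ≤ δ := by have := Real.pi_pos; positivity
    have hδ1 : δ ≤ 0.0015708 := by
      have := Real.pi_lt_d6
      rw [hδ]; push_cast; linarith
    have hcos := Real.one_sub_sq_div_two_le_cos (x := δ)
    have hsin := Real.sin_le hδ0
    have hc : 1 - Real.cos δ ≤ 0.00000124 := by nlinarith
    have hs : Real.sin δ ≤ 0.0015708 := by linarith
    have hbg : 0 ≤ b * g := by positivity
    have e1 : (1 - Real.cos δ) * M ≤ 0.00000124 * M := by gcongr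
    have e2 : Real.sin δ * b * g ≤ 0.0015708 * (b * g) := by
      rw [mul_assoc]; gcongr
    push_cast
    linarith
  have hmeas : MeasurableSet {x : E | N x ≤ M / 4} := measurableSet_le hNc.measurable measurable_const
  set P := stdGaussian E {x : E | N x ≤ M / 4} with hP
  have h2 : P * eLpNorm (fun x => max (N x - M / 4) 0) p (stdGaussian E) ^ p ≤
      ENNReal.ofReal (M / 400) ^ p := by
    refine le_trans ?_ (pow_le_pow_left' h1 p)
    rw [eLpNorm_natCast_pow _ hp0, eLpNorm_natCast_pow _ hp0, lintegral_prod_symm _ (by fun_prop),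
      mul_comm, hP, ← lintegral_indicator_const hmeas]
    refine lintegral_mono fun y => ?_
    by_cases hy : y ∈ {x : E | N x ≤ M / 4}
    · rw [Set.indicator_of_mem hy]
      refine lintegral_mono fun x => ?_
      simp only
      gcongr
      rw [Real.enorm_of_nonneg (le_max_right _ _), Real.enorm_of_nonneg (le_max_right _ _)]
      gcongr
      exact hy
    · rw [Set.indicator_of_notMem hy]
      exact zero_le
  have h3 : ENNReal.ofReal (3 * M / 4) ≤ eLpNorm (fun x => max (N x - M / 4) 0) p (stdGaussian E) := by
    have h4 : eLpNorm N p (stdGaussian E) ≤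
        eLpNorm (fun x => max (N x - M / 4) 0) p (stdGaussian E) + ENNReal.ofReal (M / 4) := by
      calc _ ≤ eLpNorm ((fun x => max (N x - M / 4) 0) + fun _ => M / 4) p (stdGaussian E) := by
            refine eLpNorm_mono_real fun x => ?_
            rw [Real.norm_of_nonneg (apply_nonneg N x)]
            simp only [Pi.add_apply]
            linarith [le_max_left (N x - M / 4) 0]
        _ ≤ _ := eLpNorm_add_le (by fun_prop) (by fun_prop) hp1
        _ = _ := by
            rw [eLpNorm_const _ (by simpa using hp0) (NeZero.ne _), Real.enorm_of_nonneg (by positivity)]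
            simp
    rw [hM] at h4
    have h5 : ENNReal.ofReal M = ENNReal.ofReal (3 * M / 4) + ENNReal.ofReal (M / 4) := by
      rw [← ENNReal.ofReal_add (by positivity) (by positivity)]
      congr 1; ring
    rw [h5] at h4
    exact (ENNReal.add_le_add_iff_right ENNReal.ofReal_ne_top).1 h4
  have h6 : P * ENNReal.ofReal (3 * M / 4) ^ p ≤ ENNReal.ofReal (1 / 300) ^ p * ENNReal.ofReal (3 * M / 4) ^ p := by
    rw [← mul_pow, ← ENNReal.ofReal_mul (by positivity), show 1 / 300 * (3 * M / 4) = M / 400 by ring]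
    exact (by gcongr : P * ENNReal.ofReal (3 * M / 4) ^ p ≤ _).trans h2
  refine (ENNReal.mul_le_mul_iff_left ?_ ?_).1 h6
  · exact pow_ne_zero _ (by simpa using hM0)
  · exact ENNReal.pow_ne_top ENNReal.ofReal_ne_top

end

lemma volume_ball_eq_pow_mul {k : ℕ} (x : Euc k) {r : ℝ} (hr : 0 < r) :
    volume (Metric.ball x r) = ENNReal.ofReal (r ^ k) * volume (Metric.ball (0 : Euc k) 1) := by
  rw [Measure.addHaar_ball_of_pos _ _ hr]
  simp

/-- A seminorm which is neither large nor small on most of the unit ball is bounded below. -/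
lemma Seminorm.mul_norm_le_of_volume {k : ℕ} (hk : 2 ≤ k) (N : Seminorm ℝ (Euc k)) {M : ℝ}
    (hM : 0 < M)
    (h1 : volume {t ∈ Metric.ball (0 : Euc k) 1 | 5 * M < N t} ≤
      ENNReal.ofReal (3 * (1 / 5) ^ k) * volume (Metric.ball (0 : Euc k) 1))
    (h2 : volume {t ∈ Metric.ball (0 : Euc k) 1 | N t < M / 4 * ‖t‖} ≤
      ENNReal.ofReal (3 * (1 / 300) ^ k) * volume (Metric.ball (0 : Euc k) 1)) (t : Euc k) :
    M / 16 * ‖t‖ ≤ N t := by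
  have hb0 : volume (Metric.ball (0 : Euc k) 1) ≠ 0 :=
    (Metric.measure_ball_pos volume _ one_pos).ne'
  have hbt : volume (Metric.ball (0 : Euc k) 1) ≠ ∞ := measure_ball_lt_top.ne
  set β := volume (Metric.ball (0 : Euc k) 1) with hβ
  have hpow : ∀ a b : ℝ, 0 < a → 0 < b → (3 : ℝ) < (b / a) ^ 2 → a ≤ b → 3 * a ^ k < b ^ k := by
    intro a b ha hb h hab
    have : (3 : ℝ) < (b / a) ^ k :=
      h.trans_le (pow_le_pow_right₀ ((one_le_div ha).2 hab) hk)
    rw [div_pow, lt_div_iff₀ (by positivity)] at this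
    exact this
  have hup : ∀ s : Euc k, ‖s‖ ≤ 1 → N s ≤ 10 * M := by
    intro s hs
    by_contra! hcon
    set S := {t ∈ Metric.ball (0 : Euc k) 1 | 5 * M < N t} with hS
    have hsub : Metric.ball ((1 / 2 : ℝ) • s) (1 / 2) ⊆ S ∪ (fun a => a + (-s)) ⁻¹' S := by
      intro a ha
      have ha1 : a ∈ Metric.ball (0 : Euc k) 1 := by
        rw [mem_ball_zero_iff]
        rw [mem_ball_iff_norm] at ha
        calc ‖a‖ = ‖(a - (1 / 2 : ℝ) • s) + (1 / 2 : ℝ) • s‖ := by congr 1; abel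
          _ ≤ ‖a - (1 / 2 : ℝ) • s‖ + ‖(1 / 2 : ℝ) • s‖ := norm_add_le _ _
          _ < 1 := by rw [norm_smul]; norm_num; linarith
      have ha2 : a - s ∈ Metric.ball (0 : Euc k) 1 := by
        rw [mem_ball_zero_iff]
        rw [mem_ball_iff_norm] at ha
        calc ‖a - s‖ = ‖(a - (1 / 2 : ℝ) • s) + (-(1 / 2) : ℝ) • s‖ := by congr 1; module
          _ ≤ ‖a - (1 / 2 : ℝ) • s‖ + ‖(-(1 / 2) : ℝ) • s‖ := norm_add_le _ _
          _ < 1 := by rw [norm_smul]; norm_num; linarith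
      by_contra hn
      simp only [Set.mem_union, Set.mem_preimage, not_or, ← sub_eq_add_neg] at hn
      have e1 : N a ≤ 5 * M := by
        by_contra! h
        exact hn.1 ⟨ha1, h⟩
      have e2 : N (a - s) ≤ 5 * M := by
        by_contra! h
        exact hn.2 ⟨ha2, h⟩
      have e3 : N s ≤ N a + N (a - s) := by
        calc N s = N (a - (a - s)) := by congr 1; abel
          _ ≤ _ := map_sub_le_add N _ _
      linarith
    have hvol := (measure_mono hsub).trans (measure_union_le (μ := volume) _ _)
    rw [volume_ball_eq_pow_mul _ (by norm_num), measure_preimage_add_right, ← hβ] at hvol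
    have h3 := hvol.trans (add_le_add h1 h1)
    rw [← add_mul, ← ENNReal.ofReal_add (by positivity) (by positivity),
      ENNReal.mul_le_mul_iff_left hb0 hbt, ENNReal.ofReal_le_ofReal_iff (by positivity)] at h3
    have h4 : (6 : ℝ) < (5 / 2) ^ k :=
      (by norm_num : (6 : ℝ) < (5 / 2) ^ 2).trans_le (pow_le_pow_right₀ (by norm_num) hk)
    have h5 : ((1 : ℝ) / 2) ^ k = (5 / 2) ^ k * (1 / 5) ^ k := by rw [← mul_pow]; norm_num
    rw [h5] at h3
    have : (0 : ℝ) < (1 / 5) ^ k := by positivity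
    nlinarith
  have hunit : ∀ s : Euc k, ‖s‖ = 1 → M / 16 ≤ N s := by
    intro s hs
    have hex : ∃ t ∈ Metric.ball ((1 - 1 / 128 : ℝ) • s) (1 / 128), M / 4 * ‖t‖ ≤ N t := by
      by_contra! hcon
      have hsub : Metric.ball ((1 - 1 / 128 : ℝ) • s) (1 / 128) ⊆
          {t ∈ Metric.ball (0 : Euc k) 1 | N t < M / 4 * ‖t‖} := by
        intro a ha
        refine ⟨?_, hcon a ha⟩
        rw [mem_ball_zero_iff]
        rw [mem_ball_iff_norm] at ha
        calc ‖a‖ = ‖(a - (1 - 1 / 128 : ℝ) • s) + (1 - 1 / 128 : ℝ) • s‖ := by congr 1; abel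
          _ ≤ ‖a - (1 - 1 / 128 : ℝ) • s‖ + ‖(1 - 1 / 128 : ℝ) • s‖ := norm_add_le _ _
          _ < 1 := by rw [norm_smul, hs]; norm_num; norm_num at ha; linarith
      have h3 := (measure_mono hsub).trans h2
      rw [volume_ball_eq_pow_mul _ (by norm_num), ← hβ, ENNReal.mul_le_mul_iff_left hb0 hbt,
        ENNReal.ofReal_le_ofReal_iff (by positivity)] at h3
      have := hpow (1 / 300) (1 / 128) (by norm_num) (by norm_num) (by norm_num) (by norm_num)
      linarith
    obtain ⟨t, ht, htN⟩ := hex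
    rw [mem_ball_iff_norm] at ht
    have e1 : ‖s - t‖ ≤ 1 / 64 := by
      calc ‖s - t‖ = ‖(1 / 128 : ℝ) • s - (t - (1 - 1 / 128 : ℝ) • s)‖ := by congr 1; module
        _ ≤ ‖(1 / 128 : ℝ) • s‖ + ‖t - (1 - 1 / 128 : ℝ) • s‖ := norm_sub_le _ _
        _ ≤ 1 / 64 := by rw [norm_smul, hs]; norm_num; norm_num at ht; linarith
    have e2 : N (s - t) ≤ 10 * M / 64 := by
      have := hup ((64 : ℝ) • (s - t)) (by rw [norm_smul]; norm_num; linarith)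
      rw [map_smul_eq_mul] at this
      norm_num at this
      linarith
    have e3 : 1 - 1 / 64 ≤ ‖t‖ := by
      have := norm_sub_norm_le s t
      rw [hs] at this
      linarith
    have e4 : N t ≤ N s + N (s - t) := by
      calc N t = N (s - (s - t)) := by congr 1; abel
        _ ≤ _ := map_sub_le_add N _ _
    nlinarith
  rcases eq_or_ne t 0 with rfl | ht
  · simp
  have hnt : 0 < ‖t‖ := norm_pos_iff.2 ht
  have := hunit (‖t‖⁻¹ • t) (by rw [norm_smul, norm_inv, norm_norm]; field_simp)
  rw [map_smul_eq_mul, norm_inv, norm_norm, inv_mul_eq_div, le_div_iff₀ hnt] at this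
  exact this

/-- The linear combination of the vectors `Γ i` with coefficients `t i`. -/
noncomputable def combCLM (n k : ℕ) (t : Euc k) : PiLp 2 (fun _ : Fin k => Euc n) →L[ℝ] Euc n :=
  ∑ i, t i • PiLp.proj 2 (fun _ : Fin k => Euc n) i

lemma combCLM_apply {n k : ℕ} (t : Euc k) (Γ : PiLp 2 (fun _ : Fin k => Euc n)) :
    combCLM n k t Γ = ∑ i, t i • Γ i := by
  simp [combCLM]

lemma norm_adjoint_combCLM {n k : ℕ} (t : Euc k) (v : Euc n) :
    ‖ContinuousLinearMap.adjoint (combCLM n k t) v‖ = |‖t‖| * ‖v‖ := by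
  have h : ContinuousLinearMap.adjoint (combCLM n k t) v =
      WithLp.toLp 2 (fun i => t i • v) := by
    refine ext_inner_right ℝ fun Γ => ?_
    rw [ContinuousLinearMap.adjoint_inner_left, combCLM_apply, inner_sum, PiLp.inner_apply]
    simp only [inner_smul_left, inner_smul_right, conj_trivial]
  rw [h, abs_norm, PiLp.norm_eq_of_L2, EuclideanSpace.norm_eq, ← Real.sqrt_sq (norm_nonneg v),
    ← Real.sqrt_mul (by positivity), Finset.sum_mul]
  simp only [norm_smul, mul_pow]

lemma map_combCLM_stdGaussian {n k : ℕ} (t : Euc k) :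
    (stdGaussian (PiLp 2 (fun _ : Fin k => Euc n))).map (combCLM n k t) =
      (stdGaussian (Euc n)).map (fun x => ‖t‖ • x) :=
  map_stdGaussian_eq _ (norm_adjoint_combCLM t)

/-- Three averages can be controlled simultaneously at a single point. -/
lemma exists_forall_lintegral_le_three_mul {X Y : Type*} [MeasurableSpace X] [MeasurableSpace Y]
    (μ : Measure X) [IsProbabilityMeasure μ] (lam : Measure Y) [SFinite lam]
    (f : Fin 3 → X × Y → ℝ≥0∞) (hf : ∀ i, Measurable (f i)) (c : Fin 3 → ℝ≥0∞)
    (hc0 : ∀ i, c i ≠ 0) (hct : ∀ i, c i ≠ ∞)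
    (h : ∀ i, ∀ᵐ y ∂lam, ∫⁻ x, f i (x, y) ∂μ ≤ c i) :
    ∃ x, ∀ i, ∫⁻ y, f i (x, y) ∂lam ≤ c i * (3 * lam Set.univ) := by
  have hfx : ∀ i y, Measurable fun x => f i (x, y) := fun i y => (hf i).comp measurable_prodMk_right
  have hfy : ∀ i x, Measurable fun y => f i (x, y) := fun i x => (hf i).comp measurable_prodMk_left
  have hm : Measurable fun z : X × Y => ∑ i, (c i)⁻¹ * f i z :=
    Finset.measurable_sum _ fun i _ => (hf i).const_mul _
  obtain ⟨x, hx⟩ := exists_le_lintegral (μ := μ)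
    (f := fun x => ∫⁻ y, ∑ i, (c i)⁻¹ * f i (x, y) ∂lam)
    (Measurable.lintegral_prod_right' hm).aemeasurable
  rw [lintegral_lintegral_swap hm.aemeasurable] at hx
  have hle : ∫⁻ y, (∫⁻ x, ∑ i, (c i)⁻¹ * f i (x, y) ∂μ) ∂lam ≤ 3 * lam Set.univ := by
    rw [← lintegral_const]
    refine lintegral_mono_ae ?_
    filter_upwards [ae_all_iff.2 h] with y hy
    rw [lintegral_finsetSum _ fun i _ => (hfx i y).const_mul _]
    calc _ ≤ ∑ i : Fin 3, (1 : ℝ≥0∞) := by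
          refine Finset.sum_le_sum fun i _ => ?_
          rw [lintegral_const_mul _ (hfx i y)]
          calc _ ≤ (c i)⁻¹ * c i := by gcongr; exact hy i
            _ = 1 := ENNReal.inv_mul_cancel (hc0 i) (hct i)
      _ = 3 := by simp
  refine ⟨x, fun i => ?_⟩
  have h1 : (c i)⁻¹ * ∫⁻ y, f i (x, y) ∂lam ≤ 3 * lam Set.univ := by
    rw [← lintegral_const_mul _ (hfy i x)]
    refine le_trans (lintegral_mono fun y => ?_) (hx.trans hle)
    exact Finset.single_le_sum (f := fun i => (c i)⁻¹ * f i (x, y)) (fun _ _ => zero_le)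
      (Finset.mem_univ i)
  calc _ = c i * ((c i)⁻¹ * ∫⁻ y, f i (x, y) ∂lam) := by
        rw [← mul_assoc, ENNReal.mul_inv_cancel (hc0 i) (hct i), one_mul]
    _ ≤ _ := by gcongr

lemma exists_gaussian_frame {n k : ℕ} (hn : 0 < n) (hk : 2 ≤ k) (N : Seminorm ℝ (Euc n))
    (hN : Continuous N) {M : ℝ} (hM : 0 < M)
    (h1 : ∫⁻ x, ‖N x‖ₑ ^ k ∂stdGaussian (Euc n) ≤ ENNReal.ofReal M ^ k)
    (h2 : stdGaussian (Euc n) {x | N x ≤ M / 4} ≤ ENNReal.ofReal (1 / 300) ^ k) :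
    ∃ Γ : Fin k → Euc n, (∀ t : Euc k, M / 16 * ‖t‖ ≤ N (∑ i, t i • Γ i)) ∧
      ∑ i, ‖Γ i‖ ^ 2 ≤ 3 * k * n := by
  let V := PiLp 2 (fun _ : Fin k => Euc n)
  set β := volume (Metric.ball (0 : Euc k) 1) with hβ
  have hb0 : β ≠ 0 := (Metric.measure_ball_pos volume _ one_pos).ne'
  have hbt : β ≠ ∞ := measure_ball_lt_top.ne
  have hcomb : Continuous fun z : V × Euc k => combCLM n k z.2 z.1 := by
    simp only [combCLM_apply]
    refine continuous_finsetSum _ fun i _ => ?_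
    exact ((PiLp.continuous_apply 2 _ i).comp continuous_snd).smul
      ((PiLp.continuous_apply 2 _ i).comp continuous_fst)
  have hMk0 : ENNReal.ofReal M ^ k ≠ 0 := pow_ne_zero _ (by simpa using hM)
  have hMkt : ENNReal.ofReal M ^ k ≠ ∞ := ENNReal.pow_ne_top ENNReal.ofReal_ne_top
  have hck0 : ENNReal.ofReal (1 / 300) ^ k ≠ 0 := pow_ne_zero _ (by simp)
  have hckt : ENNReal.ofReal (1 / 300) ^ k ≠ ∞ := ENNReal.pow_ne_top ENNReal.ofReal_ne_top
  have hnk0 : ENNReal.ofReal (k * n) ≠ 0 := by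
    have : (0 : ℝ) < k * n := by positivity
    simpa only [ne_eq, ENNReal.ofReal_eq_zero, not_le] using this
  have hnkt : ENNReal.ofReal (k * n) ≠ ∞ := ENNReal.ofReal_ne_top
  let T : Set (V × Euc k) := {z | N (combCLM n k z.2 z.1) < M / 4 * ‖z.2‖}
  have hT : MeasurableSet T :=
    measurableSet_lt (hN.comp hcomb).measurable (by fun_prop)
  let f1 : V × Euc k → ℝ≥0∞ := fun z => ‖N (combCLM n k z.2 z.1)‖ₑ ^ k
  have hf1 : Measurable f1 := (hN.comp hcomb).measurable.enorm.pow_const k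
  let f2 : V × Euc k → ℝ≥0∞ := T.indicator 1
  have hf2 : Measurable f2 := measurable_one.indicator hT
  let f3 : V × Euc k → ℝ≥0∞ := fun z => ENNReal.ofReal (‖z.1‖ ^ 2)
  have hf3 : Measurable f3 := by fun_prop
  have e1 : ∀ t ∈ Metric.ball (0 : Euc k) 1,
      ∫⁻ Γ, f1 (Γ, t) ∂stdGaussian V ≤ ENNReal.ofReal M ^ k := by
    intro t ht
    have ht' : ‖t‖ ≤ 1 := (mem_ball_zero_iff.1 ht).le
    have := lintegral_map (μ := stdGaussian V) (f := fun x => ‖N x‖ₑ ^ k) (g := combCLM n k t)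
      (hN.measurable.enorm.pow_const k) (by fun_prop)
    rw [map_combCLM_stdGaussian,
      lintegral_map (hN.measurable.enorm.pow_const k) (by fun_prop)] at this
    refine (this.symm.le).trans (le_trans (lintegral_mono fun x => ?_) h1)
    simp only
    refine pow_le_pow_left' ?_ k
    rw [Real.enorm_of_nonneg (apply_nonneg _ _), Real.enorm_of_nonneg (apply_nonneg _ _),
      map_smul_eq_mul, norm_norm]
    exact ENNReal.ofReal_le_ofReal (mul_le_of_le_one_left (apply_nonneg _ _) ht')
  have e2 : ∀ t, ∫⁻ Γ, f2 (Γ, t) ∂stdGaussian V ≤ ENNReal.ofReal (1 / 300) ^ k := by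
    intro t
    have hS : MeasurableSet {x : Euc n | N x < M / 4 * ‖t‖} :=
      measurableSet_lt hN.measurable measurable_const
    have hpre : (fun Γ : V => f2 (Γ, t)) =
        ((combCLM n k t) ⁻¹' {x : Euc n | N x < M / 4 * ‖t‖}).indicator 1 := rfl
    rw [hpre, lintegral_indicator_one ((ContinuousLinearMap.measurable _) hS),
      ← Measure.map_apply (ContinuousLinearMap.measurable _) hS, map_combCLM_stdGaussian,
      Measure.map_apply (by fun_prop) hS]
    refine le_trans (measure_mono ?_) h2
    intro x hx
    simp only [Set.mem_preimage, Set.mem_ofPred_eq, map_smul_eq_mul, norm_norm] at hx ⊢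
    have ht : 0 < ‖t‖ := by
      rcases (norm_nonneg t).eq_or_lt with h | h
      · rw [← h] at hx; simp at hx
      · exact h
    by_contra! hcon
    nlinarith
  have e3 : ∫⁻ Γ : V, ENNReal.ofReal (‖Γ‖ ^ 2) ∂stdGaussian V ≤ ENNReal.ofReal (k * n) := by
    have hsum : ∀ Γ : V, ENNReal.ofReal (‖Γ‖ ^ 2) =
        ∑ i, ENNReal.ofReal (‖combCLM n k (EuclideanSpace.single i 1) Γ‖ ^ 2) := by
      intro Γ
      rw [← ENNReal.ofReal_sum_of_nonneg (fun _ _ => by positivity), PiLp.norm_sq_eq_of_L2]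
      congr 1
      refine Finset.sum_congr rfl fun i _ => ?_
      rw [combCLM_apply]
      simp [PiLp.single_apply]
    simp_rw [hsum]
    rw [lintegral_finsetSum _ (fun i _ => by fun_prop)]
    have hone : ∀ i : Fin k, ∫⁻ Γ : V,
        ENNReal.ofReal (‖combCLM n k (EuclideanSpace.single i 1) Γ‖ ^ 2) ∂stdGaussian V =
        ENNReal.ofReal n := by
      intro i
      have := lintegral_map (μ := stdGaussian V) (f := fun x : Euc n => ENNReal.ofReal (‖x‖ ^ 2))
        (g := combCLM n k (EuclideanSpace.single i 1)) (by fun_prop) (by fun_prop)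
      rw [← this, map_combCLM_stdGaussian]
      simp only [PiLp.norm_single, norm_one, one_smul, Measure.map_id']
      rw [← ofReal_integral_eq_lintegral_ofReal _ (ae_of_all _ fun x => by positivity),
        integral_norm_sq_stdGaussian]
      exact (IsGaussian.memLp_id (stdGaussian (Euc n)) 2 (by simp)).integrable_norm_pow (by simp)
    rw [Finset.sum_congr rfl fun i _ => hone i]
    simp [ENNReal.ofReal_mul]
  obtain ⟨Γ, hΓ⟩ := exists_forall_lintegral_le_three_mul (stdGaussian V)
    (volume.restrict (Metric.ball (0 : Euc k) 1)) ![f1, f2, f3]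
    (by intro i; fin_cases i <;> assumption)
    ![ENNReal.ofReal M ^ k, ENNReal.ofReal (1 / 300) ^ k, ENNReal.ofReal (k * n)]
    (by intro i; fin_cases i <;> assumption) (by intro i; fin_cases i <;> assumption)
    (by
      intro i
      fin_cases i
      · exact ae_restrict_of_forall_mem measurableSet_ball e1
      · exact ae_of_all _ e2
      · exact ae_of_all _ fun _ => e3)
  rw [Measure.restrict_apply_univ, ← hβ] at hΓ
  have g1 : ∫⁻ t in Metric.ball (0 : Euc k) 1, f1 (Γ, t) ≤ _ := hΓ 0
  have g2 : ∫⁻ t in Metric.ball (0 : Euc k) 1, f2 (Γ, t) ≤ _ := hΓ 1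
  have g3 : ∫⁻ t in Metric.ball (0 : Euc k) 1, f3 (Γ, t) ≤ _ := hΓ 2
  simp only [Matrix.cons_val] at g1 g2 g3
  refine ⟨fun i => Γ i, fun t => ?_, ?_⟩
  · let L : Euc k →ₗ[ℝ] Euc n := ∑ i, (EuclideanSpace.proj (𝕜 := ℝ) i).toLinearMap.smulRight (Γ i)
    have hL : ∀ t, L t = combCLM n k t Γ := by
      intro t
      simp [L, combCLM_apply]
    have hLc : Continuous L := L.continuous_of_finiteDimensional
    have := Seminorm.mul_norm_le_of_volume hk (N.comp L) hM ?_ ?_ t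
    · rw [Seminorm.comp_apply, hL, combCLM_apply] at this
      exact this
    · have hmk := mul_meas_ge_le_lintegral₀ (μ := volume.restrict (Metric.ball (0 : Euc k) 1))
        (f := fun t => f1 (Γ, t)) (by fun_prop) (ENNReal.ofReal (5 * M) ^ k)
      have hsub : {t ∈ Metric.ball (0 : Euc k) 1 | 5 * M < N.comp L t} ⊆
          {t | ENNReal.ofReal (5 * M) ^ k ≤ f1 (Γ, t)} ∩ Metric.ball 0 1 := by
        rintro t ⟨ht1, ht2⟩
        refine ⟨?_, ht1⟩
        rw [Seminorm.comp_apply, hL] at ht2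
        simp only [f1, Set.mem_ofPred_eq]
        rw [Real.enorm_of_nonneg (apply_nonneg _ _)]
        gcongr
      have hmono := measure_mono (μ := volume) hsub
      rw [← Measure.restrict_apply' measurableSet_ball] at hmono
      have h5 : ENNReal.ofReal (5 * M) ^ k ≠ 0 := pow_ne_zero _ (by simpa using hM)
      have h5t : ENNReal.ofReal (5 * M) ^ k ≠ ∞ := ENNReal.pow_ne_top ENNReal.ofReal_ne_top
      refine hmono.trans ((ENNReal.mul_le_mul_iff_right h5 h5t).1 ((hmk.trans g1).trans_eq ?_))
      rw [← hβ, ← ENNReal.ofReal_pow hM.le, ← ENNReal.ofReal_pow (by positivity), ← mul_assoc,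
        ← mul_assoc, ← ENNReal.ofReal_mul (by positivity), ← ENNReal.ofReal_ofNat 3,
        ← ENNReal.ofReal_mul (by positivity)]
      congr 2
      rw [mul_pow, one_div, inv_pow]
      field_simp
    · have hset : {t ∈ Metric.ball (0 : Euc k) 1 | N.comp L t < M / 4 * ‖t‖} =
          {t | (Γ, t) ∈ T} ∩ Metric.ball 0 1 := by
        ext t
        simp only [Set.mem_ofPred_eq, Set.mem_inter_iff, Seminorm.comp_apply, hL, T]
        exact and_comm
      have hTm : MeasurableSet {t | (Γ, t) ∈ T} := measurable_prodMk_left hT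
      rw [hset, ← Measure.restrict_apply' measurableSet_ball, ← lintegral_indicator_one hTm]
      refine g2.trans_eq ?_
      rw [← hβ, ← mul_assoc, ← ENNReal.ofReal_pow (by norm_num), ← ENNReal.ofReal_ofNat 3,
        ← ENNReal.ofReal_mul (by positivity), mul_comm (3 : ℝ)]
  · have : ENNReal.ofReal (‖Γ‖ ^ 2) * β ≤ ENNReal.ofReal (3 * k * n) * β := by
      calc _ = ∫⁻ t in Metric.ball (0 : Euc k) 1, f3 (Γ, t) := by simp [f3, hβ]
        _ ≤ _ := g3
        _ = _ := by
          rw [← mul_assoc, ← ENNReal.ofReal_ofNat 3, ← ENNReal.ofReal_mul (by positivity)]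
          congr 2
          ring
    rw [ENNReal.mul_le_mul_iff_left hb0 hbt, ENNReal.ofReal_le_ofReal_iff (by positivity),
      PiLp.norm_sq_eq_of_L2] at this
    exact this

lemma exists_pow_eq {a : ℝ} (ha : 0 ≤ a) {p : ℕ} (hp : p ≠ 0) : ∃ b : ℝ, 0 ≤ b ∧ b ^ p = a :=
  ⟨a ^ (p⁻¹ : ℝ), by positivity, Real.rpow_inv_natCast_pow ha hp⟩

section

variable {n : ℕ} {ν : Measure (Euc n)}

/-- The seminorm of moments of order `p` of linear functionals. -/
lemma IsSymLogConcave.exists_moment_seminorm (hν : IsSymLogConcave ν) {p : ℕ} (hp : 1 ≤ p) :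
    ∃ N : Seminorm ℝ (Euc n), ∀ z, N z ^ p = ∫ x, |inner ℝ z x| ^ p ∂ν := by
  have hp0 : p ≠ 0 := by omega
  have hp1 : (1 : ℝ≥0∞) ≤ p := by exact_mod_cast hp
  have hinteg : ∀ z : Euc n, Integrable (fun x => |inner ℝ z x| ^ p) ν := fun z =>
    hν.integrable (by fun_prop)
  have hpow : ∀ z : Euc n, eLpNorm (fun x => inner ℝ z x) p ν ^ p =
      ENNReal.ofReal (∫ x, |inner ℝ z x| ^ p ∂ν) := fun z => by
    rw [eLpNorm_natCast_pow _ hp0, lintegral_enorm_pow_eq (hinteg z)]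
  have hfin : ∀ z : Euc n, eLpNorm (fun x => inner ℝ z x) p ν ≠ ∞ := by
    intro z h
    have := hpow z
    rw [h, ENNReal.top_pow hp0] at this
    exact ENNReal.ofReal_ne_top this.symm
  refine ⟨Seminorm.of (fun z => (eLpNorm (fun x => inner ℝ z x) p ν).toReal) ?_ ?_, ?_⟩
  · intro z w
    rw [← ENNReal.toReal_add (hfin z) (hfin w)]
    refine ENNReal.toReal_mono (ENNReal.add_ne_top.2 ⟨hfin z, hfin w⟩) ?_
    simp_rw [inner_add_left]
    exact eLpNorm_add_le (f := fun x => inner ℝ z x) (g := fun x => inner ℝ w x) (by fun_prop)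
      (by fun_prop) hp1
  · intro c z
    have := eLpNorm_const_smul c (fun x => inner ℝ z x) p ν
    have h2 : (c • fun x => inner ℝ z x) = fun x : Euc n => inner ℝ (c • z) x := by
      ext x
      simp [inner_smul_left]
    rw [h2] at this
    rw [this, ENNReal.toReal_mul, toReal_enorm]
  · intro z
    change (eLpNorm (fun x => inner ℝ z x) p ν).toReal ^ p = _
    rw [← ENNReal.toReal_pow, hpow, ENNReal.toReal_ofReal (integral_nonneg fun x => by positivity)]

/-- Moments of order at most of the order `√n` of the norm of an isotropic symmetric log-concave
random vector. -/
theorem IsSymLogConcave.integral_norm_pow_le (hn : 0 < n) (hν : IsSymLogConcave ν)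
    (hiso : ∀ v : Euc n, ∫ x, (inner ℝ v x : ℝ) ^ 2 ∂ν = ‖v‖ ^ 2) {q : ℕ} (hq : 1 ≤ q)
    (hqn : (2 * q : ℝ) ≤ 5 * √n) :
    ∫ x, ‖x‖ ^ (2 * q) ∂ν ≤ (100000 * √n) ^ (2 * q) := by
  have := hν.prob
  set p := 2 * q with hp
  have hp2 : 2 ≤ p := by omega
  have hp0 : p ≠ 0 := by omega
  have hpr : (p : ℝ) = 2 * q := by rw [hp]; push_cast; ring
  have hq1 : (1 : ℝ) ≤ q := by exact_mod_cast hq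
  obtain ⟨A, hA0, hA⟩ := exists_pow_eq (a := ∫ x, ‖x‖ ^ p ∂ν)
    (integral_nonneg fun x => by positivity) hp0
  obtain ⟨g, hg0, hg⟩ := exists_pow_eq (a := gaussMoment p)
    (integral_nonneg fun x => by positivity) hp0
  obtain ⟨N, hN⟩ := hν.exists_moment_seminorm (p := p) (by omega)
  rw [← hA]
  refine pow_le_pow_left₀ hA0 ?_ p
  rcases lt_or_ge A (20000 * p) with hAp | hAp
  · rw [hpr] at hAp
    nlinarith
  have hA1 : 0 < A := lt_of_lt_of_le (by rw [hpr]; positivity) hAp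
  have hgsq : (q : ℝ) / 2 ≤ g ^ 2 := by
    have h1 := le_gaussMoment_two_mul q
    rw [← hp, ← hg, hp, pow_mul] at h1
    exact le_of_pow_le_pow_left₀ (by omega) (by positivity) h1
  have hg1 : 0 < g := by
    rcases hg0.eq_or_lt with h | h
    · rw [← h] at hgsq; norm_num at hgsq; linarith
    · exact h
  have hNb : ∀ x, N x ≤ 12 * p * ‖x‖ := by
    intro z
    rcases eq_or_ne z 0 with rfl | hz
    · simp
    have hz' : 0 < ‖z‖ := norm_pos_iff.2 hz
    have h1 := hν.integral_abs_pow_functional_le (innerSL ℝ z) (p := p) hz' (hiso z).le hp2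
    simp only [innerSL_apply_apply] at h1
    rw [← hN] at h1
    have := le_of_pow_le_pow_left₀ hp0 (by positivity) h1
    linarith
  have hNc : Continuous N := Seminorm.continuous_of_le_mul_norm hNb
  have hlint : ∫⁻ z, ‖N z‖ₑ ^ p ∂stdGaussian (Euc n) = ENNReal.ofReal (g * A) ^ p := by
    have e1 : ∀ z, ‖N z‖ₑ ^ p = ∫⁻ x, ‖(inner ℝ z x : ℝ)‖ₑ ^ p ∂ν := by
      intro z
      rw [lintegral_enorm_pow_eq (hν.integrable (by fun_prop)), ← hN,
        Real.enorm_of_nonneg (apply_nonneg _ _), ENNReal.ofReal_pow (apply_nonneg _ _)]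
    have hm : Measurable fun z : Euc n × Euc n => ‖(inner ℝ z.1 z.2 : ℝ)‖ₑ ^ p := by fun_prop
    have e2 : ∀ x : Euc n, ∫⁻ z, ‖(inner ℝ z x : ℝ)‖ₑ ^ p ∂stdGaussian (Euc n) =
        ENNReal.ofReal (‖x‖ ^ p) * ENNReal.ofReal (gaussMoment p) := by
      intro x
      simp_rw [real_inner_comm x]
      rw [lintegral_enorm_pow_eq (integrable_abs_inner_pow_stdGaussian x p),
        integral_abs_inner_pow_stdGaussian, ENNReal.ofReal_mul (by positivity)]
    simp_rw [e1]
    rw [lintegral_lintegral_swap hm.aemeasurable]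
    simp_rw [e2]
    rw [lintegral_mul_const _ (by fun_prop), ← ofReal_integral_eq_lintegral_ofReal
      (hν.integrable (by fun_prop)) (ae_of_all _ fun x => by positivity), ← hA, ← hg,
      ← ENNReal.ofReal_mul (by positivity), ← ENNReal.ofReal_pow (by positivity), mul_pow, mul_comm]
  have hM : 0 < g * A := by positivity
  have hNM : eLpNorm N p (stdGaussian (Euc n)) = ENNReal.ofReal (g * A) := by
    refine (ENNReal.pow_right_strictMono hp0).injective ?_
    simp only
    rw [eLpNorm_natCast_pow _ hp0, hlint]
  have hsmall := stdGaussian_seminorm_small_le (by omega) (by positivity) hNb hg0 hg hNM hM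
    (by nlinarith)
  obtain ⟨Γ, hΓ1, hΓ2⟩ := exists_gaussian_frame hn hp2 N hNc hM hlint.le hsmall
  let L : Euc n →L[ℝ] Euc p :=
    (EuclideanSpace.equiv (Fin p) ℝ).symm.toContinuousLinearMap ∘L
      ContinuousLinearMap.pi fun i => innerSL ℝ (Γ i)
  have hL : ∀ x i, L x i = inner ℝ (Γ i) x := fun x i => rfl
  have hν' := hν.map L
  have hfin := hν'.sq_le_integral_norm_sq hp2 (m := g * A / 16) (by positivity) (by
    intro t
    rw [integral_map (by fun_prop) (by fun_prop)]
    have : ∀ x, inner ℝ t (L x) = inner ℝ (∑ i, t i • Γ i) x := by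
      intro x
      rw [sum_inner, PiLp.inner_apply]
      refine Finset.sum_congr rfl fun i _ => ?_
      rw [hL, inner_smul_left]
      simp [mul_comm]
    simp_rw [this]
    rw [← hN]
    exact pow_le_pow_left₀ (by positivity) (hΓ1 t) p)
  rw [integral_map (by fun_prop) (by fun_prop)] at hfin
  have hsum : ∫ x, ‖L x‖ ^ 2 ∂ν = ∑ i, ‖Γ i‖ ^ 2 := by
    have : ∀ x, ‖L x‖ ^ 2 = ∑ i, (inner ℝ (Γ i) x : ℝ) ^ 2 := fun x => by
      simp_rw [EuclideanSpace.norm_sq_eq, hL, Real.norm_eq_abs, sq_abs]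
    simp_rw [this]
    rw [integral_finsetSum _ fun i _ => hν.integrable (by fun_prop)]
    exact Finset.sum_congr rfl fun i _ => (hiso _)
  rw [hsum] at hfin
  have h1 := hfin.trans hΓ2
  have h2 : (q : ℝ) / 2 * A ^ 2 ≤ g ^ 2 * A ^ 2 := by gcongr
  rw [hpr] at h1
  have h3 : A ^ 2 ≤ 12 * 16000 ^ 2 * n := by
    have : q * A ^ 2 ≤ q * (12 * 16000 ^ 2 * n) := by nlinarith
    exact le_of_mul_le_mul_left this (by linarith)
  refine le_of_pow_le_pow_left₀ two_ne_zero (by positivity) ?_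
  rw [mul_pow, Real.sq_sqrt (by positivity)]
  nlinarith [(Nat.cast_nonneg n : (0 : ℝ) ≤ n)]

end

section

open Matrix

variable {n : ℕ}

/-- Hadamard's inequality. -/
theorem Matrix.abs_det_le_prod_norm_row (A : Matrix (Fin n) (Fin n) ℝ) :
    |A.det| ≤ ∏ i, ‖WithLp.toLp 2 (A i)‖ := by
  have : Fact (Module.finrank ℝ (Euc n) = n) := ⟨by simp⟩
  have h := (EuclideanSpace.basisFun (Fin n) ℝ).toBasis.orientation.abs_volumeForm_apply_le
    fun i => WithLp.toLp 2 (A i)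
  rwa [Orientation.volumeForm_robust' _ (EuclideanSpace.basisFun (Fin n) ℝ), Module.Basis.det_apply,
    ← Matrix.det_transpose] at h

lemma prod_le_sum_div_pow (hn : 0 < n) {z : Fin n → ℝ} (hz : ∀ i, 0 ≤ z i) :
    ∏ i, z i ≤ ((∑ i, z i) / n) ^ n := by
  have h := Real.geom_mean_le_arith_mean Finset.univ (fun _ => (1 : ℝ)) z (fun _ _ => by simp)
    (by simpa using hn) (fun i _ => hz i)
  simp only [Real.rpow_one, Finset.sum_const, Finset.card_univ, Fintype.card_fin, nsmul_eq_mul,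
    mul_one, one_mul] at h
  have := pow_le_pow_left₀ (Real.rpow_nonneg (Finset.prod_nonneg fun i _ => hz i) _) h n
  rwa [Real.rpow_inv_natCast_pow (Finset.prod_nonneg fun i _ => hz i) hn.ne'] at this

theorem Matrix.det_sq_le (hn : 0 < n) (A : Matrix (Fin n) (Fin n) ℝ) :
    A.det ^ 2 ≤ ((∑ i, ∑ j, A i j ^ 2) / n) ^ n := by
  have h := pow_le_pow_left₀ (abs_nonneg _) A.abs_det_le_prod_norm_row 2
  rw [sq_abs, ← Finset.prod_pow] at h
  refine h.trans ((prod_le_sum_div_pow hn fun i => by positivity).trans_eq ?_)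
  simp [EuclideanSpace.norm_sq_eq]

open scoped MatrixOrder in
theorem Matrix.PosDef.exists_mul_mul_transpose_eq_one {M : Matrix (Fin n) (Fin n) ℝ}
    (hM : M.PosDef) : ∃ B : Matrix (Fin n) (Fin n) ℝ, B * M * Bᵀ = 1 := by
  obtain ⟨N, hN⟩ := CStarAlgebra.nonneg_iff_eq_star_mul_self.1 hM.posSemidef.nonneg
  rw [star_eq_conjTranspose, conjTranspose_eq_transpose_of_trivial] at hN
  have hu : IsUnit N.det := by
    have := (isUnit_iff_isUnit_det _).1 hM.isUnit
    rw [hN, det_mul] at this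
    exact isUnit_of_mul_isUnit_right this
  have hu' : IsUnit Nᵀ.det := by rwa [det_transpose]
  refine ⟨Nᵀ⁻¹, ?_⟩
  rw [hN, ← mul_assoc, nonsing_inv_mul _ hu', one_mul, transpose_nonsing_inv, transpose_transpose,
    mul_nonsing_inv _ hu]

/-- The matrix of second moments. -/
noncomputable def secondMoment (ν : Measure (Euc n)) : Matrix (Fin n) (Fin n) ℝ :=
  .of fun i j => ∫ x, x i * x j ∂ν

variable {ν : Measure (Euc n)}

lemma integral_inner_sq_eq (hinteg : ∀ i j, Integrable (fun x : Euc n => x i * x j) ν) (v : Euc n) :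
    ∫ x, (inner ℝ v x : ℝ) ^ 2 ∂ν = v.ofLp ⬝ᵥ secondMoment ν *ᵥ v.ofLp := by
  have : ∀ x : Euc n, (inner ℝ v x : ℝ) ^ 2 = ∑ i, ∑ j, v i * v j * (x i * x j) := by
    intro x
    rw [PiLp.inner_apply, sq, Finset.sum_mul_sum]
    refine Finset.sum_congr rfl fun i _ => Finset.sum_congr rfl fun j _ => ?_
    simp only [RCLike.inner_apply, conj_trivial]
    ring
  simp_rw [this]
  rw [integral_finsetSum _ fun i _ => integrable_finsetSum _ fun j _ => (hinteg i j).const_mul _]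
  simp only [dotProduct, mulVec, Finset.mul_sum]
  refine Finset.sum_congr rfl fun i _ => ?_
  rw [integral_finsetSum _ fun j _ => (hinteg i j).const_mul _]
  refine Finset.sum_congr rfl fun j _ => ?_
  rw [integral_const_mul, secondMoment, of_apply]
  ring

lemma inner_toEuclideanCLM (B : Matrix (Fin n) (Fin n) ℝ) (v x : Euc n) :
    (inner ℝ v (toEuclideanCLM (𝕜 := ℝ) B x) : ℝ) = inner ℝ (toEuclideanCLM (𝕜 := ℝ) Bᵀ v) x := by
  have : Bᵀ = star B := by simp [star_eq_conjTranspose]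
  rw [this, map_star, ContinuousLinearMap.star_eq_adjoint, ContinuousLinearMap.adjoint_inner_left]

theorem exists_isotropic (hinteg : ∀ i j, Integrable (fun x : Euc n => x i * x j) ν)
    (hpos : ∀ v : Euc n, v ≠ 0 → 0 < ∫ x, (inner ℝ v x : ℝ) ^ 2 ∂ν) :
    ∃ B : Matrix (Fin n) (Fin n) ℝ, B * secondMoment ν * Bᵀ = 1 ∧
      ∀ v : Euc n, ∫ x, (inner ℝ v (toEuclideanCLM (𝕜 := ℝ) B x) : ℝ) ^ 2 ∂ν = ‖v‖ ^ 2 := by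
  have hM : (secondMoment ν).PosDef := by
    refine PosDef.of_dotProduct_mulVec_pos ?_ ?_
    · ext i j
      simp [secondMoment, mul_comm]
    · intro v hv
      have := hpos (WithLp.toLp 2 v) (by simpa using hv)
      rwa [integral_inner_sq_eq hinteg] at this
  obtain ⟨B, hB⟩ := hM.exists_mul_mul_transpose_eq_one
  refine ⟨B, hB, fun v => ?_⟩
  simp_rw [inner_toEuclideanCLM]
  rw [integral_inner_sq_eq hinteg, ofLp_toEuclideanCLM, mulVec_mulVec,
    dotProduct_comm, dotProduct_mulVec, ← mulVec_transpose, transpose_transpose, mulVec_mulVec,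
    ← mul_assoc, hB, one_mulVec, EuclideanSpace.norm_sq_eq]
  simp [dotProduct, sq]

lemma integral_norm_toEuclideanCLM_sq (hiso : ∀ v : Euc n, ∫ x, (inner ℝ v x : ℝ) ^ 2 ∂ν = ‖v‖ ^ 2)
    (hinteg : ∀ v : Euc n, Integrable (fun x : Euc n => (inner ℝ v x : ℝ) ^ 2) ν)
    (B : Matrix (Fin n) (Fin n) ℝ) :
    ∫ x, ‖toEuclideanCLM (𝕜 := ℝ) B x‖ ^ 2 ∂ν = ∑ i, ∑ j, B i j ^ 2 := by
  have : ∀ x, ‖toEuclideanCLM (𝕜 := ℝ) B x‖ ^ 2 =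
      ∑ i, (inner ℝ (WithLp.toLp 2 (B i)) x : ℝ) ^ 2 := by
    intro x
    rw [EuclideanSpace.norm_sq_eq]
    refine Finset.sum_congr rfl fun i _ => ?_
    rw [ofLp_toEuclideanCLM, Real.norm_eq_abs, sq_abs, mulVec, PiLp.inner_apply]
    simp [dotProduct, mul_comm]
  simp_rw [this]
  rw [integral_finsetSum _ fun i _ => hinteg _]
  refine Finset.sum_congr rfl fun i _ => ?_
  rw [hiso, EuclideanSpace.norm_sq_eq]
  simp

end

section

variable {n : ℕ}

/-- Bounded measurable convex sets of positive volume. -/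
structure IsThickConvex (K : Set (Euc n)) : Prop where
  meas : MeasurableSet K
  conv : Convex ℝ K
  bdd : Bornology.IsBounded K
  vol : volume K ≠ 0

/-- The exponential tilt in direction `y` of the uniform distribution on `K`. -/
noncomputable def tilt (K : Set (Euc n)) (y : Euc n) : Measure (Euc n) :=
  (volume.restrict K).tilted fun x => inner ℝ y x

/-- The distribution of the difference of two independent copies. -/
noncomputable def diffLaw (μ : Measure (Euc n)) : Measure (Euc n) :=
  (μ.prod μ).map fun z => z.1 - z.2

namespace IsThickConvex

variable {K : Set (Euc n)}

lemma integrableOn (hK : IsThickConvex K) {F : Type*} [NormedAddCommGroup F]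
    {f : Euc n → F} (hf : Continuous f) : IntegrableOn f K :=
  (hf.continuousOn.integrableOn_compact hK.bdd.isCompact_closure).mono_set subset_closure

lemma measure_ne_top (hK : IsThickConvex K) : volume K ≠ ∞ := hK.bdd.measure_lt_top.ne

lemma neZero (hK : IsThickConvex K) : NeZero (volume.restrict K) :=
  ⟨by rw [Ne, Measure.restrict_eq_zero]; exact hK.vol⟩

lemma isProbabilityMeasure_tilt (hK : IsThickConvex K) (y : Euc n) :
    IsProbabilityMeasure (tilt K y) := by
  have := hK.neZero
  exact isProbabilityMeasure_tilted (hK.integrableOn (by fun_prop))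

lemma tilt_absolutelyContinuous (y : Euc n) : tilt K y ≪ volume :=
  (tilted_absolutelyContinuous _ _).trans Measure.restrict_le_self.absolutelyContinuous

lemma ae_tilt_mem (hK : IsThickConvex K) (y : Euc n) : ∀ᵐ x ∂tilt K y, x ∈ K :=
  (tilted_absolutelyContinuous _ _).ae_le (ae_restrict_mem hK.meas)

lemma integral_exp_pos (hK : IsThickConvex K) (y : Euc n) :
    0 < ∫ x in K, Real.exp (inner ℝ y x) := by
  have := hK.neZero
  exact MeasureTheory.integral_exp_pos (hK.integrableOn (by fun_prop))

lemma integral_tilt_eq (y : Euc n) (g : Euc n → ℝ) :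
    ∫ x, g x ∂tilt K y =
      (∫ x in K, g x * Real.exp (inner ℝ y x)) / ∫ x in K, Real.exp (inner ℝ y x) := by
  rw [tilt, integral_tilted, ← integral_div]
  refine integral_congr_ae (ae_of_all _ fun x => ?_)
  simp only [smul_eq_mul]
  ring

lemma integrable_tilt (hK : IsThickConvex K) (y : Euc n) {F : Type*} [NormedAddCommGroup F]
    [SecondCountableTopology F] {f : Euc n → F} (hf : Continuous f) : Integrable f (tilt K y) := by
  have := hK.isProbabilityMeasure_tilt y
  obtain ⟨C, hC⟩ := hK.bdd.isCompact_closure.exists_bound_of_continuousOn hf.continuousOn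
  refine Integrable.of_bound hf.aestronglyMeasurable C ?_
  filter_upwards [hK.ae_tilt_mem y] with x hx using hC x (subset_closure hx)

lemma isMidLogConcave_tilt_prod (hK : IsThickConvex K) (y : Euc n) :
    IsMidLogConcave ((tilt K y).prod (tilt K y)) := by
  set ρ : Euc n → ℝ≥0∞ := K.indicator fun x =>
    ENNReal.ofReal (Real.exp (inner ℝ y x) / ∫ x in K, Real.exp (inner ℝ y x)) with hρ
  have hρm : Measurable ρ := by
    refine Measurable.indicator ?_ hK.meas
    fun_prop
  have e : tilt K y = volume.withDensity ρ := by
    rw [tilt, Measure.tilted, hρ, withDensity_indicator hK.meas]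
  have hρl : ∀ x x', ρ x * ρ x' ≤ ρ (midpoint ℝ x x') ^ 2 := by
    intro x x'
    by_cases hx : x ∈ K
    · by_cases hx' : x' ∈ K
      · have hm : midpoint ℝ x x' ∈ K := hK.conv.midpoint_mem hx hx'
        have hF := hK.integral_exp_pos y
        simp only [hρ, Set.indicator_of_mem hx, Set.indicator_of_mem hx', Set.indicator_of_mem hm]
        rw [← ENNReal.ofReal_mul (by positivity), ← ENNReal.ofReal_pow (by positivity)]
        refine ENNReal.ofReal_le_ofReal (le_of_eq ?_)
        rw [div_mul_div_comm, ← Real.exp_add, div_pow, ← Real.exp_nat_mul, ← sq,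
          midpoint_eq_smul_add, inner_smul_right, inner_add_right]
        congr 2
        push_cast
        simp
      · simp [hρ, Set.indicator_of_notMem hx']
    · simp [hρ, Set.indicator_of_notMem hx]
  rw [e, prod_withDensity hρm hρm]
  refine ((hasPrekopaLeindler_euclidean n).prod
    (hasPrekopaLeindler_euclidean n)).isMidLogConcave_withDensity (by fun_prop) fun z z' => ?_
  calc ρ z.1 * ρ z.2 * (ρ z'.1 * ρ z'.2) = (ρ z.1 * ρ z'.1) * (ρ z.2 * ρ z'.2) := by ring
    _ ≤ ρ (midpoint ℝ z.1 z'.1) ^ 2 * ρ (midpoint ℝ z.2 z'.2) ^ 2 :=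
      mul_le_mul' (hρl _ _) (hρl _ _)
    _ = _ := by
      rw [← mul_pow]
      simp [midpoint_eq_smul_add]

lemma isSymLogConcave_diffLaw_tilt (hK : IsThickConvex K) (y : Euc n) :
    IsSymLogConcave (diffLaw (tilt K y)) where
  prob := by
    have := hK.isProbabilityMeasure_tilt y
    exact Measure.isProbabilityMeasure_map (by fun_prop)
  symm := by
    have := hK.isProbabilityMeasure_tilt y
    rw [diffLaw, Measure.map_map (by fun_prop) (by fun_prop)]
    conv_rhs => rw [← Measure.prod_swap, Measure.map_map (by fun_prop) (by fun_prop)]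
    congr 1
    ext z
    simp
  lc := by
    have hm : Measurable (LinearMap.fst ℝ (Euc n) (Euc n) - LinearMap.snd ℝ (Euc n) (Euc n)) :=
      measurable_fst.sub measurable_snd
    exact (hK.isMidLogConcave_tilt_prod y).map _ hm
  bdd := by
    have := hK.isProbabilityMeasure_tilt y
    obtain ⟨R, hR⟩ := hK.bdd.exists_norm_le
    refine ⟨R + R, ?_⟩
    rw [diffLaw, ae_map_iff (by fun_prop) (by measurability)]
    have h1 := Measure.quasiMeasurePreserving_fst (μ := tilt K y) (ν := tilt K y) |>.ae
      (hK.ae_tilt_mem y)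
    have h2 := Measure.quasiMeasurePreserving_snd (μ := tilt K y) (ν := tilt K y) |>.ae
      (hK.ae_tilt_mem y)
    filter_upwards [h1, h2] with z hz1 hz2
    exact (norm_sub_le _ _).trans (add_le_add (hR _ hz1) (hR _ hz2))

lemma integrable_tilt_prod (hK : IsThickConvex K) (y : Euc n)
    {f : Euc n × Euc n → ℝ} (hf : Continuous f) :
    Integrable f ((tilt K y).prod (tilt K y)) := by
  have := hK.isProbabilityMeasure_tilt y
  obtain ⟨C, hC⟩ := (hK.bdd.isCompact_closure.prod
    hK.bdd.isCompact_closure).exists_bound_of_continuousOn hf.continuousOn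
  refine Integrable.of_bound hf.aestronglyMeasurable C ?_
  have h1 := Measure.quasiMeasurePreserving_fst (μ := tilt K y) (ν := tilt K y) |>.ae
    (hK.ae_tilt_mem y)
  have h2 := Measure.quasiMeasurePreserving_snd (μ := tilt K y) (ν := tilt K y) |>.ae
    (hK.ae_tilt_mem y)
  filter_upwards [h1, h2] with z hz1 hz2 using hC z ⟨subset_closure hz1, subset_closure hz2⟩

lemma integral_diffLaw (μ : Measure (Euc n)) {f : Euc n → ℝ} (hf : Continuous f) :
    ∫ x, f x ∂diffLaw μ = ∫ z, f (z.1 - z.2) ∂(μ.prod μ) := by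
  rw [diffLaw, integral_map (by fun_prop) hf.aestronglyMeasurable]

lemma secondMoment_diffLaw_tilt (hK : IsThickConvex K) (y : Euc n) (i j : Fin n) :
    secondMoment (diffLaw (tilt K y)) i j =
      2 * (∫ x, x i * x j ∂tilt K y - (∫ x, x i ∂tilt K y) * ∫ x, x j ∂tilt K y) := by
  have := hK.isProbabilityMeasure_tilt y
  set μ := tilt K y
  have e : ∀ z : Euc n × Euc n, (z.1 - z.2) i * (z.1 - z.2) j =
      z.1 i * z.1 j * 1 - z.1 i * z.2 j - z.1 j * z.2 i + 1 * (z.2 i * z.2 j) := by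
    intro z
    simp only [PiLp.sub_apply]
    ring
  rw [secondMoment, Matrix.of_apply, integral_diffLaw μ (by fun_prop)]
  simp_rw [e]
  rw [integral_add, integral_sub, integral_sub, integral_prod_mul (μ := μ) (ν := μ)
      (fun x => x i * x j) (fun _ => 1),
    integral_prod_mul (μ := μ) (ν := μ) (fun x => x i) (fun x => x j),
    integral_prod_mul (μ := μ) (ν := μ) (fun x => x j) (fun x => x i),
    integral_prod_mul (μ := μ) (ν := μ) (fun _ => 1) (fun x => x i * x j)]
  · simp
    ring
  all_goals exact hK.integrable_tilt_prod y (by fun_prop)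

lemma integral_inner_sq_diffLaw_pos (hK : IsThickConvex K) (y : Euc n) {v : Euc n} (hv : v ≠ 0) :
    0 < ∫ x, (inner ℝ v x : ℝ) ^ 2 ∂diffLaw (tilt K y) := by
  have := hK.isProbabilityMeasure_tilt y
  refine lt_of_le_of_ne (integral_nonneg fun x => by positivity) fun h => ?_
  rw [integral_diffLaw _ (by fun_prop), eq_comm, integral_eq_zero_iff_of_nonneg
    (fun x => by positivity) (hK.integrable_tilt_prod y (by fun_prop))] at h
  have h2 := Measure.ae_ae_of_ae_prod h
  obtain ⟨x, hx⟩ := h2.exists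
  have h3 : ∀ᵐ z ∂volume, ¬ (inner ℝ v z : ℝ) = inner ℝ v x := by
    have h4 := Measure.addHaar_affineSubspace (volume : Measure (Euc n))
      (AffineSubspace.mk' x (LinearMap.ker (innerSL ℝ v).toLinearMap)) (by
        intro h
        have : x + v ∈ AffineSubspace.mk' x (LinearMap.ker (innerSL ℝ v).toLinearMap) := by
          rw [h]; trivial
        rw [AffineSubspace.mem_mk'] at this
        simp at this
        exact hv this)
    rw [ae_iff]
    convert h4 using 2
    ext z
    simp [AffineSubspace.mem_mk', inner_sub_right, sub_eq_zero]
  have h5 := hx.and ((tilt_absolutelyContinuous (K := K) y).ae_le h3)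
  obtain ⟨z, hz1, hz2⟩ := h5.exists
  simp only [Pi.zero_apply, ne_eq, OfNat.ofNat_ne_zero, not_false_eq_true, pow_eq_zero_iff,
    inner_sub_right] at hz1
  exact hz2 (by linarith)

end IsThickConvex

end

section

variable {n : ℕ} {K : Set (Euc n)}

namespace IsThickConvex

lemma hasFDerivAt_integral_mul_exp (hK : IsThickConvex K) {g : Euc n → ℝ} (hg : Continuous g)
    (y : Euc n) :
    HasFDerivAt (fun y => ∫ x in K, g x * Real.exp (inner ℝ y x))
      (∫ x in K, (g x * Real.exp (inner ℝ y x)) • innerSL ℝ x) y := by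
  obtain ⟨R, hR⟩ := hK.bdd.exists_norm_le
  refine hasFDerivAt_integral_of_dominated_of_fderiv_le
    (F' := fun y x => (g x * Real.exp (inner ℝ y x)) • innerSL ℝ x)
    (bound := fun x => |g x| * Real.exp ((‖y‖ + 1) * ‖x‖) * ‖x‖)
    (Metric.ball_mem_nhds y one_pos) ?_ ?_ ?_ ?_ ?_ ?_
  · exact .of_forall fun z => (by fun_prop : Continuous _).aestronglyMeasurable
  · exact hK.integrableOn (by fun_prop)
  · exact (by fun_prop : Continuous _).aestronglyMeasurable
  · refine ae_of_all _ fun x z hz => ?_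
    rw [norm_smul, norm_mul, Real.norm_eq_abs, Real.norm_of_nonneg (Real.exp_nonneg _),
      innerSL_apply_norm]
    gcongr
    refine (real_inner_le_norm _ _).trans ?_
    gcongr
    have := norm_le_norm_add_norm_sub y z
    rw [mem_ball_iff_norm'] at hz
    linarith
  · exact hK.integrableOn (by fun_prop)
  · refine ae_of_all _ fun x z hz => ?_
    have h1 : HasFDerivAt (fun y : Euc n => (inner ℝ y x : ℝ)) (innerSL ℝ x) z := by
      have := (innerSL ℝ x).hasFDerivAt (x := z)
      refine this.congr_of_eventuallyEq (.of_forall fun y => ?_)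
      simp [real_inner_comm]
    have h2 := h1.exp.const_mul (g x)
    rwa [smul_smul] at h2

lemma hasFDerivAt_integral_mul_exp_apply (hK : IsThickConvex K) {g : Euc n → ℝ} (hg : Continuous g)
    (y v : Euc n) :
    (∫ x in K, (g x * Real.exp (inner ℝ y x)) • innerSL ℝ x) v =
      ∑ j, (∫ x in K, (g x * x j) * Real.exp (inner ℝ y x)) * v j := by
  rw [ContinuousLinearMap.integral_apply (φ := fun x => (g x * Real.exp (inner ℝ y x)) • innerSL ℝ x)
    (hK.integrableOn (by fun_prop))]
  simp_rw [← integral_mul_const]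
  rw [← integral_finsetSum _ fun j _ => hK.integrableOn (by fun_prop)]
  refine integral_congr_ae (ae_of_all _ fun x => ?_)
  simp only [smul_apply, innerSL_apply_apply, smul_eq_mul, PiLp.inner_apply,
    RCLike.inner_apply, conj_trivial, Finset.mul_sum]
  refine Finset.sum_congr rfl fun j _ => ?_
  ring

/-- The barycenter of the tilted measure. -/
noncomputable def _root_.baryTilt (K : Set (Euc n)) (y : Euc n) : Euc n := ∫ x, x ∂tilt K y

lemma baryTilt_apply (hK : IsThickConvex K) (y : Euc n) (i : Fin n) :
    baryTilt K y i = ∫ x, x i ∂tilt K y :=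
  ((EuclideanSpace.proj (𝕜 := ℝ) i).integral_comp_comm
    (hK.integrable_tilt y continuous_id)).symm

theorem hasFDerivAt_baryTilt (hK : IsThickConvex K) (y : Euc n) :
    HasFDerivAt (baryTilt K) (Matrix.toEuclideanCLM (𝕜 := ℝ)
      ((2 : ℝ)⁻¹ • secondMoment (diffLaw (tilt K y)))) y := by
  rw [← hasFDerivWithinAt_univ, hasFDerivWithinAt_euclidean]
  intro i
  rw [hasFDerivWithinAt_univ]
  have hF := hK.integral_exp_pos y
  have h1 := hK.hasFDerivAt_integral_mul_exp (g := fun x => x i) (by fun_prop) y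
  have h2 := hK.hasFDerivAt_integral_mul_exp (g := fun _ => 1) (by fun_prop) y
  have h3 := h1.mul ((hasDerivAt_inv (by simpa using hF.ne')).comp_hasFDerivAt y h2)
  simp only [one_mul] at h3
  have e : (fun x => baryTilt K x i) = fun y => (∫ x in K, x i * Real.exp (inner ℝ y x)) *
      (∫ x in K, Real.exp (inner ℝ y x))⁻¹ := by
    ext z
    rw [hK.baryTilt_apply, integral_tilt_eq, div_eq_mul_inv]
  rw [e]
  refine h3.congr_fderiv ?_
  ext v
  have h4 := hK.hasFDerivAt_integral_mul_exp_apply (g := fun x => x i) (by fun_prop) y v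
  have h5 := hK.hasFDerivAt_integral_mul_exp_apply (g := fun _ => 1) (by fun_prop) y v
  simp only [one_mul] at h5
  simp only [ContinuousLinearMap.comp_apply, add_apply,
    smul_apply, h4, h5, smul_eq_mul, Function.comp_apply]
  rw [PiLp.proj_apply, Matrix.ofLp_toEuclideanCLM, Matrix.smul_mulVec, Pi.smul_apply,
    Matrix.mulVec, dotProduct]
  simp only [secondMoment_diffLaw_tilt hK, integral_tilt_eq, smul_eq_mul, Finset.mul_sum,
    ← Finset.sum_add_distrib]
  refine Finset.sum_congr rfl fun j _ => ?_
  field_simp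
  ring

lemma baryTilt_mem_closure (hK : IsThickConvex K) (y : Euc n) : baryTilt K y ∈ closure K := by
  have := hK.isProbabilityMeasure_tilt y
  refine hK.conv.closure.integral_mem isClosed_closure ?_ (hK.integrable_tilt y continuous_id)
  filter_upwards [hK.ae_tilt_mem y] with x hx using subset_closure hx

lemma integrable_coord_mul_coord (hK : IsThickConvex K) (y : Euc n) (i j : Fin n) :
    Integrable (fun x : Euc n => x i * x j) (diffLaw (tilt K y)) :=
  (hK.isSymLogConcave_diffLaw_tilt y).integrable (by fun_prop)

lemma injective_baryTilt (hK : IsThickConvex K) : Function.Injective (baryTilt K) := by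
  intro y z hyz
  by_contra hne
  set w := z - y with hw
  have hw0 : w ≠ 0 := by
    rw [hw, sub_ne_zero]
    exact fun h => hne h.symm
  let f : ℝ → ℝ := fun t => inner ℝ w (baryTilt K (y + t • w))
  have hf : ∀ t, HasDerivAt f ((2 : ℝ)⁻¹ *
      ∫ x, (inner ℝ w x : ℝ) ^ 2 ∂diffLaw (tilt K (y + t • w))) t := by
    intro t
    have h1 : HasDerivAt (fun t : ℝ => y + t • w) w t := by
      simpa using ((hasDerivAt_id t).smul_const w).const_add y
    have h2 := (hK.hasFDerivAt_baryTilt (y + t • w)).comp_hasDerivAt t h1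
    have h3 := (innerSL ℝ w).hasFDerivAt.comp_hasDerivAt t h2
    refine h3.congr_deriv ?_
    rw [integral_inner_sq_eq (hK.integrable_coord_mul_coord _), innerSL_apply_apply,
      EuclideanSpace.inner_eq_star_dotProduct, Matrix.ofLp_toEuclideanCLM, Matrix.smul_mulVec,
      smul_dotProduct, star_trivial, dotProduct_comm, smul_eq_mul]
  have hmono : StrictMono f := strictMono_of_deriv_pos fun t => by
    rw [(hf t).deriv]
    have := hK.integral_inner_sq_diffLaw_pos (y + t • w) hw0
    positivity
  have := hmono (zero_lt_one)
  simp [f, hw, hyz] at this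

theorem lintegral_det_le (hK : IsThickConvex K) {Y : Set (Euc n)} (hY : MeasurableSet Y) :
    ∫⁻ y in Y, ENNReal.ofReal |((2 : ℝ)⁻¹ • secondMoment (diffLaw (tilt K y))).det| ≤
      volume K := by
  have h := lintegral_abs_det_fderiv_eq_addHaar_image volume hY
    (fun y _ => (hK.hasFDerivAt_baryTilt y).hasFDerivWithinAt) hK.injective_baryTilt.injOn
  have hdet : ∀ M : Matrix (Fin n) (Fin n) ℝ,
      (Matrix.toEuclideanCLM (𝕜 := ℝ) M).det = M.det := by
    intro M
    rw [ContinuousLinearMap.det, Matrix.coe_toEuclideanCLM_eq_toEuclideanLin,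
      Matrix.toEuclideanLin, Matrix.toLpLin_eq_toLin, LinearMap.det_toLin]
  simp_rw [hdet] at h
  rw [h]
  calc volume (baryTilt K '' Y) ≤ volume (closure K) :=
        measure_mono (Set.image_subset_iff.2 fun y _ => hK.baryTilt_mem_closure y)
    _ ≤ volume K + volume (frontier K) := by
      rw [closure_eq_self_union_frontier]
      exact measure_union_le _ _
    _ = volume K := by rw [hK.conv.addHaar_frontier volume, add_zero]

end IsThickConvex

end

section

lemma MeasureTheory.Measure.pi_mono_of_le {ι : Type*} [Fintype ι] {α : ι → Type*}
    [∀ i, MeasurableSpace (α i)] {μ ν : ∀ i, Measure (α i)} [∀ i, SigmaFinite (μ i)]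
    (h : ∀ i, μ i ≤ ν i) : Measure.pi μ ≤ Measure.pi ν := by
  have h1 : (Measure.pi μ).toOuterMeasure ≤ OuterMeasure.pi fun i => (ν i).toOuterMeasure := by
    rw [OuterMeasure.le_pi]
    intro s _
    change Measure.pi μ (Set.univ.pi s) ≤ _
    rw [Measure.pi_pi]
    exact Finset.prod_le_prod' fun i _ => h i (s i)
  refine Measure.le_iff.2 fun s hs => ?_
  conv_rhs => rw [Measure.pi, toMeasure_apply _ _ hs]
  exact h1 s

lemma gaussianReal_le_volume : gaussianReal 0 1 ≤ volume := by
  rw [gaussianReal_of_var_ne_zero _ one_ne_zero]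
  conv_rhs => rw [← withDensity_one (μ := (volume : Measure ℝ))]
  refine withDensity_mono (ae_of_all _ fun x => ?_)
  rw [gaussianPDF, Pi.one_apply, ENNReal.ofReal_le_one, gaussianPDFReal]
  have h1 : Real.exp (-(x - 0) ^ 2 / (2 * ((1 : NNReal) : ℝ))) ≤ 1 := by
    rw [Real.exp_le_one_iff]
    have : 0 ≤ (x - 0) ^ 2 := by positivity
    simp only [NNReal.coe_one]
    linarith
  have h2 : (√(2 * Real.pi * ((1 : NNReal) : ℝ)))⁻¹ ≤ 1 := by
    refine inv_le_one_of_one_le₀ (Real.one_le_sqrt.2 ?_)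
    simp only [NNReal.coe_one]
    linarith [Real.pi_gt_three]
  exact mul_le_one₀ h2 (Real.exp_nonneg _) h1

lemma stdGaussian_le_volume (n : ℕ) : stdGaussian (Euc n) ≤ volume := by
  rw [stdGaussian_eq_map_pi_orthonormalBasis (EuclideanSpace.basisFun (Fin n) ℝ)]
  have : (fun x : Fin n → ℝ => ∑ i, x i • (EuclideanSpace.basisFun (Fin n) ℝ) i) = WithLp.toLp 2 := by
    ext x i
    simp [Finset.sum_apply, Pi.single_apply]
  rw [this, ← (PiLp.volume_preserving_toLp (Fin n)).map_eq]
  exact Measure.map_mono (Measure.pi_mono_of_le fun _ => gaussianReal_le_volume) (by fun_prop)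

variable {n : ℕ} {ν : Measure (Euc n)}

lemma IsSymLogConcave.measurable_moment (hν : IsSymLogConcave ν) (p : ℕ) :
    Measurable fun y : Euc n => ∫ x, |inner ℝ y x| ^ p ∂ν := by
  have := hν.prob
  refine (StronglyMeasurable.integral_prod_right (f := fun y x : Euc n => |inner ℝ y x| ^ p)
    ?_).measurable
  exact (by fun_prop : Continuous fun z : Euc n × Euc n => |inner ℝ z.1 z.2| ^ p).stronglyMeasurable

open scoped Pointwise in
theorem IsSymLogConcave.le_volume_moment_le (hn : 0 < n) (hν : IsSymLogConcave ν)
    (hiso : ∀ v : Euc n, ∫ x, (inner ℝ v x : ℝ) ^ 2 ∂ν = ‖v‖ ^ 2) {q : ℕ} (hq : 1 ≤ q)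
    (hqn : (2 * q : ℝ) ≤ 5 * √n) {s : ℝ} (hs0 : 0 < s) (hs : s * (1200000 * √n) ≤ √(2 * q)) :
    ENNReal.ofReal (s ^ n) / 2 ≤
      volume {y : Euc n | ∫ x, |inner ℝ y x| ^ (2 * q) ∂ν ≤ (((2 * q : ℕ) : ℝ) / 6) ^ (2 * q)} := by
  have := hν.prob
  have hq1 : (1 : ℝ) ≤ q := by exact_mod_cast hq
  set H : ℝ := √(2 * q) * (100000 * √n) with hH
  have hn' : 0 < √(n : ℝ) := Real.sqrt_pos.2 (by exact_mod_cast hn)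
  have hH0 : 0 < H := by positivity
  set Φ : Euc n → ℝ := fun y => ∫ x, |inner ℝ y x| ^ (2 * q) ∂ν with hΦ
  have hΦm : Measurable Φ := hν.measurable_moment _
  have hlint : ∫⁻ y, ENNReal.ofReal (Φ y) ∂stdGaussian (Euc n) ≤ ENNReal.ofReal (H ^ (2 * q)) := by
    have e1 : ∀ y, ENNReal.ofReal (Φ y) = ∫⁻ x, ‖(inner ℝ y x : ℝ)‖ₑ ^ (2 * q) ∂ν := by
      intro y
      rw [lintegral_enorm_pow_eq (hν.integrable (by fun_prop))]
    have hm : Measurable fun z : Euc n × Euc n => ‖(inner ℝ z.1 z.2 : ℝ)‖ₑ ^ (2 * q) := by fun_prop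
    have e2 : ∀ x : Euc n, ∫⁻ z, ‖(inner ℝ z x : ℝ)‖ₑ ^ (2 * q) ∂stdGaussian (Euc n) =
        ENNReal.ofReal (‖x‖ ^ (2 * q)) * ENNReal.ofReal (gaussMoment (2 * q)) := by
      intro x
      simp_rw [real_inner_comm x]
      rw [lintegral_enorm_pow_eq (integrable_abs_inner_pow_stdGaussian x _),
        integral_abs_inner_pow_stdGaussian, ENNReal.ofReal_mul (by positivity)]
    simp_rw [e1]
    rw [lintegral_lintegral_swap hm.aemeasurable]
    simp_rw [e2]
    rw [lintegral_mul_const _ (by fun_prop), ← ofReal_integral_eq_lintegral_ofReal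
      (hν.integrable (by fun_prop)) (ae_of_all _ fun x => by positivity),
      ← ENNReal.ofReal_mul (integral_nonneg fun x => by positivity)]
    refine ENNReal.ofReal_le_ofReal ?_
    rw [hH, mul_pow, mul_comm]
    refine mul_le_mul ?_ (hν.integral_norm_pow_le hn hiso hq hqn)
      (integral_nonneg fun x => by positivity) (by positivity)
    rw [pow_mul, Real.sq_sqrt (by positivity)]
    exact gaussMoment_two_mul_le q
  set A : Set (Euc n) := {y | Φ y < 2 * H ^ (2 * q)} with hA
  have hAm : MeasurableSet A := measurableSet_lt hΦm measurable_const
  have hAγ : (1 : ℝ≥0∞) / 2 ≤ stdGaussian (Euc n) A := by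
    have h1 : stdGaussian (Euc n) Aᶜ ≤ 1 / 2 := by
      have h2 := mul_meas_ge_le_lintegral (μ := stdGaussian (Euc n)) hΦm.ennreal_ofReal
        (ENNReal.ofReal (2 * H ^ (2 * q)))
      have h3 : Aᶜ ⊆ {x | ENNReal.ofReal (2 * H ^ (2 * q)) ≤ ENNReal.ofReal (Φ x)} := by
        intro y hy
        simp only [hA, Set.mem_compl_iff, Set.mem_ofPred_eq, not_lt] at hy
        exact ENNReal.ofReal_le_ofReal hy
      have h4 := (mul_le_mul_right (measure_mono (μ := stdGaussian (Euc n)) h3) _).trans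
        (h2.trans hlint)
      rw [ENNReal.ofReal_mul (by norm_num), mul_comm, ← mul_assoc] at h4
      have h5 : ENNReal.ofReal (H ^ (2 * q)) ≠ 0 := by
        simpa using by positivity
      have h6 := (ENNReal.mul_le_mul_iff_left h5 ENNReal.ofReal_ne_top).1 (h4.trans_eq (one_mul _).symm)
      rw [ENNReal.le_div_iff_mul_le (by simp) (by simp)]
      simpa using h6
    have h2 := measure_add_measure_compl (μ := stdGaussian (Euc n)) hAm
    rw [measure_univ] at h2
    have h3 : (1 : ℝ≥0∞) / 2 + 1 / 2 ≤ stdGaussian (Euc n) A + 1 / 2 := by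
      rw [ENNReal.add_halves]
      exact h2.symm.le.trans (add_le_add_right h1 _)
    exact (ENNReal.add_le_add_iff_right (by simp)).1 h3
  have hsub : s • A ⊆ {y | Φ y ≤ (((2 * q : ℕ) : ℝ) / 6) ^ (2 * q)} := by
    rintro _ ⟨y, hy, rfl⟩
    have hsc : Φ (s • y) = s ^ (2 * q) * Φ y := by
      simp only [hΦ, inner_smul_left, conj_trivial, abs_mul, mul_pow, integral_const_mul,
        abs_of_pos hs0]
    simp only [Set.mem_ofPred_eq]
    rw [hsc]
    have h2 : (2 : ℝ) ≤ 2 ^ (2 * q) := by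
      calc (2 : ℝ) = 2 ^ 1 := by norm_num
        _ ≤ 2 ^ (2 * q) := pow_le_pow_right₀ (by norm_num) (by omega)
    calc s ^ (2 * q) * Φ y ≤ s ^ (2 * q) * (2 ^ (2 * q) * H ^ (2 * q)) := by
          gcongr
          exact (le_of_lt hy).trans (by gcongr)
      _ = (s * 2 * H) ^ (2 * q) := by rw [mul_pow (s * 2) H, mul_pow s 2, mul_assoc]
      _ ≤ _ := by
          refine pow_le_pow_left₀ (by positivity) ?_ _
          have hsq : √(2 * (q : ℝ)) * √(2 * q) = 2 * q := Real.mul_self_sqrt (by positivity)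
          have : s * (1200000 * √n) * √(2 * q) ≤ √(2 * q) * √(2 * q) := by gcongr
          rw [hsq] at this
          push_cast
          rw [hH]
          linarith
  refine le_trans ?_ (measure_mono hsub)
  rw [Measure.addHaar_smul, finrank_euclideanSpace, Fintype.card_fin, abs_of_pos (by positivity)]
  rw [div_eq_mul_inv, ← one_div]
  gcongr
  exact hAγ.trans (stdGaussian_le_volume n A)

end

section

variable {n : ℕ} {K : Set (Euc n)}

namespace IsThickConvex

lemma tilt_zero_eq : tilt K 0 = (volume K)⁻¹ • volume.restrict K := by
  have : (fun x : Euc n => (inner ℝ (0 : Euc n) x : ℝ)) = 0 := by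
    ext x
    simp
  rw [tilt, this, tilted_zero', Measure.restrict_apply_univ]

lemma tilt_eq_tilted (hK : IsThickConvex K) (y : Euc n) :
    tilt K y = (tilt K 0).tilted fun x => inner ℝ y x := by
  rw [tilt, tilt, tilted_tilted (hK.integrableOn (by fun_prop))]
  congr 1
  ext x
  simp

lemma integral_exp_tilt_zero_pos (hK : IsThickConvex K) (y : Euc n) :
    0 < ∫ x, Real.exp (inner ℝ y x) ∂tilt K 0 := by
  have := hK.isProbabilityMeasure_tilt 0
  exact MeasureTheory.integral_exp_pos (hK.integrable_tilt 0 (by fun_prop))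

lemma integral_tilt_prod (hK : IsThickConvex K) (y : Euc n) {h : Euc n × Euc n → ℝ}
    (hh : Continuous h) :
    ∫ z, h z * Real.exp (inner ℝ y (z.1 + z.2)) ∂((tilt K 0).prod (tilt K 0)) =
      (∫ x, Real.exp (inner ℝ y x) ∂tilt K 0) ^ 2 * ∫ z, h z ∂((tilt K y).prod (tilt K y)) := by
  have := hK.isProbabilityMeasure_tilt 0
  have := hK.isProbabilityMeasure_tilt y
  have hF := hK.integral_exp_tilt_zero_pos y
  rw [integral_prod _ (hK.integrable_tilt_prod y hh),
    integral_prod _ (hK.integrable_tilt_prod 0 (by fun_prop)), hK.tilt_eq_tilted y,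
    integral_tilted]
  simp_rw [integral_tilted, smul_eq_mul, ← integral_const_mul]
  refine integral_congr_ae (ae_of_all _ fun x => integral_congr_ae (ae_of_all _ fun x' => ?_))
  simp only
  rw [inner_add_right, Real.exp_add]
  field_simp

/-- Comparison of moments of the uniform distribution and of its tilts. -/
lemma sq_integral_diffLaw_le (hK : IsThickConvex K) (y : Euc n) {f : Euc n → ℝ}
    (hf : Continuous f) :
    (∫ x, f x ∂diffLaw (tilt K 0)) ^ 2 ≤
      (∫ x, Real.exp |inner ℝ y x| ∂diffLaw (tilt K 0)) ^ 2 *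
        ∫ x, f x ^ 2 ∂diffLaw (tilt K y) := by
  have := hK.isProbabilityMeasure_tilt 0
  set μ := tilt K 0 with hμ
  set F : Euc n → ℝ := fun y => ∫ x, Real.exp (inner ℝ y x) ∂μ with hF
  have hFpos : ∀ y, 0 < F y := hK.integral_exp_tilt_zero_pos
  set A := ∫ z, f (z.1 - z.2) ^ 2 * Real.exp (inner ℝ y (z.1 + z.2)) ∂(μ.prod μ) with hA
  set B := ∫ z : Euc n × Euc n, Real.exp (inner ℝ (-y) (z.1 + z.2)) ∂(μ.prod μ) with hB
  have hAeq : A = F y ^ 2 * ∫ x, f x ^ 2 ∂diffLaw (tilt K y) := by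
    rw [integral_diffLaw _ (by fun_prop), hA, hμ,
      hK.integral_tilt_prod y (h := fun z => f (z.1 - z.2) ^ 2) (by fun_prop)]
  have hBeq : B = F (-y) ^ 2 := by
    rw [hB, sq, hF]
    simp_rw [inner_add_right, Real.exp_add]
    exact integral_prod_mul (μ := μ) (ν := μ) (fun x => Real.exp (inner ℝ (-y) x))
      (fun x => Real.exp (inner ℝ (-y) x))
  have hFF : F y * F (-y) ≤ ∫ x, Real.exp |inner ℝ y x| ∂diffLaw μ := by
    have h1 : F y * F (-y) = ∫ z : Euc n × Euc n, Real.exp (inner ℝ y (z.1 - z.2)) ∂(μ.prod μ) := by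
      rw [hF]
      simp_rw [sub_eq_add_neg, inner_add_right, Real.exp_add, inner_neg_right, ← inner_neg_left]
      exact (integral_prod_mul (μ := μ) (ν := μ) (fun x => Real.exp (inner ℝ y x))
        (fun x => Real.exp (inner ℝ (-y) x))).symm
    rw [h1, integral_diffLaw _ (by fun_prop)]
    refine integral_mono (hK.integrable_tilt_prod 0 (by fun_prop))
      (hK.integrable_tilt_prod 0 (by fun_prop)) fun z => ?_
    exact Real.exp_le_exp.2 (le_abs_self _)
  have hCS : (∫ x, f x ∂diffLaw μ) ^ 2 ≤ A * B := by
    have hd := discrim_le_zero (a := A) (b := -2 * ∫ x, f x ∂diffLaw μ) (c := B) (by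
      intro t
      have e : A * (t * t) + -2 * (∫ x, f x ∂diffLaw μ) * t + B = ∫ z : Euc n × Euc n,
          (t * (f (z.1 - z.2) * Real.exp (inner ℝ y (z.1 + z.2) / 2)) -
            Real.exp (-(inner ℝ y (z.1 + z.2) / 2))) ^ 2 ∂(μ.prod μ) := by
        have e1 : ∀ z : Euc n × Euc n, (t * (f (z.1 - z.2) * Real.exp (inner ℝ y (z.1 + z.2) / 2)) -
            Real.exp (-(inner ℝ y (z.1 + z.2) / 2))) ^ 2 =
            f (z.1 - z.2) ^ 2 * Real.exp (inner ℝ y (z.1 + z.2)) * (t * t) +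
            f (z.1 - z.2) * (-2 * t) + Real.exp (inner ℝ (-y) (z.1 + z.2)) := by
          intro z
          rw [inner_neg_left]
          set w : ℝ := inner ℝ y (z.1 + z.2)
          have h1 : Real.exp w = Real.exp (w / 2) ^ 2 := by
            rw [← Real.exp_nat_mul]; congr 1; push_cast; ring
          have h2 : Real.exp (-w) = Real.exp (-(w / 2)) ^ 2 := by
            rw [← Real.exp_nat_mul]; congr 1; push_cast; ring
          have h3 : Real.exp (w / 2) * Real.exp (-(w / 2)) = 1 := by
            rw [← Real.exp_add]; simp
          rw [h1, h2]
          linear_combination (-2 * t * f (z.1 - z.2)) * h3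
        simp_rw [e1]
        rw [integral_add (hK.integrable_tilt_prod 0 (by fun_prop))
          (hK.integrable_tilt_prod 0 (by fun_prop)),
          integral_add (hK.integrable_tilt_prod 0 (by fun_prop))
          (hK.integrable_tilt_prod 0 (by fun_prop)), integral_mul_const, integral_mul_const,
          integral_diffLaw _ hf]
        ring
      rw [e]
      exact integral_nonneg fun z => by positivity)
    rw [discrim] at hd
    nlinarith
  refine hCS.trans ?_
  rw [hAeq, hBeq]
  have h0 : 0 ≤ ∫ x, f x ^ 2 ∂diffLaw (tilt K y) := integral_nonneg fun x => by positivity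
  calc F y ^ 2 * (∫ x, f x ^ 2 ∂diffLaw (tilt K y)) * F (-y) ^ 2
      = (F y * F (-y)) ^ 2 * ∫ x, f x ^ 2 ∂diffLaw (tilt K y) := by ring
    _ ≤ _ := by
      gcongr

theorem le_det_of_moment_le (hn : 0 < n) (hK : IsThickConvex K)
    (hiso : ∀ v : Euc n, ∫ x, (inner ℝ v x : ℝ) ^ 2 ∂diffLaw (tilt K 0) = ‖v‖ ^ 2) {r : ℕ}
    (hr : 1 ≤ r) (hrn : (4 * r : ℝ) ≤ 5 * √n) {y : Euc n}
    (hy : ∫ x, |inner ℝ y x| ^ (2 * (2 * r)) ∂diffLaw (tilt K 0) ≤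
      (((2 * (2 * r) : ℕ) : ℝ) / 6) ^ (2 * (2 * r))) :
    (((2 * 10 ^ 13 : ℝ)) ^ n)⁻¹ ≤ ((2 : ℝ)⁻¹ • secondMoment (diffLaw (tilt K y))).det := by
  have hν0 := hK.isSymLogConcave_diffLaw_tilt 0
  have hνy := hK.isSymLogConcave_diffLaw_tilt y
  have := hν0.prob
  obtain ⟨B, hB, hBiso⟩ := exists_isotropic (hK.integrable_coord_mul_coord y)
    fun v hv => hK.integral_inner_sq_diffLaw_pos y hv
  set L := Matrix.toEuclideanCLM (𝕜 := ℝ) B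
  have hn1 : (1 : ℝ) ≤ n := by exact_mod_cast hn
  have hP : ∫ x, ‖L x‖ ^ (2 * (2 * r)) ∂diffLaw (tilt K y) ≤ (100000 * √n) ^ (2 * (2 * r)) := by
    have := (hνy.map L).integral_norm_pow_le hn (fun v => by
      rw [integral_map (by fun_prop) (by fun_prop)]
      exact hBiso v) (q := 2 * r) (by omega) (by push_cast; linarith)
    rwa [integral_map (by fun_prop) (by fun_prop)] at this
  have hE := hν0.integral_exp_functional_le (innerSL ℝ y) (p := 2 * (2 * r)) (by omega)
    (by simpa only [innerSL_apply_apply] using hy)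
  simp only [innerSL_apply_apply] at hE
  have hCS := hK.sq_integral_diffLaw_le y (f := fun x => (‖L x‖ ^ 2) ^ r) (by fun_prop)
  set T := ∫ x, ‖L x‖ ^ 2 ∂diffLaw (tilt K 0) with hT
  have hT0 : 0 ≤ T := integral_nonneg fun x => by positivity
  have hJ : T ^ r ≤ ∫ x, (‖L x‖ ^ 2) ^ r ∂diffLaw (tilt K 0) :=
    (convexOn_pow r).map_integral_le (continuous_pow r).continuousOn isClosed_Ici
      (ae_of_all _ fun x => by simp) (hν0.integrable (by fun_prop)) (hν0.integrable (by fun_prop))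
  have hTle : T ≤ 10 ^ 13 * n := by
    have h1 : (T ^ r) ^ 2 ≤ (16 * Real.exp 4 * 10 ^ 10 * n) ^ (2 * r) := by
      calc (T ^ r) ^ 2 ≤ (∫ x, (‖L x‖ ^ 2) ^ r ∂diffLaw (tilt K 0)) ^ 2 := by gcongr
        _ ≤ _ := hCS
        _ ≤ (4 * Real.exp ((2 * (2 * r) : ℕ) : ℝ)) ^ 2 * (100000 * √n) ^ (2 * (2 * r)) := by
          refine mul_le_mul (pow_le_pow_left₀ (integral_nonneg fun x => by positivity) hE 2) ?_
            (integral_nonneg fun x => by positivity) (by positivity)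
          refine le_of_eq_of_le (integral_congr_ae (ae_of_all _ fun x => ?_)) hP
          simp only
          rw [← pow_mul, ← pow_mul]
          congr 1
          ring
        _ = 16 * Real.exp 4 ^ (2 * r) * (10 ^ 10 * n) ^ (2 * r) := by
          have e1 : (100000 * √(n : ℝ)) ^ (2 * (2 * r)) = (10 ^ 10 * n) ^ (2 * r) := by
            rw [pow_mul, mul_pow, Real.sq_sqrt (by positivity)]
            norm_num
          rw [e1, mul_pow, ← Real.exp_nat_mul, ← Real.exp_nat_mul]
          congr 2
          · norm_num
          · congr 1
            push_cast
            ring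
        _ ≤ 16 ^ (2 * r) * Real.exp 4 ^ (2 * r) * (10 ^ 10 * n) ^ (2 * r) := by
          gcongr
          exact le_self_pow₀ (by norm_num) (by omega)
        _ = _ := by rw [← mul_pow, ← mul_pow]; congr 1; ring
    rw [← pow_mul, mul_comm r 2] at h1
    have h2 := le_of_pow_le_pow_left₀ (by omega) (by positivity) h1
    have h3 : Real.exp 4 ≤ 55 := by
      have h4 : Real.exp 4 = Real.exp 1 ^ 4 := by rw [← Real.exp_nat_mul]; norm_num
      rw [h4]
      have := Real.exp_one_lt_d9
      calc Real.exp 1 ^ 4 ≤ 2.72 ^ 4 := by gcongr; linarith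
        _ ≤ 55 := by norm_num
    nlinarith
  have hdetB : B.det ^ 2 ≤ (10 ^ 13) ^ n := by
    refine (Matrix.det_sq_le hn B).trans ?_
    rw [← integral_norm_toEuclideanCLM_sq hiso (fun v => hν0.integrable (by fun_prop))]
    refine pow_le_pow_left₀ (by positivity) ?_ n
    rw [div_le_iff₀ (by positivity)]
    exact hTle
  have hdet := congrArg Matrix.det hB
  rw [Matrix.det_mul, Matrix.det_mul, Matrix.det_transpose, Matrix.det_one] at hdet
  rw [Matrix.det_smul, Fintype.card_fin]
  set D := (secondMoment (diffLaw (tilt K y))).det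
  have hD : B.det ^ 2 * D = 1 := by linarith
  have hB0 : 0 < B.det ^ 2 := by
    rcases (sq_nonneg B.det).eq_or_lt with h | h
    · rw [← h] at hD; simp at hD
    · exact h
  rw [mul_pow, mul_inv, inv_pow]
  gcongr
  rw [inv_le_iff_one_le_mul₀ (by positivity), ← hD]
  have : 0 < D := by
    by_contra hc
    push Not at hc
    nlinarith
  rw [mul_comm]
  gcongr

end IsThickConvex

end

section

variable {n : ℕ} {K : Set (Euc n)}

namespace IsThickConvex

theorem le_volume_of_isotropic (hn : 0 < n) (hK : IsThickConvex K)
    (hiso : ∀ v : Euc n, ∫ x, (inner ℝ v x : ℝ) ^ 2 ∂diffLaw (tilt K 0) = ‖v‖ ^ 2) :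
    ENNReal.ofReal (((4 * 10 ^ 19 * √√n) ^ n)⁻¹) ≤ volume K := by
  have hν0 := hK.isSymLogConcave_diffLaw_tilt 0
  set r := Nat.sqrt n with hr
  have hn1 : (1 : ℝ) ≤ n := by exact_mod_cast hn
  have hr1 : 1 ≤ r := Nat.sqrt_pos.2 hn
  have hr1' : (1 : ℝ) ≤ r := by exact_mod_cast hr1
  have hsn : 0 < √(n : ℝ) := by positivity
  have hrle : (r : ℝ) ≤ √n := by
    refine Real.le_sqrt_of_sq_le ?_
    have : r ^ 2 ≤ n := Nat.sqrt_le' n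
    exact_mod_cast this
  have hler : √(n : ℝ) ≤ 2 * r := by
    have : n < (r + 1) ^ 2 := Nat.lt_succ_sqrt' n
    have h2 : √(n : ℝ) ≤ r + 1 := by
      rw [Real.sqrt_le_left (by positivity)]
      exact_mod_cast this.le
    linarith
  set t := √√(n : ℝ) with ht
  have ht0 : 0 < t := by positivity
  have htt : t * t = √n := Real.mul_self_sqrt hsn.le
  set s : ℝ := (10 ^ 6 * t)⁻¹ with hs
  have hs0 : 0 < s := by positivity
  have hY := hν0.le_volume_moment_le hn hiso (q := 2 * r) (by omega)
    (by push_cast; linarith) hs0 (by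
      refine Real.le_sqrt_of_sq_le ?_
      have : s * (1200000 * √n) = 1.2 * t := by
        rw [hs, ← htt]
        field_simp
        norm_num
      rw [this]
      push_cast
      nlinarith)
  set Y := {y : Euc n | ∫ x, |inner ℝ y x| ^ (2 * (2 * r)) ∂diffLaw (tilt K 0) ≤
    (((2 * (2 * r) : ℕ) : ℝ) / 6) ^ (2 * (2 * r))} with hYd
  have hYm : MeasurableSet Y := measurableSet_le (hν0.measurable_moment _) measurable_const
  have h1 : ENNReal.ofReal ((((2 * 10 ^ 13 : ℝ)) ^ n)⁻¹) * volume Y ≤ volume K := by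
    rw [← setLIntegral_const]
    refine le_trans (setLIntegral_mono' hYm fun y hy => ?_) (hK.lintegral_det_le hYm)
    exact ENNReal.ofReal_le_ofReal
      ((hK.le_det_of_moment_le hn hiso hr1 (by linarith) hy).trans (le_abs_self _))
  refine le_trans ?_ ((mul_le_mul_right hY _).trans h1)
  rw [← ENNReal.ofReal_ofNat 2, ← ENNReal.ofReal_div_of_pos (by norm_num),
    ← ENNReal.ofReal_mul (by positivity)]
  refine ENNReal.ofReal_le_ofReal ?_
  have e : (((4 * 10 ^ 19 * t) ^ n)⁻¹ : ℝ) = ((2 * 10 ^ 13) ^ n)⁻¹ * (s ^ n / 2 ^ n) := by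
    rw [← div_pow, ← inv_pow, ← inv_pow, ← mul_pow, hs]
    congr 1
    field_simp
    norm_num
  rw [e]
  gcongr
  exact le_self_pow₀ (by norm_num) (by omega)

lemma _root_.Matrix.det_toEuclideanCLM (B : Matrix (Fin n) (Fin n) ℝ) :
    LinearMap.det (Matrix.toEuclideanCLM (𝕜 := ℝ) B : Euc n →ₗ[ℝ] Euc n) = B.det := by
  rw [Matrix.coe_toEuclideanCLM_eq_toEuclideanLin, Matrix.toEuclideanLin,
    Matrix.toLpLin_eq_toLin, LinearMap.det_toLin]

lemma _root_.Matrix.toEuclideanCLM_injective_of_det_ne_zero {B : Matrix (Fin n) (Fin n) ℝ}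
    (hB : B.det ≠ 0) : Function.Injective (Matrix.toEuclideanCLM (𝕜 := ℝ) B) := by
  refine Function.LeftInverse.injective (g := Matrix.toEuclideanCLM (𝕜 := ℝ) B⁻¹) fun x => ?_
  have h : Matrix.toEuclideanCLM (𝕜 := ℝ) B⁻¹ * Matrix.toEuclideanCLM (𝕜 := ℝ) B = 1 := by
    rw [← map_mul, Matrix.nonsing_inv_mul _ (isUnit_iff_ne_zero.2 hB), map_one]
  exact DFunLike.congr_fun h x

lemma image (hK : IsThickConvex K) {B : Matrix (Fin n) (Fin n) ℝ} (hB : B.det ≠ 0) :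
    IsThickConvex (Matrix.toEuclideanCLM (𝕜 := ℝ) B '' K) := by
  refine ⟨?_, ?_, ?_, ?_⟩
  · exact hK.meas.image_of_continuousOn_injOn (by fun_prop)
      (Matrix.toEuclideanCLM_injective_of_det_ne_zero hB).injOn
  · exact hK.conv.linear_image (Matrix.toEuclideanCLM (𝕜 := ℝ) B).toLinearMap
  · exact (Matrix.toEuclideanCLM (𝕜 := ℝ) B).lipschitz.isBounded_image hK.bdd
  · rw [Measure.addHaar_image_continuousLinearMap, Matrix.det_toEuclideanCLM]
    simp [hB, hK.vol]

lemma tilt_zero_image (hK : IsThickConvex K) {B : Matrix (Fin n) (Fin n) ℝ} (hB : B.det ≠ 0) :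
    tilt (Matrix.toEuclideanCLM (𝕜 := ℝ) B '' K) 0 =
      (tilt K 0).map (Matrix.toEuclideanCLM (𝕜 := ℝ) B) := by
  set L := Matrix.toEuclideanCLM (𝕜 := ℝ) B with hL
  have hinj : Function.Injective L := Matrix.toEuclideanCLM_injective_of_det_ne_zero hB
  have hm : Measure.map L (volume : Measure (Euc n)) = ENNReal.ofReal |B.det⁻¹| • volume := by
    have := Measure.map_linearMap_addHaar_eq_smul_addHaar (volume : Measure (Euc n))
      (f := (L : Euc n →ₗ[ℝ] Euc n)) (by rwa [hL, Matrix.det_toEuclideanCLM])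
    rw [hL, Matrix.det_toEuclideanCLM] at this
    exact this
  have hr := Measure.restrict_map (μ := (volume : Measure (Euc n))) (f := L)
    (by fun_prop) (hK.image hB).meas
  rw [Set.preimage_image_eq _ hinj, hm] at hr
  rw [tilt_zero_eq, tilt_zero_eq, Measure.map_smul, ← hr, Measure.restrict_smul, smul_smul,
    Measure.addHaar_image_continuousLinearMap, Matrix.det_toEuclideanCLM]
  congr 1
  have h1 : ENNReal.ofReal |B.det| ≠ 0 := by simp [hB]
  rw [ENNReal.mul_inv (Or.inl h1) (Or.inl ENNReal.ofReal_ne_top), mul_comm, abs_inv,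
    ENNReal.ofReal_inv_of_pos (abs_pos.2 hB)]

lemma diffLaw_map (μ : Measure (Euc n)) [SFinite μ] (L : Euc n →L[ℝ] Euc n) :
    diffLaw (μ.map L) = (diffLaw μ).map L := by
  rw [diffLaw, diffLaw, Measure.map_prod_map _ _ (by fun_prop) (by fun_prop),
    Measure.map_map (by fun_prop) (by fun_prop), Measure.map_map (by fun_prop) (by fun_prop)]
  congr 1
  ext z
  simp

/-- After an affine change of variables, a convex set with controlled second moment has volume
bounded below by `(C n ^ (1/4)) ^ (-n)`. -/
theorem exists_position (hn : 0 < n) (hK : IsThickConvex K) :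
    ∃ (B : Matrix (Fin n) (Fin n) ℝ) (c : Euc n), B.det ≠ 0 ∧
      ∫ x in K, ‖Matrix.toEuclideanCLM (𝕜 := ℝ) B (x - c)‖ ^ 2 ≤ n * volume.real K ∧
      ((4 * 10 ^ 19 * √√n) ^ n)⁻¹ ≤ |B.det| * volume.real K := by
  have hν0 := hK.isSymLogConcave_diffLaw_tilt 0
  have := hK.isProbabilityMeasure_tilt 0
  obtain ⟨B, hB, hBiso⟩ := exists_isotropic (hK.integrable_coord_mul_coord 0)
    fun v hv => hK.integral_inner_sq_diffLaw_pos 0 hv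
  have hdet : B.det ≠ 0 := by
    intro h
    have := congrArg Matrix.det hB
    simp [h] at this
  set L := Matrix.toEuclideanCLM (𝕜 := ℝ) B with hL
  have hK' := hK.image hdet
  have hlaw : diffLaw (tilt (L '' K) 0) = (diffLaw (tilt K 0)).map L := by
    rw [hK.tilt_zero_image hdet, diffLaw_map]
  have hiso : ∀ v : Euc n, ∫ x, (inner ℝ v x : ℝ) ^ 2 ∂diffLaw (tilt (L '' K) 0) = ‖v‖ ^ 2 := by
    intro v
    rw [hlaw, integral_map (by fun_prop) (by fun_prop)]
    exact hBiso v
  have hvol := hK'.le_volume_of_isotropic hn hiso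
  rw [Measure.addHaar_image_continuousLinearMap, Matrix.det_toEuclideanCLM] at hvol
  have hsq : ∫ z : Euc n × Euc n, ‖L (z.1 - z.2)‖ ^ 2 ∂((tilt K 0).prod (tilt K 0)) = n := by
    have h1 := integral_norm_toEuclideanCLM_sq hiso (fun v =>
      (hK'.isSymLogConcave_diffLaw_tilt 0).integrable (by fun_prop)) 1
    rw [map_one, hlaw, integral_map (by fun_prop) (by fun_prop)] at h1
    simp only [one_apply_eq_self] at h1
    rw [integral_diffLaw _ (by fun_prop)] at h1
    rw [h1]
    simp [Matrix.one_apply]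
  have hinteg : Integrable (fun z : Euc n × Euc n => ‖L (z.1 - z.2)‖ ^ 2)
      ((tilt K 0).prod (tilt K 0)) := hK.integrable_tilt_prod 0 (by fun_prop)
  rw [integral_prod_symm _ hinteg] at hsq
  obtain ⟨c, hc⟩ := exists_le_integral hinteg.integral_prod_right
  rw [hsq, tilt_zero_eq, integral_smul_measure] at hc
  refine ⟨B, c, hdet, ?_, ?_⟩
  · have hv : 0 < volume.real K := ENNReal.toReal_pos hK.vol hK.measure_ne_top
    rw [ENNReal.toReal_inv, smul_eq_mul, ← Measure.real, inv_mul_le_iff₀ hv] at hc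
    rw [mul_comm]
    exact hc
  · have := ENNReal.toReal_mono (ENNReal.mul_ne_top ENNReal.ofReal_ne_top hK.measure_ne_top) hvol
    rwa [ENNReal.toReal_mul, ENNReal.toReal_ofReal (by positivity),
      ENNReal.toReal_ofReal (by positivity)] at this

end IsThickConvex

end

section

open scoped Matrix

variable {d : ℕ}

lemma ae_linearIndependent {V : Type*} [NormedAddCommGroup V] [NormedSpace ℝ V]
    [FiniteDimensional ℝ V] [MeasureSpace V] [BorelSpace V]
    [(volume : Measure V).IsAddHaarMeasure] (k : ℕ) (hk : k ≤ Module.finrank ℝ V) :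
    ∀ᵐ x : Fin k → V, LinearIndependent ℝ x := by
  induction k with
  | zero => exact ae_of_all _ fun x => linearIndependent_empty_type
  | succ k ih =>
    have ih := ih (by omega)
    have hopen : ∀ k, MeasurableSet {x : Fin k → V | LinearIndependent ℝ x} := fun k =>
      isOpen_setOfPred_linearIndependent.measurableSet
    have hmp := (volume_preserving_piFinSuccAbove (fun _ : Fin (k + 1) => V) 0).symm
    rw [← hmp.map_eq, ae_map_iff (by fun_prop) (hopen _)]
    have hS : MeasurableSet {z : V × (Fin k → V) | LinearIndependent ℝ
        ((MeasurableEquiv.piFinSuccAbove (fun _ : Fin (k + 1) => V) 0).symm z)} :=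
      (MeasurableEquiv.measurable _) (hopen _)
    rw [Measure.volume_eq_prod, ← Measure.prod_swap,
      ae_map_iff measurable_swap.aemeasurable hS]
    refine (Measure.ae_prod_mem_iff_ae_ae_mem (measurable_swap hS)).2 ?_
    filter_upwards [ih] with x hx
    have hs : Submodule.span ℝ (Set.range x) ≠ ⊤ := by
      intro h
      have h1 := finrank_range_le_card (R := ℝ) x
      rw [Set.finrank, h, finrank_top, Fintype.card_fin] at h1
      omega
    have h0 := Measure.addHaar_submodule volume _ hs
    filter_upwards [measure_eq_zero_iff_ae_notMem.1 h0] with y hy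
    have := linearIndependent_finCons.2 ⟨hx, hy⟩
    simpa [MeasurableEquiv.piFinSuccAbove, Fin.consEquiv] using this

/-- The matrix whose rows are the edge vectors at the first point. -/
def edgeMat (x : Fin (d + 1) → Euc d) : Matrix (Fin d) (Fin d) ℝ :=
  Matrix.of fun i j => x i.succ j - x 0 j

lemma continuous_edgeMat : Continuous (edgeMat : (Fin (d + 1) → Euc d) → _) := by
  refine continuous_matrix fun i j => ?_
  simp only [edgeMat, Matrix.of_apply]
  fun_prop

lemma ae_det_edgeMat_ne_zero : ∀ᵐ x : Fin (d + 1) → Euc d, (edgeMat x).det ≠ 0 := by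
  have hmp := (volume_preserving_piFinSuccAbove (fun _ : Fin (d + 1) => Euc d) 0).symm
  have hm : MeasurableSet {x : Fin (d + 1) → Euc d | (edgeMat x).det ≠ 0} :=
    (isOpen_ne_fun continuous_edgeMat.matrix_det continuous_const).measurableSet
  rw [← hmp.map_eq, ae_map_iff (by fun_prop) hm]
  refine (Measure.ae_prod_mem_iff_ae_ae_mem ((MeasurableEquiv.measurable _) hm)).2
    (ae_of_all _ fun x => ?_)
  have h := (measurePreserving_sub_right (volume : Measure (Fin d → Euc d))
    (fun _ => x)).quasiMeasurePreserving.ae (ae_linearIndependent d (by simp))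
  filter_upwards [h] with X hX
  have h1 : LinearIndependent ℝ
      ((WithLp.linearEquiv 2 ℝ (Fin d → ℝ)).toLinearMap ∘ fun i => X i - x) :=
    LinearIndependent.map' (v := fun i => X i - x) hX _ (LinearEquiv.ker _)
  have h2 := (Matrix.linearIndependent_rows_iff_isUnit (A := edgeMat
    ((MeasurableEquiv.piFinSuccAbove (fun _ : Fin (d + 1) => Euc d) 0).symm (x, X)))).1 (by
      have e : (edgeMat ((MeasurableEquiv.piFinSuccAbove (fun _ : Fin (d + 1) => Euc d) 0).symm
          (x, X))).row = (WithLp.linearEquiv 2 ℝ (Fin d → ℝ)).toLinearMap ∘ fun i => X i - x := by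
        ext i j
        simp [edgeMat, MeasurableEquiv.piFinSuccAbove, Fin.consEquiv, Matrix.row]
      rw [e]
      exact h1)
  exact ((Matrix.isUnit_iff_isUnit_det _).1 h2).ne_zero

/-- The vertices of the standard simplex. -/
noncomputable def refVertex (d : ℕ) : Fin (d + 1) → Euc d :=
  Fin.cons 0 fun i => EuclideanSpace.single i 1

/-- The standard simplex. -/
def refSimplex (d : ℕ) : Set (Euc d) := convexHull ℝ (Set.range (refVertex d))

/-- The open simplex spanned by affinely independent points. -/
def simplexInt (x : Fin (d + 1) → Euc d) : Set (Euc d) :=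
  {y | Matrix.toEuclideanCLM (𝕜 := ℝ) (edgeMat x)ᵀ⁻¹ (y - x 0) ∈ interior (refSimplex d)}

/-- The affine map taking the standard simplex to the simplex with vertices `x`. -/
noncomputable def simplexMap (x : Fin (d + 1) → Euc d) : Euc d →ᵃ[ℝ] Euc d :=
  (Matrix.toEuclideanCLM (𝕜 := ℝ) (edgeMat x)ᵀ : Euc d →ₗ[ℝ] Euc d).toAffineMap +
    AffineMap.const ℝ _ (x 0)

lemma simplexMap_apply (x : Fin (d + 1) → Euc d) (t : Euc d) :
    simplexMap x t = Matrix.toEuclideanCLM (𝕜 := ℝ) (edgeMat x)ᵀ t + x 0 := rfl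

lemma simplexMap_refVertex (x : Fin (d + 1) → Euc d) (i : Fin (d + 1)) :
    simplexMap x (refVertex d i) = x i := by
  rw [simplexMap_apply]
  refine Fin.cases ?_ (fun i => ?_) i
  · simp [refVertex]
  · ext j
    simp [refVertex, edgeMat, Matrix.ofLp_toEuclideanCLM]

/-- The affine isomorphism taking the standard simplex to a nondegenerate simplex. -/
noncomputable def simplexHomeo (x : Fin (d + 1) → Euc d) (hx : (edgeMat x).det ≠ 0) :
    Euc d ≃ₜ Euc d where
  toFun := simplexMap x
  invFun y := Matrix.toEuclideanCLM (𝕜 := ℝ) (edgeMat x)ᵀ⁻¹ (y - x 0)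
  left_inv t := by
    have h : Matrix.toEuclideanCLM (𝕜 := ℝ) (edgeMat x)ᵀ⁻¹ *
        Matrix.toEuclideanCLM (𝕜 := ℝ) (edgeMat x)ᵀ = 1 := by
      rw [← map_mul, Matrix.nonsing_inv_mul _ (by simpa using hx), map_one]
    simp only [simplexMap_apply, add_sub_cancel_right]
    exact DFunLike.congr_fun h t
  right_inv y := by
    have h : Matrix.toEuclideanCLM (𝕜 := ℝ) (edgeMat x)ᵀ *
        Matrix.toEuclideanCLM (𝕜 := ℝ) (edgeMat x)ᵀ⁻¹ = 1 := by
      rw [← map_mul, Matrix.mul_nonsing_inv _ (by simpa using hx), map_one]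
    rw [simplexMap_apply]
    have := DFunLike.congr_fun h (y - x 0)
    simp only [mul_apply_eq_comp, one_apply_eq_self] at this
    rw [this, sub_add_cancel]
  continuous_toFun := by
    change Continuous fun t => Matrix.toEuclideanCLM (𝕜 := ℝ) (edgeMat x)ᵀ t + x 0
    fun_prop
  continuous_invFun := by fun_prop

lemma simplexInt_eq_image {x : Fin (d + 1) → Euc d} (hx : (edgeMat x).det ≠ 0) :
    simplexInt x = simplexMap x '' interior (refSimplex d) :=
  ((simplexHomeo x hx).image_eq_preimage_symm _).symm

lemma simplexInt_eq {x : Fin (d + 1) → Euc d} (hx : (edgeMat x).det ≠ 0) :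
    simplexInt x = interior (convexHull ℝ (Set.range x)) := by
  have h : simplexMap x '' refSimplex d = convexHull ℝ (Set.range x) := by
    rw [refSimplex, AffineMap.image_convexHull, ← Set.range_comp]
    congr 2
    ext1 i
    exact simplexMap_refVertex x i
  rw [simplexInt_eq_image hx, ← h]
  exact (simplexHomeo x hx).image_interior _

lemma volume_simplexInt {x : Fin (d + 1) → Euc d} (hx : (edgeMat x).det ≠ 0) :
    volume (simplexInt x) =
      ENNReal.ofReal |(edgeMat x).det| * volume (interior (refSimplex d)) := by
  have : simplexMap x = (fun y => y + x 0) ∘ (Matrix.toEuclideanCLM (𝕜 := ℝ) (edgeMat x)ᵀ) := by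
    ext1 t
    exact simplexMap_apply x t
  rw [simplexInt_eq_image hx, this, Set.image_comp, Set.image_add_right, measure_preimage_add_right,
    Measure.addHaar_image_continuousLinearMap, Matrix.det_toEuclideanCLM, Matrix.det_transpose]

lemma measurableSet_mem_simplexInt :
    MeasurableSet {p : (Fin (d + 1) → Euc d) × Euc d | p.2 ∈ simplexInt p.1} := by
  refine MeasurableSet.preimage (t := interior (refSimplex d)) isOpen_interior.measurableSet
    (f := fun p : (Fin (d + 1) → Euc d) × Euc d =>
      Matrix.toEuclideanCLM (𝕜 := ℝ) (edgeMat p.1)ᵀ⁻¹ (p.2 - p.1 0)) ?_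
  have hdet : Measurable fun p : (Fin (d + 1) → Euc d) × Euc d => (edgeMat p.1)ᵀ.det :=
    ((continuous_edgeMat.comp continuous_fst).matrix_transpose.matrix_det).measurable
  have hadj : ∀ i j, Measurable fun p : (Fin (d + 1) → Euc d) × Euc d =>
      (edgeMat p.1)ᵀ.adjugate i j := fun i j =>
    ((continuous_edgeMat.comp continuous_fst).matrix_transpose.matrix_adjugate.matrix_elem
      i j).measurable
  have hinv : ∀ i j, Measurable fun p : (Fin (d + 1) → Euc d) × Euc d =>
      (edgeMat p.1)ᵀ⁻¹ i j := fun i j => by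
    simp only [Matrix.inv_def, Ring.inverse_eq_inv', Matrix.smul_apply, smul_eq_mul]
    exact hdet.inv.mul (hadj i j)
  have e : (fun p : (Fin (d + 1) → Euc d) × Euc d =>
      Matrix.toEuclideanCLM (𝕜 := ℝ) (edgeMat p.1)ᵀ⁻¹ (p.2 - p.1 0)) =
      fun p => WithLp.toLp 2 fun i => ∑ j, (edgeMat p.1)ᵀ⁻¹ i j * (p.2 j - p.1 0 j) := by
    ext p i
    rw [Matrix.ofLp_toEuclideanCLM]
    simp [Matrix.mulVec, dotProduct]
  rw [e]
  refine (PiLp.volume_preserving_toLp (Fin d)).measurable.comp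
    (measurable_pi_iff.2 fun i => Finset.measurable_fun_sum _ fun j _ => (hinv i j).mul ?_)
  fun_prop

lemma affineIndependent_refVertex (d : ℕ) : AffineIndependent ℝ (refVertex d) := by
  rw [affineIndependent_iff_linearIndependent_vsub ℝ _ 0]
  have h := (EuclideanSpace.basisFun (Fin d) ℝ).toBasis.linearIndependent
  have h2 := h.comp (fun i : {i : Fin (d + 1) // i ≠ 0} => i.1.pred i.2) fun i j hij =>
    Subtype.ext (Fin.pred_inj.1 hij)
  have e : (fun i : {i : Fin (d + 1) // i ≠ 0} => refVertex d i -ᵥ refVertex d 0) =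
      (EuclideanSpace.basisFun (Fin d) ℝ).toBasis ∘ fun i => i.1.pred i.2 := by
    ext1 ⟨i, hi⟩
    obtain ⟨j, rfl⟩ := Fin.exists_succ_eq.2 hi
    simp [refVertex]
  rw [e]
  exact h2

lemma affineIndependent_of_det_edgeMat_ne_zero {x : Fin (d + 1) → Euc d}
    (hx : (edgeMat x).det ≠ 0) : AffineIndependent ℝ x := by
  have h := (affineIndependent_refVertex d).map' (simplexMap x) (simplexHomeo x hx).injective
  refine (congrArg (AffineIndependent ℝ) ?_).mp h
  ext1 i
  exact simplexMap_refVertex x i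

lemma notMem_simplexInt [NeZero d] {x : Fin (d + 1) → Euc d} (hx : (edgeMat x).det ≠ 0)
    (i : Fin (d + 1)) : x i ∉ simplexInt x := by
  have hai := affineIndependent_of_det_edgeMat_ne_zero hx
  let b : AffineBasis (Fin (d + 1)) ℝ (Euc d) := ⟨x, hai, hai.affineSpan_eq_top_iff_card_eq_finrank_add_one.2 (by simp)⟩
  rw [simplexInt_eq hx]
  have h := b.interior_convexHull
  intro hi
  have hi' : b i ∈ interior (convexHull ℝ (Set.range b)) := hi
  rw [h] at hi'
  obtain ⟨j, hj⟩ := exists_ne i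
  have := hi' j
  rw [b.coord_apply_ne hj] at this
  exact lt_irrefl _ this

lemma volume_interior_refSimplex_pos (d : ℕ) : 0 < volume (interior (refSimplex d)) := by
  refine isOpen_interior.measure_pos _ ?_
  rw [refSimplex, interior_convexHull_nonempty_iff_affineSpan_eq_top]
  exact (affineIndependent_refVertex d).affineSpan_eq_top_iff_card_eq_finrank_add_one.2 (by simp)

lemma volume_interior_refSimplex_le (d : ℕ) [NeZero d] :
    volume (interior (refSimplex d)) ≤ ENNReal.ofReal (2 ^ d / d.factorial) := by
  have hsub : refSimplex d ⊆ WithLp.ofLp ⁻¹' {x : Fin d → ℝ | (∑ i, |x i| ^ (1 : ℝ)) ^ (1 / (1 : ℝ)) ≤ 1} := by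
    simp only [Real.rpow_one, ne_eq, one_ne_zero, not_false_eq_true, div_self]
    refine convexHull_min ?_ ?_
    · rintro _ ⟨i, rfl⟩
      refine Fin.cases ?_ (fun i => ?_) i
      · simp [refVertex]
      · simp [refVertex, apply_ite abs]
    · intro x hx y hy a b ha hb hab
      simp only [Set.mem_preimage, Set.mem_ofPred_eq, PiLp.add_apply, PiLp.smul_apply, smul_eq_mul] at *
      calc ∑ i, |a * x i + b * y i| ≤ ∑ i, (a * |x i| + b * |y i|) := by
            refine Finset.sum_le_sum fun i _ => (abs_add_le _ _).trans ?_
            rw [abs_mul, abs_mul, abs_of_nonneg ha, abs_of_nonneg hb]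
        _ = a * ∑ i, |x i| + b * ∑ i, |y i| := by
            rw [Finset.sum_add_distrib, Finset.mul_sum, Finset.mul_sum]
        _ ≤ 1 := by nlinarith
  refine (measure_mono (interior_subset.trans hsub)).trans ?_
  have hmeas : MeasurableSet {x : Fin d → ℝ | (∑ i, |x i| ^ (1 : ℝ)) ^ (1 / (1 : ℝ)) ≤ 1} := by
    simp only [Real.rpow_one, ne_eq, one_ne_zero, not_false_eq_true, div_self]
    exact measurableSet_le (by fun_prop) (by fun_prop)
  rw [(PiLp.volume_preserving_ofLp (Fin d)).measure_preimage hmeas.nullMeasurableSet,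
    volume_sum_rpow_le _ le_rfl]
  simp [one_add_one_eq_two, Real.Gamma_nat_eq_factorial]

end

section

variable {d : ℕ}

lemma measurePreserving_split {E : Type*} [MeasurableSpace E] (μ : Measure E) [SigmaFinite μ]
    {k N n : ℕ} (σ : Fin k ⊕ Fin N ≃ Fin n) :
    MeasurePreserving (fun x : Fin n → E => ((fun i => x (σ (.inl i))), fun j => x (σ (.inr j))))
      (Measure.pi fun _ => μ) ((Measure.pi fun _ => μ).prod (Measure.pi fun _ => μ)) := by
  have h1 := (measurePreserving_piCongrLeft (fun _ : Fin n => μ) σ).symm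
  have h2 := measurePreserving_sumPiEquivProdPi (fun _ : Fin k ⊕ Fin N => μ)
  exact h2.comp h1

/-- All simplices spanned by the points are nondegenerate. -/
def IsGeneric {n : ℕ} (x : Fin n → Euc d) : Prop :=
  ∀ (I : Finset (Fin n)) (h : I.card = d + 1), (edgeMat (x ∘ I.orderEmbOfFin h)).det ≠ 0

/-- The points with labels in `I` span a simplex containing no other point. -/
def IsEmptySimplex {n : ℕ} (x : Fin n → Euc d) (I : Finset (Fin n)) : Prop :=
  ∀ j ∉ I, x j ∉ interior (convexHull ℝ (x '' I))

lemma range_comp_orderEmbOfFin {n k : ℕ} {E : Type*} (x : Fin n → E) {I : Finset (Fin n)}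
    (h : I.card = k) : Set.range (x ∘ I.orderEmbOfFin h) = x '' I := by
  rw [Set.range_comp, Finset.range_orderEmbOfFin]

lemma IsGeneric.injective [NeZero d] {n : ℕ} {x : Fin n → Euc d} (hx : IsGeneric x)
    (hn : d + 1 ≤ n) : Function.Injective x := by
  intro i j hij
  by_contra hne
  have hd := NeZero.pos d
  obtain ⟨I, hI, -, hcard⟩ := Finset.exists_subsuperset_card_eq (n := d + 1)
    (Finset.subset_univ {i, j})
    (by rw [Finset.card_pair hne]; omega) (by simpa using hn)
  have hinj := (affineIndependent_of_det_edgeMat_ne_zero (hx I hcard)).injective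
  have hi : i ∈ Set.range (I.orderEmbOfFin hcard) := by
    rw [Finset.range_orderEmbOfFin]; exact hI (by simp)
  have hj : j ∈ Set.range (I.orderEmbOfFin hcard) := by
    rw [Finset.range_orderEmbOfFin]; exact hI (by simp)
  obtain ⟨a, rfl⟩ := hi
  obtain ⟨b, rfl⟩ := hj
  exact hne (congrArg _ (hinj hij))

open Classical in
lemma holeCount_eq [NeZero d] {n : ℕ} {x : Fin n → Euc d} (hx : IsGeneric x) (hn : d + 1 ≤ n) :
    holeCount d (d + 1) n x =
      ((Finset.univ.powersetCard (d + 1)).filter (IsEmptySimplex x)).card := by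
  have hinj := hx.injective hn
  symm
  refine Finset.card_bij (fun I _ => I.image x) ?_ ?_ ?_
  · intro I hI
    rw [Finset.mem_filter, Finset.mem_powersetCard] at hI
    obtain ⟨⟨-, hcard⟩, hI⟩ := hI
    have hsub : I.image x ⊆ Finset.image x Finset.univ :=
      Finset.image_subset_image (Finset.subset_univ I)
    have hdet := hx I hcard
    rw [Finset.mem_filter, Finset.mem_powerset]
    refine ⟨hsub, hsub, ?_, ?_, ?_⟩
    · rw [Finset.card_image_of_injective _ hinj, hcard]
    · have hai := affineIndependent_of_det_edgeMat_ne_zero hdet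
      rw [Finset.coe_image, ← range_comp_orderEmbOfFin x hcard]
      rintro _ ⟨i, rfl⟩ hmem
      refine hai.notMem_affineSpan_sdiff i Set.univ (convexHull_subset_affineSpan _ ?_)
      rwa [Set.image_sdiff hai.injective, Set.image_univ, Set.image_singleton]
    · intro p hp
      obtain ⟨j, -, rfl⟩ := Finset.mem_image.1 hp
      rw [Finset.coe_image]
      by_cases hj : j ∈ I
      · have hj' : j ∈ Set.range (I.orderEmbOfFin hcard) := by
          rw [Finset.range_orderEmbOfFin]; exact hj
        obtain ⟨i, rfl⟩ := hj'
        rw [← range_comp_orderEmbOfFin x hcard, ← simplexInt_eq hdet]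
        exact notMem_simplexInt hdet i
      · exact hI j hj
  · intro I _ J _ h
    exact Finset.image_injective hinj h
  · intro H hH
    rw [Finset.mem_filter, Finset.mem_powerset] at hH
    obtain ⟨hsub, -, hcard, -, hempty⟩ := hH
    have himg : (Finset.univ.filter fun i => x i ∈ H).image x = H := by
      ext p
      simp only [Finset.mem_image, Finset.mem_filter, Finset.mem_univ, true_and]
      constructor
      · rintro ⟨i, hi, rfl⟩
        exact hi
      · intro hp
        obtain ⟨i, -, rfl⟩ := Finset.mem_image.1 (hsub hp)
        exact ⟨i, hp, rfl⟩
    refine ⟨Finset.univ.filter fun i => x i ∈ H, ?_, himg⟩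
    rw [Finset.mem_filter, Finset.mem_powersetCard]
    refine ⟨⟨Finset.subset_univ _, ?_⟩, fun j _ => ?_⟩
    · rw [← hcard, ← himg, Finset.card_image_of_injective _ hinj, himg]
    · rw [← Finset.coe_image, himg]
      exact hempty _ (Finset.mem_image_of_mem x (Finset.mem_univ j))

variable {μ : Measure (Euc d)}

lemma pi_absolutelyContinuous_volume {K : Set (Euc d)} (n : ℕ) :
    (Measure.pi fun _ : Fin n => (volume : Measure (Euc d)).restrict K) ≪ volume := by
  rw [← Measure.restrict_pi_pi]
  exact Measure.absolutelyContinuous_of_le Measure.restrict_le_self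

lemma ae_isGeneric [IsProbabilityMeasure μ]
    (hμ : (Measure.pi fun _ : Fin (d + 1) => μ) ≪ volume) (n : ℕ) :
    ∀ᵐ x ∂Measure.pi fun _ : Fin n => μ, IsGeneric x := by
  simp only [IsGeneric]
  rw [ae_all_iff]
  intro I
  rw [ae_all_iff]
  intro h
  have hmp := measurePreserving_split μ (finSumEquivOfFinset h rfl)
  have h1 := (Measure.quasiMeasurePreserving_fst.comp hmp.quasiMeasurePreserving).ae
    (hμ.ae_le ae_det_edgeMat_ne_zero)
  filter_upwards [h1] with x hx
  convert hx using 3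
  ext1 i
  simp

lemma measurableSet_avoid (N : ℕ) : MeasurableSet {z : (Fin (d + 1) → Euc d) × (Fin N → Euc d) |
    ∀ j, z.2 j ∉ simplexInt z.1} := by
  have : {z : (Fin (d + 1) → Euc d) × (Fin N → Euc d) | ∀ j, z.2 j ∉ simplexInt z.1} =
      ⋂ j, (fun z => (z.1, z.2 j)) ⁻¹' {p : (Fin (d + 1) → Euc d) × Euc d |
        p.2 ∈ simplexInt p.1}ᶜ := by
    ext z
    simp
  rw [this]
  exact MeasurableSet.iInter fun j => measurableSet_mem_simplexInt.compl.preimage (by fun_prop)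

lemma prod_avoid [IsProbabilityMeasure μ] (N : ℕ) :
    ((Measure.pi fun _ : Fin (d + 1) => μ).prod (Measure.pi fun _ : Fin N => μ))
      {z | ∀ j, z.2 j ∉ simplexInt z.1} =
      ∫⁻ x, μ (simplexInt x)ᶜ ^ N ∂Measure.pi fun _ => μ := by
  rw [Measure.prod_apply (measurableSet_avoid N)]
  refine lintegral_congr fun x => ?_
  have : Prod.mk x ⁻¹' {z : (Fin (d + 1) → Euc d) × (Fin N → Euc d) |
      ∀ j, z.2 j ∉ simplexInt z.1} = Set.univ.pi fun _ => (simplexInt x)ᶜ := by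
    ext q
    simp
  rw [this, Measure.pi_pi]
  simp

theorem integral_holeCount [NeZero d] [IsProbabilityMeasure μ]
    (hμ : (Measure.pi fun _ : Fin (d + 1) => μ) ≪ volume) (N : ℕ) :
    ∫ x, (holeCount d (d + 1) (N + (d + 1)) x : ℝ) ∂(Measure.pi fun _ => μ) =
      (N + (d + 1)).choose (d + 1) *
        (∫⁻ x, μ (simplexInt x)ᶜ ^ N ∂Measure.pi fun _ : Fin (d + 1) => μ).toReal := by
  classical
  set n := N + (d + 1) with hn
  have hgen := ae_isGeneric hμ n
  have hcount : ∀ᵐ x ∂Measure.pi fun _ : Fin n => μ, (holeCount d (d + 1) n x : ℝ) =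
      ∑ I ∈ Finset.univ.powersetCard (d + 1),
        {x : Fin n → Euc d | IsEmptySimplex x I}.indicator (fun _ => (1 : ℝ)) x := by
    filter_upwards [hgen] with x hx
    rw [holeCount_eq hx (by omega), Finset.card_filter]
    push_cast
    rfl
  have key : ∀ I ∈ (Finset.univ : Finset (Fin n)).powersetCard (d + 1),
      ∃ A : Set (Fin n → Euc d), MeasurableSet A ∧
        {x : Fin n → Euc d | IsEmptySimplex x I} =ᵐ[Measure.pi fun _ : Fin n => μ] A ∧
        (Measure.pi fun _ : Fin n => μ) A =
          ∫⁻ x, μ (simplexInt x)ᶜ ^ N ∂Measure.pi fun _ : Fin (d + 1) => μ := by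
    intro I hI
    have hI := (Finset.mem_powersetCard.1 hI).2
    have hI' : Iᶜ.card = N := by rw [Finset.card_compl, hI, Fintype.card_fin]; omega
    have hmp := measurePreserving_split μ (finSumEquivOfFinset hI hI')
    refine ⟨_, hmp.measurable (measurableSet_avoid N), ?_, ?_⟩
    · filter_upwards [hgen] with x hx
      have e : (fun i => x (finSumEquivOfFinset hI hI' (.inl i))) = x ∘ I.orderEmbOfFin hI := by
        ext1 i
        simp
      refine propext ?_
      change (IsEmptySimplex x I ↔ ∀ j, x (finSumEquivOfFinset hI hI' (.inr j)) ∉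
        simplexInt fun i => x (finSumEquivOfFinset hI hI' (.inl i)))
      rw [e, simplexInt_eq (hx I hI), range_comp_orderEmbOfFin, IsEmptySimplex]
      constructor
      · intro h j
        refine h _ ?_
        rw [finSumEquivOfFinset_inr]
        exact Finset.mem_compl.1 (Finset.orderEmbOfFin_mem _ hI' j)
      · intro h j hj
        have hj' : j ∈ Set.range (Iᶜ.orderEmbOfFin hI') := by
          rw [Finset.range_orderEmbOfFin]
          simpa using hj
        obtain ⟨i, rfl⟩ := hj'
        have := h i
        rwa [finSumEquivOfFinset_inr] at this
    · rw [hmp.measure_preimage (measurableSet_avoid N).nullMeasurableSet, prod_avoid]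
  have hind : ∀ I ∈ (Finset.univ : Finset (Fin n)).powersetCard (d + 1),
      Integrable ({x : Fin n → Euc d | IsEmptySimplex x I}.indicator fun _ => (1 : ℝ))
        (Measure.pi fun _ : Fin n => μ) ∧
      ∫ x, {x : Fin n → Euc d | IsEmptySimplex x I}.indicator (fun _ => (1 : ℝ)) x
        ∂(Measure.pi fun _ : Fin n => μ) =
        (∫⁻ x, μ (simplexInt x)ᶜ ^ N ∂Measure.pi fun _ : Fin (d + 1) => μ).toReal := by
    intro I hI
    obtain ⟨A, hA, hAI, hAμ⟩ := key I hI
    have h1 := indicator_ae_eq_of_ae_eq_set (f := fun _ => (1 : ℝ)) hAI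
    refine ⟨((integrable_const (1 : ℝ)).indicator hA).congr h1.symm, ?_⟩
    rw [integral_congr_ae h1, integral_indicator_const _ hA, Measure.real, hAμ]
    simp
  rw [integral_congr_ae hcount, integral_finsetSum _ fun I hI => (hind I hI).1,
    Finset.sum_congr rfl fun I hI => (hind I hI).2, Finset.sum_const, Finset.card_powersetCard,
    Finset.card_univ, Fintype.card_fin, nsmul_eq_mul]

end

noncomputable section

variable {m : ℕ}

/-- The matrix whose rows are the homogeneous coordinates of the points `u i`. -/
def homMat (u : Fin (m + 1) → Fin m → ℝ) : Matrix (Fin (m + 1)) (Fin (m + 1)) ℝ :=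
  Matrix.of fun i => Matrix.vecCons 1 (u i)

/-- The affine function with coefficient vector `w`. -/
def height (w : Fin (m + 1) → ℝ) (v : Fin m → ℝ) : ℝ := w 0 + ∑ j, v j * w j.succ

lemma homMat_mulVec (u : Fin (m + 1) → Fin m → ℝ) (w : Fin (m + 1) → ℝ) (i : Fin (m + 1)) :
    (homMat u).mulVec w i = height w (u i) := by
  simp [homMat, height, Matrix.mulVec, dotProduct, Fin.sum_univ_succ]

lemma continuous_homMat : Continuous (homMat : (Fin (m + 1) → Fin m → ℝ) → _) := by
  refine continuous_matrix fun i j => ?_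
  refine Fin.cases ?_ (fun j => ?_) j
  · simpa [homMat] using continuous_const
  · simp only [homMat, Matrix.of_apply, Matrix.cons_val_succ]
    fun_prop

lemma continuous_height : Continuous fun z : (Fin (m + 1) → ℝ) × (Fin m → ℝ) => height z.1 z.2 := by
  unfold height
  fun_prop

lemma det_homMat (u : Fin (m + 1) → Fin m → ℝ) :
    (homMat u).det = (edgeMat fun i => WithLp.toLp 2 (u i)).det := by
  have h : (homMat u).det = (Matrix.of (fun i => Fin.cases (Matrix.vecCons 1 (u 0))
      (fun i => Matrix.vecCons 0 (u i.succ - u 0)) i) : Matrix (Fin (m+1)) (Fin (m+1)) ℝ).det := by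
    refine Matrix.det_eq_of_forall_row_eq_smul_add_const (Fin.cases 0 fun _ => 1) 0 (by simp) ?_
    intro i j
    refine Fin.cases ?_ (fun i => ?_) i
    · simp [homMat]
    · refine Fin.cases ?_ (fun j => ?_) j <;> simp [homMat]
  rw [h, Matrix.det_succ_column_zero, Fin.sum_univ_succ]
  simp
  congr 1

lemma ae_det_homMat_ne_zero : ∀ᵐ u : Fin (m + 1) → Fin m → ℝ, (homMat u).det ≠ 0 := by
  have h : MeasurePreserving (fun (u : Fin (m + 1) → Fin m → ℝ) i =>
      (WithLp.toLp 2 (u i) : Euc m)) volume volume :=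
    volume_preserving_pi (fun _ => PiLp.volume_preserving_toLp (Fin m))
  simp_rw [det_homMat]
  exact h.quasiMeasurePreserving.ae ae_det_edgeMat_ne_zero

lemma measurable_graph : Measurable fun (z : (Fin (m + 1) → ℝ) × (Fin (m + 1) → Fin m → ℝ)) i =>
    (height z.1 (z.2 i), z.2 i) := by
  refine measurable_pi_lambda _ fun i => ?_
  have := (continuous_height (m := m)).measurable.comp
    (f := fun z : (Fin (m + 1) → ℝ) × (Fin (m + 1) → Fin m → ℝ) => (z.1, z.2 i)) (by fun_prop)
  exact this.prodMk (by fun_prop)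

/-- Integration over tuples of points by means of the graph of the affine function through them. -/
lemma lintegral_eq_lintegral_graph {F : (Fin (m + 1) → ℝ × (Fin m → ℝ)) → ℝ≥0∞}
    (hF : Measurable F) :
    ∫⁻ X, F X = ∫⁻ w : Fin (m + 1) → ℝ, ∫⁻ u : Fin (m + 1) → Fin m → ℝ,
      ENNReal.ofReal |(homMat u).det| * F fun i => (height w (u i), u i) := by
  have e := volume_measurePreserving_arrowProdEquivProdArrow ℝ (Fin m → ℝ) (Fin (m + 1))
  have hF' : Measurable fun z : (Fin (m + 1) → ℝ) × (Fin (m + 1) → Fin m → ℝ) =>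
      F fun i => (z.1 i, z.2 i) := hF.comp (by fun_prop)
  have hg : Measurable fun z : (Fin (m + 1) → ℝ) × (Fin (m + 1) → Fin m → ℝ) =>
      ENNReal.ofReal |(homMat z.2).det| * F fun i => (height z.1 (z.2 i), z.2 i) := by
    refine Measurable.mul ?_ (hF.comp ?_)
    · exact ENNReal.measurable_ofReal.comp
        ((continuous_homMat.matrix_det.comp continuous_snd).abs.measurable)
    · exact measurable_graph
  rw [lintegral_lintegral_swap (f := fun w u =>
    ENNReal.ofReal |(homMat u).det| * F fun i => (height w (u i), u i)) hg.aemeasurable]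
  calc ∫⁻ X, F X = ∫⁻ z : (Fin (m + 1) → ℝ) × (Fin (m + 1) → Fin m → ℝ),
        F fun i => (z.1 i, z.2 i) := by
        rw [← e.symm.lintegral_comp_emb (MeasurableEquiv.measurableEmbedding _)]
        rfl
    _ = ∫⁻ u : Fin (m + 1) → Fin m → ℝ, ∫⁻ t : Fin (m + 1) → ℝ, F fun i => (t i, u i) := by
        rw [Measure.volume_eq_prod, lintegral_prod_symm _ hF'.aemeasurable]
    _ = _ := by
        refine lintegral_congr_ae ?_
        filter_upwards [ae_det_homMat_ne_zero (m := m)] with u hu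
        have hmap := Real.map_matrix_volume_pi_eq_smul_volume_pi hu
        have hFu : Measurable fun t : Fin (m + 1) → ℝ => F fun i => (t i, u i) :=
          hF.comp (by fun_prop)
        have h1 : ∫⁻ w : Fin (m + 1) → ℝ, F (fun i => (height w (u i), u i)) =
            ∫⁻ t, F (fun i => (t i, u i)) ∂(Measure.map (Matrix.toLin' (homMat u)) volume) := by
          rw [lintegral_map hFu (LinearMap.continuous_of_finiteDimensional _).measurable]
          simp_rw [Matrix.toLin'_apply, homMat_mulVec]
        rw [lintegral_const_mul' _ _ ENNReal.ofReal_ne_top, h1, hmap, lintegral_smul_measure, smul_eq_mul,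
          ← mul_assoc, ← ENNReal.ofReal_mul (abs_nonneg _), ← abs_mul, mul_inv_cancel₀ hu]
        simp

/-- The point of `ℝ^(m+1)` with first coordinate `p.1` and remaining coordinates `p.2`. -/
def pt (p : ℝ × (Fin m → ℝ)) : Euc (m + 1) := WithLp.toLp 2 (Matrix.vecCons p.1 p.2)

lemma measurePreserving_vecCons (E : Type*) [MeasureSpace E] [SigmaFinite (volume : Measure E)]
    (n : ℕ) : MeasurePreserving (fun z : E × (Fin n → E) => (Matrix.vecCons z.1 z.2))
      volume volume := by
  have h := (volume_preserving_piFinSuccAbove (fun _ : Fin (n + 1) => E) 0).symm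
  have e : (fun z : E × (Fin n → E) => (Matrix.vecCons z.1 z.2)) =
      (MeasurableEquiv.piFinSuccAbove (fun _ : Fin (n + 1) => E) 0).symm := by
    ext z i
    refine Fin.cases ?_ (fun i => ?_) i <;> simp [MeasurableEquiv.piFinSuccAbove]
  rw [e]
  exact h

lemma measurePreserving_pt : MeasurePreserving (pt (m := m)) volume volume :=
  (PiLp.volume_preserving_toLp (Fin (m + 1))).comp (measurePreserving_vecCons ℝ m)

lemma continuous_pt : Continuous (pt (m := m)) := by
  refine (PiLp.continuous_toLp 2 _).comp ?_
  exact Continuous.finCons (by fun_prop) (by fun_prop)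

lemma measurePreserving_cons_pt :
    MeasurePreserving (fun z : (ℝ × (Fin m → ℝ)) × (Fin (m + 1) → ℝ × (Fin m → ℝ)) =>
      (Matrix.vecCons (pt z.1) fun i => pt (z.2 i) : Fin (m + 2) → Euc (m + 1))) volume volume :=
  (measurePreserving_vecCons (Euc (m + 1)) (m + 1)).comp
    ((measurePreserving_pt (m := m)).prod
      (volume_preserving_pi fun _ : Fin (m + 1) => measurePreserving_pt (m := m)))

lemma abs_det_edgeMat_graph (w : Fin (m + 1) → ℝ) (u : Fin (m + 1) → Fin m → ℝ) (h : ℝ)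
    (u₀ : Fin m → ℝ) :
    |(edgeMat (Matrix.vecCons (pt (height w u₀ + h, u₀))
      fun i => pt (height w (u i), u i))).det| = |(homMat u).det| * |h| := by
  set L : Matrix (Fin (m + 1)) (Fin (m + 1)) ℝ :=
    Matrix.of (Matrix.vecCons (Matrix.vecCons 1 u₀) fun j => Matrix.vecCons 0 (Pi.single j 1))
  set Q : Matrix (Fin (m + 1)) (Fin (m + 1)) ℝ :=
    Matrix.of (Matrix.vecCons (Matrix.vecCons (w 0 - (height w u₀ + h)) (-u₀)) fun j =>
      Matrix.vecCons (w j.succ) (Pi.single j 1))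
  have hN : edgeMat (Matrix.vecCons (pt (height w u₀ + h, u₀))
      fun i => pt (height w (u i), u i)) = homMat u * Q := by
    ext i j
    refine Fin.cases ?_ (fun j => ?_) j
    · simp [edgeMat, pt, Matrix.mul_apply, Fin.sum_univ_succ, homMat, Q]
      simp [height]
      ring
    · simp [edgeMat, pt, Matrix.mul_apply, Fin.sum_univ_succ, homMat, Q, Pi.single_apply]
      ring
  have hL : L.det = 1 := by
    rw [Matrix.det_succ_column_zero, Fin.sum_univ_succ]
    have : (L.submatrix Fin.succ Fin.succ) = 1 := by
      ext i j
      simp [L, Matrix.one_apply, Pi.single_apply, eq_comm]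
    simp [this]
    simp [L]
  have hLQ : (L * Q).det = -h := by
    have h0 : ∀ j : Fin m, (L * Q) 0 j.succ = 0 := by
      intro j
      simp [L, Q, Matrix.mul_apply, Fin.sum_univ_succ, Pi.single_apply]
    have h1 : (L * Q) 0 0 = -h := by
      simp [L, Q, Matrix.mul_apply, Fin.sum_univ_succ]
      simp [height]
      ring
    rw [Matrix.det_succ_row_zero, Fin.sum_univ_succ]
    have : ((L * Q).submatrix Fin.succ Fin.succ) = 1 := by
      ext i j
      simp [L, Q, Matrix.mul_apply, Fin.sum_univ_succ, Matrix.one_apply, Pi.single_apply, eq_comm]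
    simp [h0, h1, this]
  rw [Matrix.det_mul, hL, one_mul] at hLQ
  rw [hN, Matrix.det_mul, hLQ, abs_mul, abs_neg]

end

noncomputable section

variable {m : ℕ}

/-- The normalised integral of the probability that a random simplex in `K` is avoided by `N`
further random points. -/
def avoidIntegral {d : ℕ} (K : Set (Euc d)) (N : ℕ) : ℝ≥0∞ :=
  ∫⁻ x, (volume.restrict K) (simplexInt x)ᶜ ^ N
    ∂Measure.pi fun _ : Fin (d + 1) => volume.restrict K

lemma avoidIntegral_eq {d : ℕ} {K : Set (Euc d)} (hK : Convex ℝ K) (hm : MeasurableSet K)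
    (hv : volume K = 1) (N : ℕ) :
    avoidIntegral K N = ∫⁻ x : Fin (d + 1) → Euc d, (∏ i, K.indicator 1 (x i)) *
      (1 - volume (interior (refSimplex d)) * ENNReal.ofReal |(edgeMat x).det|) ^ N := by
  rw [avoidIntegral, ← Measure.restrict_pi_pi, ← volume_pi, ← lintegral_indicator
    (MeasurableSet.univ_pi fun _ => hm)]
  refine lintegral_congr_ae ?_
  filter_upwards [ae_det_edgeMat_ne_zero (d := d)] with x hx
  by_cases hxK : x ∈ Set.univ.pi fun _ => K
  · have hxK' : ∀ i, x i ∈ K := fun i => hxK i (Set.mem_univ _)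
    have hsub : simplexInt x ⊆ K := by
      rw [simplexInt_eq hx]
      exact interior_subset.trans (convexHull_min (Set.range_subset_iff.2 hxK') hK)
    have hmeas : MeasurableSet (simplexInt x) := by
      rw [simplexInt_eq hx]
      exact isOpen_interior.measurableSet
    have : IsProbabilityMeasure (volume.restrict K) := ⟨by simp [hv]⟩
    rw [Set.indicator_of_mem hxK, prob_compl_eq_one_sub hmeas, Measure.restrict_apply hmeas,
      Set.inter_eq_left.2 hsub, volume_simplexInt hx, mul_comm (ENNReal.ofReal _)]
    simp [hxK']
  · rw [Set.indicator_of_notMem hxK]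
    simp only [Set.mem_univ_pi, not_forall] at hxK
    obtain ⟨i, hi⟩ := hxK
    rw [Finset.prod_eq_zero (Finset.mem_univ i) (by simp [hi]), zero_mul]

/-- The integrand of `avoidIntegral` in graph coordinates, with the last height rescaled. -/
def graphIntegrand (K : Set (Euc (m + 1))) (N : ℕ) (w : Fin (m + 1) → ℝ)
    (u : Fin (m + 1) → Fin m → ℝ) (u₀ : Fin m → ℝ) (s : ℝ) : ℝ≥0∞ :=
  ENNReal.ofReal |(homMat u).det| * ((∏ i, K.indicator 1 (pt (height w (u i), u i))) *
    (K.indicator 1 (pt (height w u₀ + s / N, u₀)) *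
      (1 - volume (interior (refSimplex (m + 1))) *
        ENNReal.ofReal (|(homMat u).det| * |s / N|)) ^ N))

lemma lintegral_eq_lintegral_rescale {f : ℝ → ℝ≥0∞} (hf : Measurable f) (c : ℝ) {N : ℕ}
    (hN : N ≠ 0) : N * ∫⁻ z, f z = ∫⁻ s, f (c + s / N) := by
  have hN' : (N : ℝ)⁻¹ ≠ 0 := by simpa using hN
  have h := Real.smul_map_volume_mul_right hN'
  have h2 : ∫⁻ z, f z = ∫⁻ z, f (c + z) := (lintegral_add_left_eq_self f c).symm
  have hfc : Measurable fun z => f (c + z) := hf.comp (by fun_prop)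
  rw [h2]
  nth_rw 1 [← h]
  rw [lintegral_smul_measure, lintegral_map hfc (by fun_prop), smul_eq_mul,
    ← mul_assoc]
  simp only [div_eq_mul_inv]
  rw [abs_of_nonneg (by positivity), ENNReal.ofReal_inv_of_pos (by positivity),
    ENNReal.ofReal_natCast, ENNReal.mul_inv_cancel (by simpa using hN) (by simp), one_mul]

lemma measurable_graphIntegrand {K : Set (Euc (m + 1))} (hm : MeasurableSet K) (N : ℕ) :
    Measurable fun z : (Fin (m + 1) → ℝ) × (Fin (m + 1) → Fin m → ℝ) × (Fin m → ℝ) × ℝ =>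
      graphIntegrand K N z.1 z.2.1 z.2.2.1 z.2.2.2 := by
  have hI : Measurable (K.indicator (1 : Euc (m + 1) → ℝ≥0∞)) := measurable_one.indicator hm
  have hh := (continuous_height (m := m)).measurable
  have hp := (measurePreserving_pt (m := m)).measurable
  have hd : Measurable fun u : Fin (m + 1) → Fin m → ℝ => |(homMat u).det| :=
    continuous_homMat.matrix_det.abs.measurable
  unfold graphIntegrand
  refine (ENNReal.measurable_ofReal.comp (hd.comp (by fun_prop))).mul (Measurable.mul ?_
    (Measurable.mul ?_ ?_))
  · refine Finset.measurable_fun_prod _ fun i _ => hI.comp (hp.comp ?_)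
    exact (hh.comp (f := fun z : (Fin (m + 1) → ℝ) × (Fin (m + 1) → Fin m → ℝ) × (Fin m → ℝ) × ℝ =>
      (z.1, z.2.1 i)) (by fun_prop)).prodMk (by fun_prop)
  · refine hI.comp (hp.comp ?_)
    refine Measurable.prodMk ?_ (by fun_prop)
    refine Measurable.add ?_ (by fun_prop)
    exact hh.comp (f := fun z : (Fin (m + 1) → ℝ) × (Fin (m + 1) → Fin m → ℝ) × (Fin m → ℝ) × ℝ =>
      (z.1, z.2.2.1)) (by fun_prop)
  · refine Measurable.pow_const (measurable_const.sub (measurable_const.mul ?_)) _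
    refine ENNReal.measurable_ofReal.comp (Measurable.mul (hd.comp (by fun_prop)) ?_)
    exact (by fun_prop : Measurable fun z : (Fin (m + 1) → ℝ) × (Fin (m + 1) → Fin m → ℝ) ×
      (Fin m → ℝ) × ℝ => z.2.2.2 / N).abs

theorem mul_avoidIntegral_eq {K : Set (Euc (m + 1))} (hK : Convex ℝ K) (hm : MeasurableSet K)
    (hv : volume K = 1) {N : ℕ} (hN : N ≠ 0) :
    N * avoidIntegral K N = ∫⁻ w, ∫⁻ u, ∫⁻ u₀, ∫⁻ s, graphIntegrand K N w u u₀ s := by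
  have hI : Measurable (K.indicator (1 : Euc (m + 1) → ℝ≥0∞)) := measurable_one.indicator hm
  set G : (Fin (m + 2) → Euc (m + 1)) → ℝ≥0∞ := fun x => (∏ i, K.indicator 1 (x i)) *
      (1 - volume (interior (refSimplex (m + 1))) * ENNReal.ofReal |(edgeMat x).det|) ^ N with hG
  have hGm : Measurable G := by
    refine Measurable.mul (Finset.measurable_fun_prod _ fun i _ => hI.comp (by fun_prop)) ?_
    refine Measurable.pow_const (measurable_const.sub (measurable_const.mul ?_)) _
    exact ENNReal.measurable_ofReal.comp continuous_edgeMat.matrix_det.abs.measurable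
  have hmp := measurePreserving_cons_pt (m := m)
  have hGc : Measurable fun z : (ℝ × (Fin m → ℝ)) × (Fin (m + 1) → ℝ × (Fin m → ℝ)) =>
      G (Matrix.vecCons (pt z.1) fun i => pt (z.2 i)) := hGm.comp hmp.measurable
  have h1 : avoidIntegral K N = ∫⁻ X : Fin (m + 1) → ℝ × (Fin m → ℝ), ∫⁻ p : ℝ × (Fin m → ℝ),
      G (Matrix.vecCons (pt p) fun i => pt (X i)) := by
    rw [avoidIntegral_eq hK hm hv, ← hmp.lintegral_comp hGm, Measure.volume_eq_prod,
      lintegral_prod_symm _ hGc.aemeasurable]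
  rw [h1, lintegral_eq_lintegral_graph hGc.lintegral_prod_left',
    ← lintegral_const_mul' _ _ (by simp)]
  refine lintegral_congr fun w => ?_
  rw [← lintegral_const_mul' _ _ (by simp)]
  refine lintegral_congr fun u => ?_
  have hGp : Measurable fun p : ℝ × (Fin m → ℝ) =>
      G (Matrix.vecCons (pt p) fun i => pt (height w (u i), u i)) :=
    hGc.comp (f := fun p => (p, fun i => (height w (u i), u i))) (by fun_prop)
  rw [mul_left_comm, Measure.volume_eq_prod, lintegral_prod_symm _
    hGp.aemeasurable,
    ← lintegral_const_mul' _ _ (by simp), ← lintegral_const_mul' _ _ (by simp)]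
  refine lintegral_congr fun u₀ => ?_
  rw [lintegral_eq_lintegral_rescale (c := height w u₀) _ hN, ← lintegral_const_mul' _ _ (by simp)]
  · refine lintegral_congr fun s => ?_
    simp only [hG, graphIntegrand, abs_det_edgeMat_graph, Fin.prod_univ_succ, Matrix.cons_val_zero,
      Matrix.cons_val_succ]
    ring
  · exact hGp.comp (f := fun z => (z, u₀)) (by fun_prop)

end

noncomputable section

variable {m : ℕ}

lemma prod_indicator_one {ι V : Type*} [Fintype ι] (A : Set V) (u : ι → V) :
    ∏ i, A.indicator (1 : V → ℝ≥0∞) (u i) = (Set.univ.pi fun _ => A).indicator 1 u := by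
  by_cases h : u ∈ Set.univ.pi fun _ => A
  · rw [Set.indicator_of_mem h]
    exact Finset.prod_eq_one fun i _ => by simp [h i (Set.mem_univ i)]
  · rw [Set.indicator_of_notMem h]
    simp only [Set.mem_univ_pi, not_forall] at h
    obtain ⟨i, hi⟩ := h
    exact Finset.prod_eq_zero (Finset.mem_univ i) (by simp [hi])

lemma lintegral_prod_indicator_one {V : Type*} [MeasureSpace V] [SigmaFinite (volume : Measure V)]
    {A : Set V} (hA : MeasurableSet A) (n : ℕ) :
    ∫⁻ u : Fin n → V, ∏ i, A.indicator (1 : V → ℝ≥0∞) (u i) = volume A ^ n := by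
  simp_rw [prod_indicator_one]
  rw [lintegral_indicator_one (MeasurableSet.univ_pi fun _ => hA), volume_pi_pi]
  simp

lemma integral_exp_neg_mul_abs {c : ℝ} (hc : 0 < c) : ∫ s : ℝ, Real.exp (-(c * |s|)) = 2 / c := by
  rw [integral_comp_abs (f := fun s => Real.exp (-(c * s)))]
  simp_rw [← neg_mul]
  rw [integral_exp_mul_Ioi (by linarith)]
  simp
  ring

lemma lintegral_exp_neg_mul_abs {c : ℝ} (hc : 0 < c) :
    ∫⁻ s : ℝ, ENNReal.ofReal (Real.exp (-(c * |s|))) = ENNReal.ofReal (2 / c) := by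
  rw [← integral_exp_neg_mul_abs hc, ofReal_integral_eq_lintegral_ofReal]
  · by_contra h
    have := integral_undef h
    rw [integral_exp_neg_mul_abs hc] at this
    exact absurd this (by positivity)
  · exact Eventually.of_forall fun s => (Real.exp_pos _).le

/-- The projection to `ℝ^m` of the section of `K` by the graph of an affine function. -/
def slice (K : Set (Euc (m + 1))) (w : Fin (m + 1) → ℝ) : Set (Fin m → ℝ) :=
  {v | pt (height w v, v) ∈ K}

lemma continuous_pt_graph :
    Continuous fun z : (Fin (m + 1) → ℝ) × (Fin m → ℝ) => pt (height z.1 z.2, z.2) :=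
  continuous_pt.comp (continuous_height.prodMk continuous_snd)

lemma indicator_slice (K : Set (Euc (m + 1))) (w : Fin (m + 1) → ℝ) (v : Fin m → ℝ) :
    K.indicator (1 : Euc (m + 1) → ℝ≥0∞) (pt (height w v, v)) = (slice K w).indicator 1 v := rfl

lemma measurableSet_slice_prod {K : Set (Euc (m + 1))} (hK : MeasurableSet K) :
    MeasurableSet {z : (Fin (m + 1) → ℝ) × (Fin m → ℝ) | z.2 ∈ slice K z.1} :=
  continuous_pt_graph.measurable hK

lemma measurableSet_slice {K : Set (Euc (m + 1))} (hK : MeasurableSet K) (w : Fin (m + 1) → ℝ) :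
    MeasurableSet (slice K w) :=
  measurable_prodMk_left (measurableSet_slice_prod hK)

lemma measurable_volume_slice {K : Set (Euc (m + 1))} (hK : MeasurableSet K) :
    Measurable fun w => volume (slice K w) :=
  measurable_measure_prodMk_left (measurableSet_slice_prod hK)

/-- The volume of the standard simplex. -/
def refVol (d : ℕ) : ℝ := volume.real (interior (refSimplex d))

lemma volume_interior_refSimplex_ne_top (d : ℕ) [NeZero d] :
    volume (interior (refSimplex d)) ≠ ∞ :=
  ((volume_interior_refSimplex_le d).trans_lt ENNReal.ofReal_lt_top).ne

lemma ofReal_refVol (d : ℕ) [NeZero d] :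
    ENNReal.ofReal (refVol d) = volume (interior (refSimplex d)) :=
  ENNReal.ofReal_toReal (volume_interior_refSimplex_ne_top d)

lemma refVol_pos (d : ℕ) [NeZero d] : 0 < refVol d :=
  ENNReal.toReal_pos (volume_interior_refSimplex_pos d).ne' (volume_interior_refSimplex_ne_top d)

lemma refVol_le (d : ℕ) [NeZero d] : refVol d ≤ 2 ^ d / d.factorial :=
  ENNReal.toReal_le_of_le_ofReal (by positivity) (volume_interior_refSimplex_le d)

/-- The limit of `graphIntegrand` as the number of points tends to infinity. -/
def limitIntegrand (K : Set (Euc (m + 1))) (w : Fin (m + 1) → ℝ)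
    (u : Fin (m + 1) → Fin m → ℝ) (u₀ : Fin m → ℝ) (s : ℝ) : ℝ≥0∞ :=
  ENNReal.ofReal |(homMat u).det| * ((∏ i, (slice K w).indicator 1 (u i)) *
    ((slice K w).indicator 1 u₀ *
      ENNReal.ofReal (Real.exp (-(refVol (m + 1) * |(homMat u).det| * |s|)))))

lemma one_sub_refVol_mul (D s : ℝ) (hD : 0 ≤ D) (N : ℕ) :
    1 - volume (interior (refSimplex (m + 1))) * ENNReal.ofReal (D * |s / N|) =
      ENNReal.ofReal (1 - refVol (m + 1) * D * |s| / N) := by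
  have := (refVol_pos (m + 1)).le
  rw [← ofReal_refVol, ← ENNReal.ofReal_mul this, ← ENNReal.ofReal_one,
    ← ENNReal.ofReal_sub _ (by positivity), abs_div, Nat.abs_cast]
  ring_nf

lemma limitIntegrand_le_liminf (K : Set (Euc (m + 1))) (w : Fin (m + 1) → ℝ)
    (u : Fin (m + 1) → Fin m → ℝ) (u₀ : Fin m → ℝ) (s : ℝ) :
    limitIntegrand (interior K) w u u₀ s ≤ liminf (fun N => graphIntegrand K N w u u₀ s) atTop := by
  by_cases hu : ∀ i, u i ∈ slice (interior K) w
  swap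
  · push Not at hu
    obtain ⟨i, hi⟩ := hu
    rw [limitIntegrand, Finset.prod_eq_zero (Finset.mem_univ i) (by simp [hi])]
    simp
  by_cases hu₀ : u₀ ∈ slice (interior K) w
  swap
  · simp [limitIntegrand, hu₀]
  refine (Tendsto.liminf_eq ?_).ge
  have hprod : ∏ i, (slice (interior K) w).indicator (1 : (Fin m → ℝ) → ℝ≥0∞) (u i) = 1 :=
    Finset.prod_eq_one fun i _ => by simp [hu i]
  have hprod' : ∏ i, K.indicator (1 : Euc (m + 1) → ℝ≥0∞) (pt (height w (u i), u i)) = 1 :=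
    Finset.prod_eq_one fun i _ => by
      have : pt (height w (u i), u i) ∈ K := interior_subset (hu i)
      simp [this]
  rw [limitIntegrand, hprod, Set.indicator_of_mem hu₀]
  simp only [graphIntegrand, hprod', one_mul, Pi.one_apply]
  refine ENNReal.Tendsto.const_mul ?_ (Or.inr ENNReal.ofReal_ne_top)
  set t := refVol (m + 1) * |(homMat u).det| * |s|
  have hs : Tendsto (fun N : ℕ => s / N) atTop (nhds 0) := tendsto_const_div_atTop_nhds_zero_nat s
  have hpt : Tendsto (fun N : ℕ => pt (height w u₀ + s / N, u₀)) atTop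
      (nhds (pt (height w u₀, u₀))) := by
    refine (continuous_pt.tendsto _).comp (Tendsto.prodMk_nhds ?_ tendsto_const_nhds)
    simpa using hs.const_add (height w u₀)
  have hexp : Tendsto (fun N : ℕ => ENNReal.ofReal ((1 + (-t) / N) ^ N)) atTop
      (nhds (ENNReal.ofReal (Real.exp (-t)))) :=
    ENNReal.tendsto_ofReal (Real.tendsto_one_add_div_pow_exp (-t))
  refine hexp.congr' ?_
  filter_upwards [hpt.eventually (isOpen_interior.mem_nhds hu₀), eventually_ge_atTop ⌈t⌉₊,
    eventually_gt_atTop 0] with N hN hNt hN0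
  rw [Set.indicator_of_mem (interior_subset hN), one_sub_refVol_mul _ _ (abs_nonneg _),
    ← ENNReal.ofReal_pow]
  · simp only [Pi.one_apply, one_mul]
    congr 2
    ring
  · have : t / N ≤ 1 := by
      rw [div_le_one (by exact_mod_cast hN0)]
      exact Nat.ceil_le.1 hNt
    linarith

lemma lintegral_limitIntegrand {K : Set (Euc (m + 1))} (hK : MeasurableSet K)
    (w : Fin (m + 1) → ℝ) : ∫⁻ u, ∫⁻ u₀, ∫⁻ s, limitIntegrand K w u u₀ s =
      ENNReal.ofReal (2 / refVol (m + 1)) * volume (slice K w) ^ (m + 2) := by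
  have hv := refVol_pos (m + 1)
  have hS := measurableSet_slice hK w
  have hI : Measurable ((slice K w).indicator (1 : (Fin m → ℝ) → ℝ≥0∞)) := measurable_one.indicator hS
  calc ∫⁻ u, ∫⁻ u₀, ∫⁻ s, limitIntegrand K w u u₀ s
      = ∫⁻ u : Fin (m + 1) → Fin m → ℝ, (ENNReal.ofReal (2 / refVol (m + 1)) *
        volume (slice K w)) * ∏ i, (slice K w).indicator 1 (u i) := by
        refine lintegral_congr_ae ?_
        filter_upwards [ae_det_homMat_ne_zero (m := m)] with u hu
        have hD := abs_pos.2 hu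
        have hs : ∀ u₀, ∫⁻ s, limitIntegrand K w u u₀ s = ENNReal.ofReal (2 / refVol (m + 1)) *
            (∏ i, (slice K w).indicator 1 (u i)) * (slice K w).indicator 1 u₀ := by
          intro u₀
          simp only [limitIntegrand]
          rw [lintegral_const_mul _ (by fun_prop), lintegral_const_mul _ (by fun_prop),
            lintegral_const_mul _ (by fun_prop), lintegral_exp_neg_mul_abs (by positivity)]
          have : ENNReal.ofReal (2 / refVol (m + 1)) = ENNReal.ofReal |(homMat u).det| *
              ENNReal.ofReal (2 / (refVol (m + 1) * |(homMat u).det|)) := by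
            rw [← ENNReal.ofReal_mul hD.le]
            congr 1
            field_simp
          rw [this]
          ring
        simp_rw [hs]
        rw [lintegral_const_mul _ hI, lintegral_indicator_one hS]
        ring
    _ = _ := by
        have hp : Measurable fun u : Fin (m + 1) → Fin m → ℝ =>
            ∏ i, (slice K w).indicator (1 : (Fin m → ℝ) → ℝ≥0∞) (u i) :=
          Finset.measurable_fun_prod _ fun i _ => hI.comp (by fun_prop)
        rw [lintegral_const_mul _ hp, lintegral_prod_indicator_one hS]
        ring

lemma lintegral_prod_prod_prod {A B C D : Type*} [MeasureSpace A] [MeasureSpace B] [MeasureSpace C]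
    [MeasureSpace D] [SFinite (volume : Measure B)] [SFinite (volume : Measure C)]
    [SFinite (volume : Measure D)] {f : A × B × C × D → ℝ≥0∞} (hf : Measurable f) :
    ∫⁻ z, f z = ∫⁻ a, ∫⁻ b, ∫⁻ c, ∫⁻ d, f (a, b, c, d) := by
  rw [Measure.volume_eq_prod, lintegral_prod _ hf.aemeasurable]
  refine lintegral_congr fun a => ?_
  have h1 : Measurable fun z : B × C × D => f (a, z) := hf.comp (by fun_prop)
  rw [Measure.volume_eq_prod, lintegral_prod _ h1.aemeasurable]
  refine lintegral_congr fun b => ?_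
  have h2 : Measurable fun z : C × D => f (a, b, z) := hf.comp (by fun_prop)
  rw [Measure.volume_eq_prod, lintegral_prod _ h2.aemeasurable]

theorem le_liminf_mul_avoidIntegral {K : Set (Euc (m + 1))} (hK : Convex ℝ K)
    (hm : MeasurableSet K) (hv : volume K = 1) :
    ENNReal.ofReal (2 / refVol (m + 1)) * ∫⁻ w, volume (slice (interior K) w) ^ (m + 2) ≤
      liminf (fun N : ℕ => N * avoidIntegral K N) atTop := by
  have hm' : MeasurableSet (interior K) := isOpen_interior.measurableSet
  calc ENNReal.ofReal (2 / refVol (m + 1)) * ∫⁻ w, volume (slice (interior K) w) ^ (m + 2)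
      = ∫⁻ w, ∫⁻ u, ∫⁻ u₀, ∫⁻ s, limitIntegrand (interior K) w u u₀ s := by
        rw [← lintegral_const_mul _ ((measurable_volume_slice hm').pow_const _)]
        exact lintegral_congr fun w => (lintegral_limitIntegrand hm' w).symm
    _ ≤ ∫⁻ w, ∫⁻ u, ∫⁻ u₀, ∫⁻ s, liminf (fun N => graphIntegrand K N w u u₀ s) atTop := by
        gcongr with w u u₀ s
        exact limitIntegrand_le_liminf K w u u₀ s
    _ = ∫⁻ z : (Fin (m + 1) → ℝ) × (Fin (m + 1) → Fin m → ℝ) × (Fin m → ℝ) × ℝ,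
        liminf (fun N => graphIntegrand K N z.1 z.2.1 z.2.2.1 z.2.2.2) atTop :=
        (lintegral_prod_prod_prod (Measurable.liminf fun N => measurable_graphIntegrand hm N)).symm
    _ ≤ liminf (fun N => ∫⁻ z : (Fin (m + 1) → ℝ) × (Fin (m + 1) → Fin m → ℝ) × (Fin m → ℝ) × ℝ,
        graphIntegrand K N z.1 z.2.1 z.2.2.1 z.2.2.2) atTop :=
        lintegral_liminf_le fun N => measurable_graphIntegrand hm N
    _ = _ := by
        refine liminf_congr ?_
        filter_upwards [eventually_gt_atTop 0] with N hN
        rw [mul_avoidIntegral_eq hK hm hv hN.ne',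
          lintegral_prod_prod_prod (measurable_graphIntegrand hm N)]

end

noncomputable section

variable {m : ℕ}

lemma Matrix.det_one_updateRow {ι : Type*} [Fintype ι] [DecidableEq ι] (a : ι → ℝ) (j : ι) :
    ((1 : Matrix ι ι ℝ).updateRow j a).det = a j := by
  rw [← Matrix.det_transpose, ← Matrix.updateCol_transpose, Matrix.transpose_one,
    ← Matrix.cramer_apply, Matrix.cramer_one]
  rfl

lemma abs_mul_volume_slice_le {K : Set (Euc (m + 1))} {R : ℝ} (hR : 0 ≤ R)
    (hK : ∀ p ∈ K, ‖p‖ ≤ R) (w : Fin (m + 1) → ℝ) (j : Fin m) :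
    ENNReal.ofReal |w j.succ| * volume (slice K w) ≤ ENNReal.ofReal ((2 * R) ^ m) := by
  set T := Matrix.toLin' ((1 : Matrix (Fin m) (Fin m) ℝ).updateRow j fun i => w i.succ)
  have hT : LinearMap.det T = w j.succ := by
    rw [LinearMap.det_toLin', Matrix.det_one_updateRow]
  have h := Measure.addHaar_image_linearMap volume T (slice K w)
  rw [hT] at h
  rw [← h]
  have hsub : T '' slice K w ⊆ Metric.closedBall (Pi.single j (-w 0)) R := by
    rintro _ ⟨v, hv, rfl⟩
    rw [mem_closedBall_iff_norm, pi_norm_le_iff_of_nonneg hR]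
    intro i
    by_cases hij : i = j
    · subst hij
      have h0 := (PiLp.norm_apply_le (pt (height w v, v)) 0).trans (hK _ hv)
      have : T v i - (Pi.single i (-w 0) : Fin m → ℝ) i = height w v := by
        simp [T, Matrix.mulVec, dotProduct, height, mul_comm, add_comm]
      rw [Pi.sub_apply, this]
      exact h0
    · have h0 := (PiLp.norm_apply_le (pt (height w v, v)) i.succ).trans (hK _ hv)
      have : T v i - (Pi.single j (-w 0) : Fin m → ℝ) i = v i := by
        simp [T, Matrix.mulVec, dotProduct, hij, Matrix.one_apply]
      rw [Pi.sub_apply, this]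
      exact h0
  refine (measure_mono hsub).trans ?_
  rw [Real.volume_pi_closedBall _ hR, Fintype.card_fin]

lemma volume_slice_le {K : Set (Euc (m + 1))} {R : ℝ} (hR : 0 ≤ R)
    (hK : ∀ p ∈ K, ‖p‖ ≤ R) (w : Fin (m + 1) → ℝ) :
    volume (slice K w) ≤ ENNReal.ofReal ((2 * R) ^ m) := by
  have hsub : slice K w ⊆ Metric.closedBall 0 R := by
    intro v hv
    rw [mem_closedBall_zero_iff, pi_norm_le_iff_of_nonneg hR]
    exact fun i => (PiLp.norm_apply_le (pt (height w v, v)) i.succ).trans (hK _ hv)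
  refine (measure_mono hsub).trans ?_
  rw [Real.volume_pi_closedBall _ hR, Fintype.card_fin]

lemma volume_slice_le_div {K : Set (Euc (m + 1))} {R : ℝ} (hR : 0 ≤ R)
    (hK : ∀ p ∈ K, ‖p‖ ≤ R) (w : Fin (m + 1) → ℝ) :
    volume (slice K w) ≤ ENNReal.ofReal (2 * (2 * R) ^ m / (1 + ‖fun j : Fin m => w j.succ‖)) := by
  have h1 := volume_slice_le hR hK w
  have hB : 0 ≤ (2 * R) ^ m := by positivity
  have hfin : volume (slice K w) ≠ ∞ := (h1.trans_lt ENNReal.ofReal_lt_top).ne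
  rw [← ENNReal.ofReal_toReal hfin]
  apply ENNReal.ofReal_le_ofReal
  set s := (volume (slice K w)).toReal with hs
  have hs0 : 0 ≤ s := ENNReal.toReal_nonneg
  have h1' : s ≤ (2 * R) ^ m := ENNReal.toReal_le_of_le_ofReal hB h1
  have h2 : ∀ j : Fin m, |w j.succ| * s ≤ (2 * R) ^ m := by
    intro j
    have := ENNReal.toReal_le_of_le_ofReal hB (abs_mul_volume_slice_le hR hK w j)
    rwa [ENNReal.toReal_mul, ENNReal.toReal_ofReal (abs_nonneg _)] at this
  rw [le_div_iff₀ (by positivity)]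
  rcases hs0.eq_or_lt with h0 | h0
  · rw [← h0, zero_mul]
    positivity
  · have h3 : ‖fun j : Fin m => w j.succ‖ ≤ (2 * R) ^ m / s := by
      rw [pi_norm_le_iff_of_nonneg (by positivity)]
      intro j
      rw [Real.norm_eq_abs, le_div_iff₀ h0]
      exact h2 j
    rw [le_div_iff₀ h0] at h3
    linarith

lemma graphIntegrand_le (K : Set (Euc (m + 1))) {N : ℕ} (hN : N ≠ 0) (w : Fin (m + 1) → ℝ)
    (u : Fin (m + 1) → Fin m → ℝ) (u₀ : Fin m → ℝ) (s : ℝ) :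
    graphIntegrand K N w u u₀ s ≤ ENNReal.ofReal |(homMat u).det| *
      (∏ i, (slice K w).indicator 1 (u i)) *
      (ENNReal.ofReal (Real.exp (-(refVol (m + 1) * |(homMat u).det| * |s|))) *
        (slice K (Function.update w 0 (w 0 + s / N))).indicator 1 u₀) := by
  have hu : (slice K (Function.update w 0 (w 0 + s / N))).indicator (1 : (Fin m → ℝ) → ℝ≥0∞) u₀ =
      K.indicator 1 (pt (height w u₀ + s / N, u₀)) := by
    rw [← indicator_slice]
    congr 3
    simp [height]
    ring
  rw [graphIntegrand, hu, one_sub_refVol_mul _ _ (abs_nonneg _),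
    mul_comm (ENNReal.ofReal (Real.exp _)), ← mul_assoc]
  simp_rw [← indicator_slice]
  gcongr
  set t := refVol (m + 1) * |(homMat u).det| * |s|
  calc ENNReal.ofReal (1 - t / N) ^ N ≤ ENNReal.ofReal (Real.exp (-(t / N))) ^ N := by
        gcongr
        exact Real.one_sub_le_exp_neg _
    _ = ENNReal.ofReal (Real.exp (-t)) := by
        rw [← ENNReal.ofReal_pow (Real.exp_pos _).le, ← Real.exp_nat_mul]
        congr 2
        field_simp

lemma lintegral_graphIntegrand_le {K : Set (Euc (m + 1))} (hm : MeasurableSet K) {R : ℝ}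
    (hR : 0 ≤ R) (hK : ∀ p ∈ K, ‖p‖ ≤ R) {N : ℕ} (hN : N ≠ 0) (w : Fin (m + 1) → ℝ) :
    ∫⁻ u, ∫⁻ u₀, ∫⁻ s, graphIntegrand K N w u u₀ s ≤
      ENNReal.ofReal (2 / refVol (m + 1)) *
        ENNReal.ofReal (2 * (2 * R) ^ m / (1 + ‖fun j : Fin m => w j.succ‖)) ^ (m + 1) *
          volume (slice K w) := by
  have hv := refVol_pos (m + 1)
  have hS := measurableSet_slice hm w
  set b := ENNReal.ofReal (2 * (2 * R) ^ m / (1 + ‖fun j : Fin m => w j.succ‖)) with hb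
  have hI : Measurable ((slice K w).indicator (1 : (Fin m → ℝ) → ℝ≥0∞)) :=
    measurable_one.indicator hS
  have hp : Measurable fun u : Fin (m + 1) → Fin m → ℝ =>
      ∏ i, (slice K w).indicator (1 : (Fin m → ℝ) → ℝ≥0∞) (u i) :=
    Finset.measurable_fun_prod _ fun i _ => hI.comp (by fun_prop)
  have hslice : ∀ s : ℝ, volume (slice K (Function.update w 0 (w 0 + s / N))) ≤ b := by
    intro s
    simpa using volume_slice_le_div hR hK (Function.update w 0 (w 0 + s / N))
  have hjm : Measurable fun z : (Fin m → ℝ) × ℝ =>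
      (slice K (Function.update w 0 (w 0 + z.2 / N))).indicator (1 : (Fin m → ℝ) → ℝ≥0∞) z.1 := by
    have hc : Continuous fun z : (Fin m → ℝ) × ℝ => (Function.update w 0 (w 0 + z.2 / N), z.1) :=
      (continuous_const.update 0 (by fun_prop)).prodMk continuous_fst
    exact (measurable_one (α := ℝ≥0∞)).indicator (measurableSet_slice_prod hm) |>.comp hc.measurable
  calc ∫⁻ u, ∫⁻ u₀, ∫⁻ s, graphIntegrand K N w u u₀ s
      ≤ ∫⁻ u : Fin (m + 1) → Fin m → ℝ, (ENNReal.ofReal (2 / refVol (m + 1)) * b) *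
          ∏ i, (slice K w).indicator 1 (u i) := by
        refine lintegral_mono_ae ?_
        filter_upwards [ae_det_homMat_ne_zero (m := m)] with u hu
        have hD := abs_pos.2 hu
        set p : ℝ≥0∞ := ENNReal.ofReal |(homMat u).det| * ∏ i, (slice K w).indicator 1 (u i)
        have hfm : Measurable fun z : (Fin m → ℝ) × ℝ =>
          (ENNReal.ofReal (Real.exp (-(refVol (m + 1) * |(homMat u).det| * |z.2|))) *
            (slice K (Function.update w 0 (w 0 + z.2 / N))).indicator
              (1 : (Fin m → ℝ) → ℝ≥0∞) z.1) := Measurable.mul (by fun_prop) hjm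
        have hsm : Measurable fun s : ℝ =>
            ENNReal.ofReal (Real.exp (-(refVol (m + 1) * |(homMat u).det| * |s|))) *
              volume (slice K (Function.update w 0 (w 0 + s / N))) :=
          Measurable.mul (by fun_prop) ((measurable_volume_slice hm).comp
            (continuous_const.update 0 (by fun_prop)).measurable)
        calc ∫⁻ u₀, ∫⁻ s, graphIntegrand K N w u u₀ s
            ≤ ∫⁻ u₀ : Fin m → ℝ, ∫⁻ s : ℝ, p *
              (ENNReal.ofReal (Real.exp (-(refVol (m + 1) * |(homMat u).det| * |s|))) *
                (slice K (Function.update w 0 (w 0 + s / N))).indicator 1 u₀) := by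
              gcongr with u₀ s
              exact graphIntegrand_le K hN w u u₀ s
          _ = p * ∫⁻ s : ℝ, ENNReal.ofReal (Real.exp (-(refVol (m + 1) * |(homMat u).det| * |s|))) *
                volume (slice K (Function.update w 0 (w 0 + s / N))) := by
              rw [lintegral_lintegral_swap (hfm.const_mul p).aemeasurable,
                ← lintegral_const_mul _ hsm]
              refine lintegral_congr fun s => ?_
              have hSs := measurableSet_slice hm (Function.update w 0 (w 0 + s / N))
              have hfs := hfm.comp (measurable_prodMk_right (y := s))
              rw [← lintegral_indicator_one hSs,
                ← lintegral_const_mul _ (measurable_one.indicator hSs)]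
              exact lintegral_const_mul _ hfs
          _ ≤ p * ∫⁻ s : ℝ, ENNReal.ofReal (Real.exp (-(refVol (m + 1) * |(homMat u).det| * |s|))) *
                b := by
              gcongr with s
              exact hslice s
          _ = _ := by
              rw [lintegral_mul_const _ (by fun_prop), lintegral_exp_neg_mul_abs (by positivity)]
              have : ENNReal.ofReal (2 / refVol (m + 1)) = ENNReal.ofReal |(homMat u).det| *
                  ENNReal.ofReal (2 / (refVol (m + 1) * |(homMat u).det|)) := by
                rw [← ENNReal.ofReal_mul hD.le]
                congr 1
                field_simp
              rw [this]
              simp only [p]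
              ring
    _ = ENNReal.ofReal (2 / refVol (m + 1)) * b * volume (slice K w) ^ (m + 1) := by
        rw [lintegral_const_mul _ hp, lintegral_prod_indicator_one hS]
    _ ≤ ENNReal.ofReal (2 / refVol (m + 1)) * b * (b ^ m * volume (slice K w)) := by
        rw [pow_succ]
        gcongr
        exact volume_slice_le_div hR hK w
    _ = _ := by ring

lemma lintegral_volume_slice {K : Set (Euc (m + 1))} (hm : MeasurableSet K) (a : Fin m → ℝ) :
    ∫⁻ b : ℝ, volume (slice K (Matrix.vecCons b a)) = volume K := by
  have hI : Measurable (K.indicator (1 : Euc (m + 1) → ℝ≥0∞)) := measurable_one.indicator hm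
  have hIp : Measurable fun p : ℝ × (Fin m → ℝ) => K.indicator (1 : Euc (m + 1) → ℝ≥0∞) (pt p) :=
    hI.comp measurePreserving_pt.measurable
  have hh : ∀ b v, height (Matrix.vecCons b a) v = b + ∑ j, v j * a j := by
    intro b v
    simp [height]
  calc ∫⁻ b : ℝ, volume (slice K (Matrix.vecCons b a))
      = ∫⁻ b : ℝ, ∫⁻ v : Fin m → ℝ, K.indicator 1 (pt (b + ∑ j, v j * a j, v)) := by
        refine lintegral_congr fun b => ?_
        rw [← lintegral_indicator_one (measurableSet_slice hm _)]
        simp_rw [← indicator_slice, hh]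
    _ = ∫⁻ v : Fin m → ℝ, ∫⁻ b : ℝ, K.indicator 1 (pt (b + ∑ j, v j * a j, v)) := by
        refine lintegral_lintegral_swap (Measurable.aemeasurable ?_)
        exact hIp.comp (f := fun z : ℝ × (Fin m → ℝ) => (z.1 + ∑ j, z.2 j * a j, z.2))
          (by fun_prop)
    _ = ∫⁻ v : Fin m → ℝ, ∫⁻ b : ℝ, K.indicator 1 (pt (b, v)) := by
        refine lintegral_congr fun v => ?_
        exact lintegral_add_right_eq_self (fun b => K.indicator (1 : Euc (m + 1) → ℝ≥0∞) (pt (b, v)))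
          (∑ j, v j * a j)
    _ = ∫⁻ p : ℝ × (Fin m → ℝ), K.indicator 1 (pt p) := by
        rw [Measure.volume_eq_prod, lintegral_prod_symm _ hIp.aemeasurable]
    _ = volume K := by
        rw [measurePreserving_pt.lintegral_comp hI, lintegral_indicator_one hm]

theorem exists_mul_avoidIntegral_le {K : Set (Euc (m + 1))} (hK : Convex ℝ K)
    (hc : IsCompact K) (hv : volume K = 1) :
    ∃ C : ℝ≥0∞, C ≠ ∞ ∧ ∀ N : ℕ, N ≠ 0 → N * avoidIntegral K N ≤ C := by
  have hm := hc.measurableSet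
  obtain ⟨R, hR0, hR⟩ : ∃ R : ℝ, 0 ≤ R ∧ ∀ p ∈ K, ‖p‖ ≤ R := by
    obtain ⟨R, hR⟩ := hc.isBounded.exists_norm_le
    exact ⟨max R 0, le_max_right _ _, fun p hp => (hR p hp).trans (le_max_left _ _)⟩
  set B := 2 * (2 * R) ^ m with hB
  have hB0 : 0 ≤ B := by positivity
  have hinteg : ∫⁻ a : Fin m → ℝ, ENNReal.ofReal (B / (1 + ‖a‖)) ^ (m + 1) ≠ ∞ := by
    have h := finite_integral_one_add_norm (E := Fin m → ℝ) (μ := volume) (r := (m + 1 : ℝ))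
      (by simp)
    have e : ∀ a : Fin m → ℝ, ENNReal.ofReal (B / (1 + ‖a‖)) ^ (m + 1) =
        ENNReal.ofReal (B ^ (m + 1)) * ENNReal.ofReal ((1 + ‖a‖) ^ (-(m + 1 : ℝ))) := by
      intro a
      have : (0 : ℝ) < 1 + ‖a‖ := by positivity
      rw [← ENNReal.ofReal_pow (by positivity), ← ENNReal.ofReal_mul (by positivity),
        Real.rpow_neg this.le, div_pow, div_eq_mul_inv]
      norm_cast
    simp_rw [e]
    rw [lintegral_const_mul _ (by fun_prop)]
    exact ENNReal.mul_ne_top ENNReal.ofReal_ne_top h.ne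
  refine ⟨_, ENNReal.mul_ne_top (ENNReal.ofReal_ne_top (r := 2 / refVol (m + 1))) hinteg, ?_⟩
  intro N hN
  have hsm := measurable_volume_slice hm
  calc N * avoidIntegral K N = ∫⁻ w, ∫⁻ u, ∫⁻ u₀, ∫⁻ s, graphIntegrand K N w u u₀ s :=
        mul_avoidIntegral_eq hK hm hv hN
    _ ≤ ∫⁻ w : Fin (m + 1) → ℝ, ENNReal.ofReal (2 / refVol (m + 1)) *
        ENNReal.ofReal (B / (1 + ‖fun j : Fin m => w j.succ‖)) ^ (m + 1) *
          volume (slice K w) := lintegral_mono fun w => lintegral_graphIntegrand_le hm hR0 hR hN w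
    _ = ∫⁻ z : ℝ × (Fin m → ℝ), ENNReal.ofReal (2 / refVol (m + 1)) *
        ENNReal.ofReal (B / (1 + ‖z.2‖)) ^ (m + 1) *
          volume (slice K (Matrix.vecCons z.1 z.2)) := by
        rw [← (measurePreserving_vecCons ℝ m).lintegral_comp]
        · simp
        · exact Measurable.mul (by fun_prop) hsm
    _ = ∫⁻ a : Fin m → ℝ, ∫⁻ b : ℝ, ENNReal.ofReal (2 / refVol (m + 1)) *
        ENNReal.ofReal (B / (1 + ‖a‖)) ^ (m + 1) *
          volume (slice K (Matrix.vecCons b a)) := by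
        rw [Measure.volume_eq_prod, lintegral_prod_symm]
        exact (Measurable.mul (by fun_prop)
          (hsm.comp (measurePreserving_vecCons ℝ m).measurable)).aemeasurable
    _ = ∫⁻ a : Fin m → ℝ, ENNReal.ofReal (2 / refVol (m + 1)) *
        ENNReal.ofReal (B / (1 + ‖a‖)) ^ (m + 1) := by
        refine lintegral_congr fun a => ?_
        rw [lintegral_const_mul, lintegral_volume_slice hm, hv, mul_one]
        exact hsm.comp ((measurePreserving_vecCons ℝ m).measurable.comp measurable_prodMk_right)
    _ ≤ _ := (lintegral_const_mul' _ _ ENNReal.ofReal_ne_top).le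

end

noncomputable section

variable {m : ℕ}

lemma lintegral_pi_prod {V : Type*} [MeasureSpace V] [SigmaFinite (volume : Measure V)]
    {f : V → ℝ≥0∞} (hf : Measurable f) (n : ℕ) :
    ∫⁻ u : Fin n → V, ∏ i, f (u i) = (∫⁻ v, f v) ^ n := by
  induction n with
  | zero =>
    simp only [Finset.univ_eq_empty, Finset.prod_empty, lintegral_const, one_mul, pow_zero]
    rw [← Set.pi_univ Set.univ, volume_pi_pi]
    simp
  | succ n ih =>
    have hp : ∀ k, Measurable fun u : Fin k → V => ∏ i, f (u i) := fun k =>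
      Finset.measurable_fun_prod _ fun i _ => hf.comp (measurable_pi_apply i)
    rw [← (measurePreserving_vecCons V n).lintegral_comp (hp _), pow_succ', ← ih,
      Measure.volume_eq_prod, ← lintegral_prod_mul hf.aemeasurable (hp n).aemeasurable]
    simp [Fin.prod_univ_succ]

lemma abs_det_homMat_mul_le (u : Fin (m + 1) → Fin m → ℝ) (A : Matrix (Fin m) (Fin m) ℝ)
    (c : Euc m) : |(homMat u).det| * |A.det| ≤
      ∏ i, √(1 + ‖Matrix.toEuclideanCLM (𝕜 := ℝ) A (WithLp.toLp 2 (u i) - c)‖ ^ 2) := by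
  set Q : Matrix (Fin (m + 1)) (Fin (m + 1)) ℝ :=
    Matrix.of (Matrix.vecCons (Matrix.vecCons 1 (-(A.mulVec c.ofLp)))
      fun j => Matrix.vecCons 0 fun k => A k j)
  have hQ : Q.det = A.det := by
    rw [Matrix.det_succ_column_zero, Fin.sum_univ_succ]
    have : (Q.submatrix Fin.succ Fin.succ) = A.transpose := by
      ext i j
      simp [Q]
    simp [this]
    simp [Q]
  have hM : homMat u * Q = homMat fun i =>
      (Matrix.toEuclideanCLM (𝕜 := ℝ) A (WithLp.toLp 2 (u i) - c)).ofLp := by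
    ext i j
    refine Fin.cases ?_ (fun j => ?_) j
    · simp [Matrix.mul_apply, Fin.sum_univ_succ, homMat, Q]
    · simp only [Matrix.mul_apply, Fin.sum_univ_succ, homMat, Q, Matrix.of_apply,
        Matrix.cons_val_zero, Matrix.cons_val_succ, Matrix.ofLp_toEuclideanCLM, WithLp.ofLp_sub,
        Matrix.mulVec_sub, Pi.sub_apply, Pi.neg_apply, one_mul]
      rw [neg_add_eq_sub]
      congr 1
      simp [Matrix.mulVec, dotProduct, mul_comm]
  rw [← abs_mul, ← hQ, ← Matrix.det_mul, hM]
  refine (Matrix.abs_det_le_prod_norm_row _).trans_eq (Finset.prod_congr rfl fun i _ => ?_)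
  rw [EuclideanSpace.norm_eq, EuclideanSpace.norm_sq_eq, Fin.sum_univ_succ]
  simp [homMat]

lemma sqrt_one_add_le (d t : ℝ) (hd : 0 < d) (ht : 0 ≤ t) :
    √(1 + t) ≤ √d / 2 * (1 + (1 + t) / d) := by
  have h1 := Real.sq_sqrt hd.le
  have h2 := Real.sq_sqrt (by linarith : 0 ≤ 1 + t)
  have h3 : 0 < √d := Real.sqrt_pos.2 hd
  have e : √d / 2 * (1 + (1 + t) / d) = (√d ^ 2 + √(1 + t) ^ 2) / (2 * √d) := by
    rw [h2]
    nth_rw 2 [← h1]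
    field_simp
  rw [e, le_div_iff₀ (by positivity)]
  nlinarith [sq_nonneg (√d - √(1 + t))]

lemma lintegral_abs_det_homMat_le (hm : 0 < m) {S : Set (Fin m → ℝ)} (hS : IsOpen S)
    (hconv : Convex ℝ S) (hb : Bornology.IsBounded S) :
    ∫⁻ u : Fin (m + 1) → Fin m → ℝ, ENNReal.ofReal |(homMat u).det| * ∏ i, S.indicator 1 (u i) ≤
      ENNReal.ofReal (√(m + 1) ^ (m + 1) * (4 * 10 ^ 19 * √√m) ^ m) * volume S ^ (m + 2) := by
  rcases S.eq_empty_or_nonempty with rfl | hne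
  · simp
  set S' : Set (Euc m) := WithLp.ofLp ⁻¹' S with hS'
  have hopen : IsOpen S' := hS.preimage (PiLp.continuous_ofLp 2 _)
  have hpres : MeasurePreserving (WithLp.toLp 2 : (Fin m → ℝ) → Euc m) volume volume :=
    PiLp.volume_preserving_toLp (Fin m)
  have hvol : volume S' = volume S := by
    rw [← hpres.measure_preimage hopen.measurableSet.nullMeasurableSet]
    rfl
  have hK : IsThickConvex S' := by
    refine ⟨hopen.measurableSet, ?_, ?_, ?_⟩
    · exact hconv.linear_preimage (WithLp.linearEquiv 2 ℝ (Fin m → ℝ)).toLinearMap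
    · have : S' = (PiLp.continuousLinearEquiv 2 ℝ fun _ : Fin m => ℝ).symm '' S := by
        ext x
        constructor
        · exact fun hx => ⟨x.ofLp, hx, rfl⟩
        · rintro ⟨v, hv, rfl⟩
          exact hv
      rw [this]
      exact (PiLp.continuousLinearEquiv 2 ℝ fun _ : Fin m => ℝ).symm.lipschitz.isBounded_image hb
    · rw [hvol]
      exact (hS.measure_pos volume hne).ne'
  obtain ⟨A, c, hA, hinteg, hdet⟩ := hK.exists_position hm
  set g : Euc m → ℝ := fun x => √(1 + ‖Matrix.toEuclideanCLM (𝕜 := ℝ) A (x - c)‖ ^ 2) with hg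
  have hgc : Continuous g := by fun_prop
  set s := volume.real S' with hs
  have hsS : ENNReal.ofReal s = volume S := by rw [← hvol]; exact ofReal_measureReal hK.measure_ne_top
  have hs0 : 0 ≤ s := measureReal_nonneg
  have hgi : ∫ x in S', g x ≤ √(m + 1) * s := by
    have hi : IntegrableOn (fun x => ‖Matrix.toEuclideanCLM (𝕜 := ℝ) A (x - c)‖ ^ 2) S' :=
      hK.integrableOn (by fun_prop)
    have hc' : IntegrableOn (fun _ => (1 : ℝ)) S' := hK.integrableOn (by fun_prop)
    calc ∫ x in S', g x ≤ ∫ x in S', √(m + 1) / 2 *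
          (1 + (1 + ‖Matrix.toEuclideanCLM (𝕜 := ℝ) A (x - c)‖ ^ 2) / (m + 1)) := by
          refine integral_mono (hK.integrableOn hgc) (hK.integrableOn (by fun_prop)) fun x => ?_
          exact sqrt_one_add_le _ _ (by positivity) (by positivity)
      _ = √(m + 1) / 2 * (s + (s +
          ∫ x in S', ‖Matrix.toEuclideanCLM (𝕜 := ℝ) A (x - c)‖ ^ 2) / (m + 1)) := by
          have hd : IntegrableOn (fun x =>
              (1 + ‖Matrix.toEuclideanCLM (𝕜 := ℝ) A (x - c)‖ ^ 2) / ((m : ℝ) + 1)) S' :=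
            hK.integrableOn (by fun_prop)
          rw [integral_const_mul, integral_add hc' hd, integral_div,
            integral_add hc' hi]
          simp [hs]
      _ ≤ √(m + 1) / 2 * (s + (s + m * s) / (m + 1)) := by gcongr
      _ = √(m + 1) * s := by
          field_simp
          ring
  have hgl : ∫⁻ v : Fin m → ℝ, S.indicator 1 v * ENNReal.ofReal (g (WithLp.toLp 2 v)) ≤
      ENNReal.ofReal (√(m + 1)) * volume S := by
    have e : ∀ v : Fin m → ℝ, S.indicator 1 v * ENNReal.ofReal (g (WithLp.toLp 2 v)) =
        S'.indicator (fun x => ENNReal.ofReal (g x)) (WithLp.toLp 2 v) := by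
      intro v
      by_cases hv : v ∈ S
      · have hv' : WithLp.toLp 2 v ∈ S' := hv
        simp [hv, hv']
      · have hv' : WithLp.toLp 2 v ∉ S' := hv
        simp [hv, hv']
    simp_rw [e]
    rw [hpres.lintegral_comp (Measurable.indicator (by fun_prop) hK.meas),
      lintegral_indicator hK.meas, ← ofReal_integral_eq_lintegral_ofReal (hK.integrableOn hgc)
        (Eventually.of_forall fun x => by positivity), ← hsS, ← ENNReal.ofReal_mul (by positivity)]
    exact ENNReal.ofReal_le_ofReal hgi
  have hSm : Measurable (S.indicator (1 : (Fin m → ℝ) → ℝ≥0∞)) :=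
    measurable_one.indicator hS.measurableSet
  have hfm : Measurable fun v : Fin m → ℝ =>
      S.indicator 1 v * ENNReal.ofReal (g (WithLp.toLp 2 v)) := hSm.mul (by fun_prop)
  set J := ∫⁻ u : Fin (m + 1) → Fin m → ℝ,
    ENNReal.ofReal |(homMat u).det| * ∏ i, S.indicator 1 (u i) with hJ
  have hkey : ENNReal.ofReal |A.det| * J ≤ (ENNReal.ofReal (√(m + 1)) * volume S) ^ (m + 1) := by
    calc ENNReal.ofReal |A.det| * J
        = ∫⁻ u : Fin (m + 1) → Fin m → ℝ, ENNReal.ofReal |A.det| *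
          (ENNReal.ofReal |(homMat u).det| * ∏ i, S.indicator 1 (u i)) :=
          (lintegral_const_mul' _ _ ENNReal.ofReal_ne_top).symm
      _ ≤ ∫⁻ u : Fin (m + 1) → Fin m → ℝ,
          ∏ i, (S.indicator 1 (u i) * ENNReal.ofReal (g (WithLp.toLp 2 (u i)))) := by
          refine lintegral_mono fun u => ?_
          rw [Finset.prod_mul_distrib, ← mul_assoc, mul_comm, ← ENNReal.ofReal_mul (abs_nonneg _),
            ← ENNReal.ofReal_prod_of_nonneg fun i _ => by positivity, mul_comm |A.det|]
          gcongr
          exact abs_det_homMat_mul_le u A c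
      _ = (∫⁻ v : Fin m → ℝ, S.indicator 1 v * ENNReal.ofReal (g (WithLp.toLp 2 v))) ^ (m + 1) :=
          lintegral_pi_prod hfm _
      _ ≤ _ := by gcongr
  set C := (4 * 10 ^ 19 * √√(m : ℝ)) ^ m with hC
  have hC0 : 0 < C := by
    have : (0 : ℝ) < m := by exact_mod_cast hm
    positivity
  have hone : (1 : ℝ≥0∞) ≤ ENNReal.ofReal |A.det| * volume S * ENNReal.ofReal C := by
    rw [← hsS, ← ENNReal.ofReal_mul (abs_nonneg _), ← ENNReal.ofReal_mul (by positivity),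
      ← ENNReal.ofReal_one]
    refine ENNReal.ofReal_le_ofReal ?_
    rwa [inv_le_iff_one_le_mul₀ hC0] at hdet
  calc J = 1 * J := (one_mul _).symm
    _ ≤ ENNReal.ofReal |A.det| * volume S * ENNReal.ofReal C * J := by gcongr
    _ = (ENNReal.ofReal |A.det| * J) * (volume S * ENNReal.ofReal C) := by ring
    _ ≤ (ENNReal.ofReal (√(m + 1)) * volume S) ^ (m + 1) * (volume S * ENNReal.ofReal C) := by
        gcongr
    _ = _ := by
        clear_value C
        rw [ENNReal.ofReal_mul (by positivity), ENNReal.ofReal_pow (by positivity)]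
        ring

lemma slice_properties {O : Set (Euc (m + 1))} (hO : IsOpen O) (hc : Convex ℝ O)
    (hb : Bornology.IsBounded O) (w : Fin (m + 1) → ℝ) :
    IsOpen (slice O w) ∧ Convex ℝ (slice O w) ∧ Bornology.IsBounded (slice O w) := by
  refine ⟨hO.preimage (continuous_pt_graph.comp (by fun_prop : Continuous fun v => (w, v))), ?_, ?_⟩
  · intro x hx y hy a b ha hb hab
    have h := hc hx hy ha hb hab
    have e : pt (height w (a • x + b • y), a • x + b • y) =
        a • pt (height w x, x) + b • pt (height w y, y) := by
      ext i
      refine Fin.cases ?_ (fun i => ?_) i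
      · simp only [pt, height, Matrix.cons_val_zero, Pi.add_apply, Pi.smul_apply, smul_eq_mul,
          PiLp.add_apply, PiLp.smul_apply, add_mul, Finset.sum_add_distrib, mul_add,
          Finset.mul_sum, mul_assoc]
        linear_combination -hab * w 0
      · simp [pt]
    change pt _ ∈ O
    rwa [e]
  · obtain ⟨R, hR⟩ := hb.exists_norm_le
    refine (Metric.isBounded_closedBall (x := (0 : Fin m → ℝ)) (r := max R 0)).subset ?_
    intro v hv
    rw [mem_closedBall_zero_iff, pi_norm_le_iff_of_nonneg (le_max_right _ _)]
    exact fun i => (PiLp.norm_apply_le (pt (height w v, v)) i.succ).trans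
      ((hR _ hv).trans (le_max_left _ _))

theorem one_le_lintegral_volume_slice (hm : 0 < m) {O : Set (Euc (m + 1))} (hO : IsOpen O)
    (hc : Convex ℝ O) (hb : Bornology.IsBounded O) (hv : volume O = 1) :
    1 ≤ ENNReal.ofReal (√(m + 1) ^ (m + 1) * (4 * 10 ^ 19 * √√m) ^ m) *
      ∫⁻ w, volume (slice O w) ^ (m + 2) := by
  have hI : Measurable (O.indicator (1 : Euc (m + 1) → ℝ≥0∞)) :=
    measurable_one.indicator hO.measurableSet
  have hIp : Measurable fun p : ℝ × (Fin m → ℝ) => O.indicator (1 : Euc (m + 1) → ℝ≥0∞) (pt p) :=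
    hI.comp measurePreserving_pt.measurable
  have hp : Measurable fun X : Fin (m + 1) → ℝ × (Fin m → ℝ) =>
      ∏ i, O.indicator (1 : Euc (m + 1) → ℝ≥0∞) (pt (X i)) :=
    Finset.measurable_fun_prod _ fun i _ => hIp.comp (measurable_pi_apply i)
  have h1 : ∫⁻ X : Fin (m + 1) → ℝ × (Fin m → ℝ), ∏ i, O.indicator 1 (pt (X i)) = 1 := by
    rw [lintegral_pi_prod hIp, measurePreserving_pt.lintegral_comp hI,
      lintegral_indicator_one hO.measurableSet, hv, one_pow]
  rw [← lintegral_const_mul _ ((measurable_volume_slice hO.measurableSet).pow_const _), ← h1,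
    lintegral_eq_lintegral_graph hp]
  refine lintegral_mono fun w => ?_
  obtain ⟨ho, hcv, hbd⟩ := slice_properties hO hc hb w
  exact lintegral_abs_det_homMat_le hm ho hcv hbd

end

noncomputable section

variable {m : ℕ}

lemma volume_interior_of_convex {d : ℕ} {K : Set (Euc d)} (hK : Convex ℝ K) :
    volume (interior K) = volume K := by
  refine measure_congr (interior_ae_eq_of_null_frontier (hK.addHaar_frontier volume))

lemma EH_eq {d : ℕ} [NeZero d] {K : Set (Euc d)} (hv : volume K = 1) (N : ℕ) :
    EH d (d + 1) K (N + (d + 1)) =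
      (N + (d + 1)).choose (d + 1) * (avoidIntegral K N).toReal := by
  have hu : unif K = volume.restrict K := by simp [unif, hv]
  have : IsProbabilityMeasure (volume.restrict K) := ⟨by simp [hv]⟩
  rw [EH, hu, integral_holeCount (pi_absolutelyContinuous_volume _), avoidIntegral]

lemma div_factorial_le_liminf_EH {K : Set (Euc (m + 1))} (hK : Convex ℝ K) (hc : IsCompact K)
    (hv : volume K = 1) {L : ℝ}
    (hL : ENNReal.ofReal L ≤ liminf (fun N : ℕ => N * avoidIntegral K N) atTop) :
    L / (m + 2).factorial ≤
      liminf (fun n : ℕ => EH (m + 1) (m + 1 + 1) K n / (n : ℝ) ^ (m + 1)) atTop := by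
  obtain ⟨C, hC, hCle⟩ := exists_mul_avoidIntegral_le hK hc hv
  set u : ℕ → ℝ := fun n => EH (m + 1) (m + 1 + 1) K n / (n : ℝ) ^ (m + 1) with hu
  rw [← liminf_nat_add u (m + 2)]
  set s : ℕ → ℝ := fun N =>
    ((N + (m + 2)).choose (m + 2) : ℝ) / ((N + (m + 2) : ℕ) : ℝ) ^ (m + 2) with hs
  have hs_nonneg : ∀ N, 0 ≤ s N := fun N => by positivity
  have hs_tendsto : Tendsto s atTop (nhds (1 / (m + 2).factorial)) := by
    have h := ((Asymptotics.isEquivalent_iff_tendsto_one ?_).1 (isEquivalent_choose (m + 2)))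
    · have h' := (h.mul_const (1 / ((m + 2).factorial : ℝ))).comp (tendsto_add_atTop_nat (m + 2))
      rw [one_mul] at h'
      refine h'.congr fun N => ?_
      simp only [hs, Function.comp_apply, Pi.div_apply]
      field_simp
    · filter_upwards [eventually_ge_atTop 1] with n hn
      have : (0 : ℝ) < n := by exact_mod_cast hn
      positivity
  have hs_le : ∀ N, s N ≤ 1 := fun N => by
    refine div_le_one_of_le₀ ?_ (by positivity)
    exact_mod_cast Nat.choose_le_pow _ _
  have hf_ne : ∀ N : ℕ, N ≠ 0 → N * avoidIntegral K N ≠ ∞ := fun N hN =>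
    ne_top_of_le_ne_top hC (hCle N hN)
  have hu_eq : ∀ N : ℕ, N ≠ 0 → u (N + (m + 2)) =
      s N * (((N + (m + 2) : ℕ) : ℝ) / N * ((N : ℝ≥0∞) * avoidIntegral K N).toReal) := by
    intro N hN
    have hN' : (N : ℝ) ≠ 0 := by exact_mod_cast hN
    have hn : ((N + (m + 2) : ℕ) : ℝ) ≠ 0 := by positivity
    simp only [hu, hs]
    rw [show N + (m + 2) = N + (m + 1 + 1) from rfl, EH_eq hv, ENNReal.toReal_mul,
      ENNReal.toReal_natCast]
    field_simp
    ring
  have hcob : IsCoboundedUnder (· ≥ ·) atTop fun N => u (N + (m + 2)) := by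
    refine IsBoundedUnder.isCoboundedUnder_ge
      (isBoundedUnder_of_eventually_le (a := 1 * ((m + 3) * C.toReal)) ?_)
    filter_upwards [eventually_ge_atTop 1] with N hN
    rw [hu_eq N (by lia)]
    have hN' : (1 : ℝ) ≤ N := by exact_mod_cast hN
    gcongr
    · exact hs_le N
    · rw [div_le_iff₀ (by positivity)]
      push_cast
      nlinarith [(Nat.cast_nonneg m : (0 : ℝ) ≤ m)]
    · exact hCle N (by lia)
  refine le_of_forall_lt fun b hb => ?_
  have hfac : (0 : ℝ) < (m + 2).factorial := by positivity
  obtain ⟨b', hbb', hb'⟩ := exists_between hb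
  refine hbb'.trans_le ?_
  by_cases h0 : b' < 0
  · refine le_liminf_of_le hcob ?_
    filter_upwards [eventually_ge_atTop 1] with N hN
    rw [hu_eq N (by lia)]
    exact h0.le.trans (mul_nonneg (hs_nonneg N) (by positivity))
  push Not at h0
  rw [lt_div_iff₀ hfac] at hb'
  set a := b' * (m + 2).factorial with ha
  have ha0 : 0 ≤ a := by positivity
  have hlt : ENNReal.ofReal a < liminf (fun N : ℕ => N * avoidIntegral K N) atTop :=
    ((ENNReal.ofReal_lt_ofReal_iff_of_nonneg ha0).2 hb').trans_le hL
  have hev := eventually_lt_of_lt_liminf hlt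
  have hlim : Tendsto (fun N => s N * a) atTop (nhds b') := by
    convert hs_tendsto.mul_const a using 2
    rw [ha]
    field_simp
  rw [← hlim.liminf_eq]
  refine liminf_le_liminf ?_ hlim.isBoundedUnder_ge hcob
  filter_upwards [hev, eventually_ge_atTop 1] with N h hN
  rw [hu_eq N (by lia)]
  have hN' : (1 : ℝ) ≤ N := by exact_mod_cast hN
  have h1 : a ≤ ((N : ℝ≥0∞) * avoidIntegral K N).toReal := by
    rw [← ENNReal.ofReal_le_iff_le_toReal (hf_ne N (by lia))]
    exact h.le
  refine mul_le_mul_of_nonneg_left ?_ (hs_nonneg N)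
  refine h1.trans (le_mul_of_one_le_left ENNReal.toReal_nonneg ?_)
  rw [le_div_iff₀ (by positivity)]
  push_cast
  nlinarith [(Nat.cast_nonneg m : (0 : ℝ) ≤ m)]

lemma natCast_pow_le_three_pow_mul_factorial (d : ℕ) :
    (d : ℝ) ^ d ≤ 3 ^ d * d.factorial := by
  have h := Real.pow_div_factorial_le_exp (d : ℝ) d.cast_nonneg d
  rw [div_le_iff₀ (by positivity)] at h
  refine h.trans ?_
  gcongr
  rw [← Real.exp_one_pow]
  gcongr
  exact Real.exp_one_lt_three.le

lemma target_le (hm : 0 < m) :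
    (2 / (((m + 1 : ℕ) : ℝ) + 2) / (m.factorial : ℝ)) *
      (((m + 1 : ℕ) : ℝ) ^ ((1 : ℝ) / 4) / (10 ^ 21 * Real.log (m + 1 : ℕ))) ^ (m + 1) ≤
    2 / refVol (m + 1) * (√(m + 1) ^ (m + 1) * (4 * 10 ^ 19 * √√m) ^ m)⁻¹ /
      (m + 2).factorial := by
  set q : ℝ := √√(m + 1) with hq
  have hm1 : (1 : ℝ) ≤ m := by exact_mod_cast hm
  have hq2 : q ^ 2 = √(m + 1) := Real.sq_sqrt (by positivity)
  have hq4 : q ^ 4 = m + 1 := by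
    rw [show q ^ 4 = (q ^ 2) ^ 2 by ring, hq2, Real.sq_sqrt (by positivity)]
  have hq1 : 1 ≤ q := by
    rw [hq, Real.one_le_sqrt, Real.one_le_sqrt]; linarith
  have hq0 : 0 < q := by linarith
  have hqr : ((m + 1 : ℕ) : ℝ) ^ ((1 : ℝ) / 4) = q := by
    rw [hq, Real.sqrt_eq_rpow, Real.sqrt_eq_rpow, ← Real.rpow_mul (by positivity)]
    norm_num
  have hlog : (1 / 2 : ℝ) ≤ Real.log (m + 1 : ℕ) := by
    have h2 : Real.log 2 ≤ Real.log (m + 1 : ℕ) :=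
      Real.log_le_log (by norm_num) (by push_cast; linarith)
    linarith [Real.log_two_gt_d9]
  have hA : √(m + 1) ^ (m + 1) * (4 * 10 ^ 19 * √√m) ^ m ≤ (4 * 10 ^ 19 * q ^ 3) ^ (m + 1) := by
    have h1 : (4 * 10 ^ 19 * √√m) ^ m ≤ (4 * 10 ^ 19 * q) ^ (m + 1) := by
      calc (4 * 10 ^ 19 * √√m) ^ m ≤ (4 * 10 ^ 19 * q) ^ m := by
            gcongr
            exact Real.sqrt_le_sqrt (Real.sqrt_le_sqrt (by linarith))
        _ ≤ _ := pow_le_pow_right₀ (by linarith) (by lia)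
    rw [← hq2]
    calc _ ≤ (q ^ 2) ^ (m + 1) * (4 * 10 ^ 19 * q) ^ (m + 1) := by gcongr
      _ = _ := by rw [← mul_pow]; ring
  have hApos : 0 < √((m : ℝ) + 1) ^ (m + 1) * (4 * 10 ^ 19 * √√m) ^ m := by positivity
  have hv := refVol_le (m + 1)
  have hv0 := refVol_pos (m + 1)
  have hfac := natCast_pow_le_three_pow_mul_factorial (m + 1)
  have hd : ((m : ℝ) + 1) ≤ 2 ^ (m + 1) := by
    exact_mod_cast (Nat.lt_two_pow_self (n := m + 1)).le
  have hR : 2 / ((m + 2) * (8 * 10 ^ 19 * q ^ 3) ^ (m + 1)) ≤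
      2 / refVol (m + 1) * (√(m + 1) ^ (m + 1) * (4 * 10 ^ 19 * √√m) ^ m)⁻¹ /
      (m + 2).factorial := by
    rw [← div_eq_mul_inv, div_div, div_div]
    refine div_le_div_of_nonneg_left (by norm_num) (by positivity) ?_
    calc refVol (m + 1) * (√(m + 1) ^ (m + 1) * (4 * 10 ^ 19 * √√m) ^ m * (m + 2).factorial)
        ≤ (2 ^ (m + 1) / (m + 1).factorial) * (4 * 10 ^ 19 * q ^ 3) ^ (m + 1) *
          (m + 2).factorial := by rw [← mul_assoc]; gcongr
      _ = (m + 2) * (8 * 10 ^ 19 * q ^ 3) ^ (m + 1) := by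
          rw [Nat.factorial_succ (m + 1),
            show (8 * 10 ^ 19 * q ^ 3 : ℝ) = 2 * (4 * 10 ^ 19 * q ^ 3) by ring, mul_pow 2]
          push_cast
          field_simp
          ring
  refine le_trans ?_ hR
  rw [hqr, div_div, div_pow, div_mul_div_comm]
  rw [div_le_div_iff₀ (by positivity) (by positivity)]
  have key : (q * (8 * 10 ^ 19 * q ^ 3)) ^ (m + 1) ≤
      m.factorial * (10 ^ 21 * Real.log (m + 1 : ℕ)) ^ (m + 1) := by
    calc (q * (8 * 10 ^ 19 * q ^ 3)) ^ (m + 1)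
        = (8 * 10 ^ 19 : ℝ) ^ (m + 1) * ((m + 1 : ℕ) : ℝ) ^ (m + 1) := by
          rw [← mul_pow]; push_cast; rw [← hq4]; ring
      _ ≤ (8 * 10 ^ 19 : ℝ) ^ (m + 1) * (3 ^ (m + 1) * (2 ^ (m + 1) * m.factorial)) := by
          refine mul_le_mul_of_nonneg_left (hfac.trans ?_) (by positivity)
          rw [Nat.factorial_succ]
          push_cast
          gcongr
      _ = m.factorial * (48 * 10 ^ 19 : ℝ) ^ (m + 1) := by
          rw [show (48 * 10 ^ 19 : ℝ) = 8 * 10 ^ 19 * (3 * 2) by norm_num, mul_pow (8 * 10 ^ 19 : ℝ),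
            mul_pow (3 : ℝ)]
          generalize (8 * 10 ^ 19 : ℝ) ^ (m + 1) = x
          ring
      _ ≤ _ := mul_le_mul_of_nonneg_left
          (pow_le_pow_left₀ (by positivity) (by linarith) _) (by positivity)
  push_cast at key ⊢
  calc 2 * q ^ (m + 1) * ((m + 2) * (8 * 10 ^ 19 * q ^ 3) ^ (m + 1))
      = 2 * (m + 2) * (q * (8 * 10 ^ 19 * q ^ 3)) ^ (m + 1) := by rw [mul_pow q]; ring
    _ ≤ 2 * (m + 1 + 2) * (m.factorial * (10 ^ 21 * Real.log (m + 1)) ^ (m + 1)) := by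
        gcongr; linarith
    _ = _ := by ring

end

/-- There is `c > 0` such that for every `d ≥ 2` and every convex body
`K ⊆ ℝ^d` of unit volume,
`liminf n^{-d} EH^K_{d,d+1}(n) ≥ (2/((d+2)(d-1)!)) · (d^{1/4}/(c log d))^d`. -/
theorem statement4 :
    ∃ c : ℝ, 0 < c ∧ ∀ d : ℕ, 2 ≤ d → ∀ K : Set (Euc d),
      IsConvexBody K → volume K = 1 →
      (2 / (((d : ℝ) + 2) * (Nat.factorial (d - 1) : ℝ))) *
          ((d : ℝ) ^ ((1 : ℝ) / 4) / (c * Real.log d)) ^ d ≤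
        Filter.liminf (fun n : ℕ => EH d (d + 1) K n / (n : ℝ) ^ d) Filter.atTop := by
  refine ⟨10 ^ 21, by norm_num, ?_⟩
  rintro d hd K ⟨hK, hc, -⟩ hv
  obtain ⟨m, rfl⟩ : ∃ m, d = m + 1 := ⟨d - 1, by lia⟩
  have hm : 0 < m := by lia
  have hI := one_le_lintegral_volume_slice hm isOpen_interior hK.interior
    (hc.isBounded.subset interior_subset) ((volume_interior_of_convex hK).trans hv)
  set A : ℝ := √(m + 1) ^ (m + 1) * (4 * 10 ^ 19 * √√m) ^ m with hA
  have hm0 : (0 : ℝ) < m := by exact_mod_cast hm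
  have hA0 : 0 < A := by positivity
  have hI' : ENNReal.ofReal A⁻¹ ≤ ∫⁻ w, volume (slice (interior K) w) ^ (m + 2) := by
    rw [ENNReal.ofReal_inv_of_pos hA0, ← one_div]
    exact ENNReal.div_le_of_le_mul' hI
  have hv0 := refVol_pos (m + 1)
  refine le_trans ?_ (div_factorial_le_liminf_EH hK hc hv (L := 2 / refVol (m + 1) * A⁻¹) ?_)
  · rw [← div_div]
    exact target_le hm
  · rw [ENNReal.ofReal_mul (by positivity)]
    exact le_trans (by gcongr) (le_liminf_mul_avoidIntegral hK hc.measurableSet hv)
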